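/- There exist a constant c > 0 and an integer N₀ such that for every integer N ≥ N₀ the following holds: if A₁, A₂, A₃ ⊆ [N] are subsets with |A₁|, |A₂|, |A₃| ≥ N^{1/3−c}, then the sumset A₁ + A₂ + A₃ = {a₁ + a₂ + a₃ : a₁ ∈ A₁, a₂ ∈ A₂, a₃ ∈ A₃} contains a composite number, i.e., an integer n > 1 that is not prime. -/

import Mathlib

/-- The total Mertens weight of a set of integers. -/
noncomputable def mertensWeight (S : Finset ℕ) : ℝ := ∑ p ∈ S, Real.log p / p

lemma log_factorial_eq_sum_primesLE (n : ℕ) :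
    Real.log n.factorial = ∑ p ∈ n.primesLE, (n.factorial.factorization p : ℝ) * Real.log p := by
  rw [Real.log_nat_eq_sum_factorization, Finsupp.sum]
  refine Finset.sum_subset ?_ ?_
  · intro p hp
    have hp' := Nat.support_factorization n.factorial ▸ hp
    have h1 := Nat.prime_of_mem_primeFactors hp'
    have h2 := Nat.dvd_of_mem_primeFactors hp'
    rw [Nat.mem_primesLE]
    exact ⟨(h1.dvd_factorial).1 h2, h1⟩
  · intro p _ hp
    rw [Finsupp.notMem_support_iff] at hp
    simp [hp]

lemma mertensWeight_primesLE_le (n : ℕ) (hn : 1 ≤ n) :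
    mertensWeight n.primesLE ≤ Real.log n + Real.log 4 := by
  have h1 : ∑ p ∈ n.primesLE, ((n : ℝ) / p - 1) * Real.log p ≤ Real.log n.factorial := by
    rw [log_factorial_eq_sum_primesLE]
    refine Finset.sum_le_sum fun p hp => ?_
    obtain ⟨hpn, hp⟩ := (Nat.mem_primesLE).1 hp
    refine mul_le_mul_of_nonneg_right ?_ (Real.log_natCast_nonneg p)
    have h2 : n / p ≤ n.factorial.factorization p := by
      rw [Nat.factorization_factorial hp (Nat.lt_succ_self _)]
      have h1 : 1 ∈ Finset.Ico 1 (Nat.log p n).succ := by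
        simp only [Finset.mem_Ico, le_refl, true_and, Nat.succ_eq_add_one]
        have := Nat.log_pos hp.one_lt hpn
        omega
      have := Finset.single_le_sum (f := fun i => n / p ^ i) (fun i _ => Nat.zero_le _) h1
      simpa using this
    have h3 : (n : ℝ) / p - 1 < ((n / p : ℕ) : ℝ) := by
      rw [sub_lt_iff_lt_add, div_lt_iff₀ (by exact_mod_cast hp.pos)]
      exact_mod_cast Nat.lt_div_mul_add hp.pos |>.trans_le (by ring_nf; rfl)
    have h4 : ((n / p : ℕ) : ℝ) ≤ n.factorial.factorization p := by exact_mod_cast h2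
    linarith
  have h2 : Real.log n.factorial ≤ n * Real.log n := by
    rw [← Real.log_pow]
    refine Real.log_le_log (by exact_mod_cast n.factorial_pos) ?_
    exact_mod_cast Nat.factorial_le_pow n
  have h3 := Chebyshev.theta_le_log4_mul_x (x := n) (by positivity)
  rw [Chebyshev.theta_eq_sum_primesLE_log] at h3
  have h4 : ∑ p ∈ n.primesLE, ((n : ℝ) / p - 1) * Real.log p =
      n * mertensWeight n.primesLE - ∑ p ∈ n.primesLE, Real.log p := by
    rw [mertensWeight, Finset.mul_sum, ← Finset.sum_sub_distrib]
    refine Finset.sum_congr rfl fun p _ => ?_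
    ring
  rw [h4] at h1
  have hn' : (0 : ℝ) < n := by exact_mod_cast hn
  have : (n : ℝ) * mertensWeight n.primesLE ≤ n * (Real.log n + Real.log 4) := by linarith
  exact le_of_mul_le_mul_left this hn'

lemma exists_le_mertensWeight_primesLE :
    ∃ C : ℝ, ∀ n : ℕ, 1 ≤ n → Real.log n - C ≤ mertensWeight n.primesLE := by
  have hs : Summable fun p : ℕ => 4 * ((p : ℝ) ^ (3 / 2 : ℝ))⁻¹ :=
    (Real.summable_nat_rpow_inv.2 (by norm_num)).mul_left 4
  refine ⟨1 + ∑' p : ℕ, 4 * ((p : ℝ) ^ (3 / 2 : ℝ))⁻¹, fun n hn => ?_⟩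
  have hn' : (0 : ℝ) < n := by exact_mod_cast hn
  have h1 : Real.log n.factorial ≤
      ∑ p ∈ n.primesLE, n * (Real.log p / p + 4 * ((p : ℝ) ^ (3 / 2 : ℝ))⁻¹) := by
    rw [log_factorial_eq_sum_primesLE]
    refine Finset.sum_le_sum fun p hp => ?_
    obtain ⟨hpn, hp⟩ := (Nat.mem_primesLE).1 hp
    have hp2 : (2 : ℝ) ≤ p := by exact_mod_cast hp.two_le
    have hp0 : (0 : ℝ) < p := by linarith
    have h2 : (n.factorial.factorization p : ℝ) ≤ n / (p - 1) := by
      have := Nat.factorization_factorial_le_div_pred hp n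
      calc (n.factorial.factorization p : ℝ) ≤ ((n / (p - 1) : ℕ) : ℝ) := by exact_mod_cast this
        _ ≤ (n : ℝ) / ((p - 1 : ℕ) : ℝ) := Nat.cast_div_le
        _ = n / (p - 1) := by rw [Nat.cast_sub hp.one_le]; simp
    have hlog : Real.log p ≤ 2 * Real.sqrt p := by
      have := Real.log_le_sub_one_of_pos (Real.sqrt_pos.2 hp0)
      rw [Real.log_sqrt hp0.le] at this
      linarith
    have hlog0 : 0 ≤ Real.log p := Real.log_natCast_nonneg p
    have hpw : (p : ℝ) ^ (3 / 2 : ℝ) = p * Real.sqrt p := by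
      rw [Real.sqrt_eq_rpow, show (3 / 2 : ℝ) = 1 + 1 / 2 by norm_num, Real.rpow_add hp0,
        Real.rpow_one]
    have hsq : 0 < Real.sqrt p := Real.sqrt_pos.2 hp0
    have hss : Real.sqrt p * Real.sqrt p = p := Real.mul_self_sqrt hp0.le
    refine (mul_le_mul_of_nonneg_right h2 hlog0).trans ?_
    rw [div_mul_eq_mul_div, mul_div_assoc]
    refine mul_le_mul_of_nonneg_left ?_ hn'.le
    rw [hpw]
    have h5 : Real.log p / (p - 1) = Real.log p / p + Real.log p / (p * (p - 1)) := by
      have : (p : ℝ) - 1 ≠ 0 := by linarith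
      field_simp
      ring
    rw [h5]
    refine add_le_add le_rfl ?_
    rw [div_le_iff₀ (by nlinarith), ← div_eq_mul_inv, div_mul_eq_mul_div, le_div_iff₀ (by positivity)]
    have : Real.log p * (p * Real.sqrt p) ≤ 2 * Real.sqrt p * (p * Real.sqrt p) :=
      mul_le_mul_of_nonneg_right hlog (by positivity)
    nlinarith
  have h2 : (n : ℝ) * Real.log n - n ≤ Real.log n.factorial := by
    have := Stirling.le_log_factorial_stirling (n := n) (by omega)
    have h3 : 0 ≤ Real.log n := Real.log_natCast_nonneg n
    have h4 : 0 ≤ Real.log (2 * Real.pi) := Real.log_nonneg (by nlinarith [Real.pi_gt_three])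
    linarith
  rw [← Finset.mul_sum, Finset.sum_add_distrib] at h1
  have h3 : ∑ p ∈ n.primesLE, 4 * ((p : ℝ) ^ (3 / 2 : ℝ))⁻¹ ≤
      ∑' p : ℕ, 4 * ((p : ℝ) ^ (3 / 2 : ℝ))⁻¹ := hs.sum_le_tsum _ fun p _ => by positivity
  have h4 : (n : ℝ) * (Real.log n - 1) ≤
      n * (mertensWeight n.primesLE + ∑' p : ℕ, 4 * ((p : ℝ) ^ (3 / 2 : ℝ))⁻¹) := by
    refine le_trans (by linarith) (h1.trans (mul_le_mul_of_nonneg_left ?_ hn'.le))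
    exact add_le_add le_rfl h3
  have := le_of_mul_le_mul_left h4 hn'
  linarith

/-- Mertens' first theorem. -/
lemma exists_abs_mertensWeight_sub_log_le :
    ∃ C : ℝ, 0 < C ∧ ∀ x : ℝ, 1 ≤ x → |mertensWeight ⌊x⌋₊.primesLE - Real.log x| ≤ C := by
  obtain ⟨C, hC⟩ := exists_le_mertensWeight_primesLE
  refine ⟨max (C + 1) 2, by positivity, fun x hx => ?_⟩
  have hf : 1 ≤ ⌊x⌋₊ := (Nat.one_le_floor_iff x).2 hx
  have hf0 : (1 : ℝ) ≤ (⌊x⌋₊ : ℝ) := by exact_mod_cast hf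
  have h1 := hC _ hf
  have h2 := mertensWeight_primesLE_le _ hf
  have h3 : Real.log ⌊x⌋₊ ≤ Real.log x :=
    Real.log_le_log (by linarith) (Nat.floor_le (by linarith))
  have h4 : Real.log x ≤ Real.log ⌊x⌋₊ + 1 := by
    have : x ≤ 2 * (⌊x⌋₊ : ℝ) := by linarith [Nat.lt_floor_add_one x]
    have h5 := Real.log_le_log (by linarith) this
    rw [Real.log_mul (by norm_num) (by linarith)] at h5
    linarith [Real.log_two_lt_d9]
  have h5 : Real.log 4 ≤ 2 := by
    rw [show (4 : ℝ) = 2 * 2 by norm_num, Real.log_mul (by norm_num) (by norm_num)]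
    linarith [Real.log_two_lt_d9]
  rw [abs_le]
  constructor
  · linarith [le_max_left (C + 1) 2]
  · linarith [le_max_right (C + 1) 2]

/-- The number of pairs of elements of `R` that are congruent modulo `p`. -/
def collisions (R : Finset ℕ) (p : ℕ) : ℕ :=
  ((R ×ˢ R).filter fun x => (x.1 : ZMod p) = x.2).card

/-- The reduction of a set of integers modulo `p`. -/
def residues (p : ℕ) (R : Finset ℕ) : Finset (ZMod p) := R.image (Nat.cast : ℕ → ZMod p)

lemma collisions_eq_sum_sq (R : Finset ℕ) (p : ℕ) :
    collisions R p = ∑ r ∈ residues p R, (R.filter fun a : ℕ => (a : ZMod p) = r).card ^ 2 := by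
  rw [collisions, Finset.card_eq_sum_card_fiberwise (f := fun x => (x.1 : ZMod p))
    (t := residues p R)]
  · refine Finset.sum_congr rfl fun r _ => ?_
    rw [sq, ← Finset.card_product]
    congr 1
    ext ⟨a, b⟩
    simp only [Finset.mem_filter, Finset.mem_product]
    constructor
    · rintro ⟨⟨⟨h1, h2⟩, h3⟩, h4⟩
      exact ⟨⟨h1, h4⟩, h2, h3 ▸ h4⟩
    · rintro ⟨⟨h1, h4⟩, h2, h3⟩
      exact ⟨⟨⟨h1, h2⟩, h4.trans h3.symm⟩, h4⟩
  · intro x hx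
    have hx := Finset.mem_coe.1 hx
    rw [Finset.mem_filter, Finset.mem_product] at hx
    exact Finset.mem_coe.2 (Finset.mem_image_of_mem _ hx.1.1)

lemma sq_card_le_card_residues_mul_collisions (R : Finset ℕ) (p : ℕ) :
    R.card ^ 2 ≤ (residues p R).card * collisions R p := by
  rw [collisions_eq_sum_sq]
  have h : R.card = ∑ r ∈ residues p R, (R.filter fun a : ℕ => (a : ZMod p) = r).card :=
    Finset.card_eq_sum_card_fiberwise fun x hx =>
      Finset.mem_coe.2 (Finset.mem_image_of_mem _ (Finset.mem_coe.1 hx))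
  rw [h]
  exact sq_sum_le_card_mul_sum_sq

lemma sum_log_filter_dvd_le (P : Finset ℕ) (hP : ∀ p ∈ P, p.Prime) (m : ℕ) (hm : m ≠ 0) :
    ∑ p ∈ P.filter (· ∣ m), Real.log p ≤ Real.log m := by
  rw [Real.log_nat_eq_sum_factorization, Finsupp.sum, Nat.support_factorization]
  have hsub : P.filter (· ∣ m) ⊆ m.primeFactors := by
    intro p hp
    rw [Finset.mem_filter] at hp
    exact Nat.mem_primeFactors.2 ⟨hP p hp.1, hp.2, hm⟩
  calc ∑ p ∈ P.filter (· ∣ m), Real.log p ≤ ∑ p ∈ m.primeFactors, Real.log p :=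
        Finset.sum_le_sum_of_subset_of_nonneg hsub fun p _ _ => Real.log_natCast_nonneg p
    _ ≤ _ := by
      refine Finset.sum_le_sum fun p hp => ?_
      have h1 : (1 : ℝ) ≤ m.factorization p := by
        exact_mod_cast (Nat.prime_of_mem_primeFactors hp).factorization_pos_of_dvd hm
          (Nat.dvd_of_mem_primeFactors hp)
      have := Real.log_natCast_nonneg p
      nlinarith

/-- The counting inequality behind Gallagher's larger sieve. -/
lemma sum_log_mul_collisions_sub_le (P : Finset ℕ) (hP : ∀ p ∈ P, p.Prime) (N : ℕ)
    (R : Finset ℕ) (hR : R ⊆ Finset.Icc 1 N) :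
    ∑ p ∈ P, Real.log p * ((collisions R p : ℝ) - R.card) ≤ (R.card : ℝ) ^ 2 * Real.log N := by
  have h1 : ∀ p ∈ P, Real.log p * ((collisions R p : ℝ) - R.card) =
      ∑ x ∈ R.offDiag, if (x.1 : ZMod p) = x.2 then Real.log p else 0 := by
    intro p _
    have : collisions R p = R.card + (R.offDiag.filter fun x => (x.1 : ZMod p) = x.2).card := by
      rw [collisions, ← Finset.diag_union_offDiag R, Finset.filter_union,
        Finset.card_union_of_disjoint]
      · congr 1
        rw [Finset.filter_true_of_mem, Finset.diag_card]
        intro x hx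
        rw [(Finset.mem_diag.1 hx).2]
      · exact Finset.disjoint_filter_filter (Finset.disjoint_diag_offDiag R)
    rw [this, ← Finset.sum_filter, Finset.sum_const, nsmul_eq_mul]
    push_cast
    ring
  rw [Finset.sum_congr rfl h1, Finset.sum_comm]
  have h2 : ∀ x ∈ R.offDiag, (∑ p ∈ P, if (x.1 : ZMod p) = x.2 then Real.log p else 0) ≤
      Real.log N := by
    rintro ⟨a, b⟩ hx
    obtain ⟨ha, hb, hab⟩ := Finset.mem_offDiag.1 hx
    have ha := Finset.mem_Icc.1 (hR ha)
    have hb := Finset.mem_Icc.1 (hR hb)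
    dsimp only at *
    have hd : Nat.dist a b ≠ 0 := fun h => hab (Nat.eq_of_dist_eq_zero h)
    have h3 : ∀ p : ℕ, ((a : ZMod p) = b) ↔ p ∣ Nat.dist a b := by
      intro p
      rw [ZMod.natCast_eq_natCast_iff]
      rcases le_total a b with h | h
      · rw [Nat.dist_eq_sub_of_le h, ← Nat.modEq_iff_dvd' h]
      · rw [Nat.dist_eq_sub_of_le_right h, ← Nat.modEq_iff_dvd' h]
        exact ⟨Nat.ModEq.symm, Nat.ModEq.symm⟩
    simp only [h3]
    rw [← Finset.sum_filter]
    refine (sum_log_filter_dvd_le P hP _ hd).trans ?_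
    refine Real.log_le_log (by exact_mod_cast Nat.pos_of_ne_zero hd) ?_
    have : Nat.dist a b ≤ N := by unfold Nat.dist; omega
    exact_mod_cast this
  refine (Finset.sum_le_sum h2).trans ?_
  rw [Finset.sum_const, nsmul_eq_mul]
  refine mul_le_mul_of_nonneg_right ?_ (Real.log_natCast_nonneg N)
  have : R.offDiag.card ≤ R.card ^ 2 := by rw [Finset.offDiag_card, sq]; omega
  exact_mod_cast this

lemma sum_log_primes_le (P : Finset ℕ) (hP : ∀ p ∈ P, p.Prime) (n : ℕ) (hn : ∀ p ∈ P, p ≤ n) :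
    ∑ p ∈ P, Real.log p ≤ Real.log 4 * n := by
  have h := Chebyshev.theta_le_log4_mul_x (x := n) (by positivity)
  rw [Chebyshev.theta_eq_sum_primesLE_log] at h
  refine le_trans (Finset.sum_le_sum_of_subset_of_nonneg (fun p hp => ?_)
    fun p _ _ => Real.log_natCast_nonneg p) h
  exact Nat.mem_primesLE.2 ⟨hn p hp, hP p hp⟩

/-- The normalised collision density of `R` modulo `p`; it is `1` for equidistributed sets. -/
noncomputable def collisionDensity (R : Finset ℕ) (p : ℕ) : ℝ :=
  p * collisions R p / (R.card : ℝ) ^ 2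

lemma sum_mul_collisionDensity_le (P : Finset ℕ) (hP : ∀ p ∈ P, p.Prime) (N : ℕ)
    (R : Finset ℕ) (hR : R ⊆ Finset.Icc 1 N) (hR0 : R.Nonempty) (hPR : ∀ p ∈ P, p ≤ R.card) :
    ∑ p ∈ P, Real.log p / p * collisionDensity R p ≤ Real.log N + Real.log 4 := by
  have h1 := sum_log_mul_collisions_sub_le P hP N R hR
  have h2 := sum_log_primes_le P hP R.card hPR
  have hc : (0 : ℝ) < R.card := by exact_mod_cast hR0.card_pos
  have h3 : ∑ p ∈ P, Real.log p * ((collisions R p : ℝ) - R.card) =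
      ∑ p ∈ P, Real.log p * collisions R p - R.card * ∑ p ∈ P, Real.log p := by
    rw [Finset.mul_sum, ← Finset.sum_sub_distrib]
    exact Finset.sum_congr rfl fun p _ => by ring
  have h4 : ∑ p ∈ P, Real.log p / p * collisionDensity R p =
      (∑ p ∈ P, Real.log p * collisions R p) / (R.card : ℝ) ^ 2 := by
    rw [Finset.sum_div]
    refine Finset.sum_congr rfl fun p hp => ?_
    have : (p : ℝ) ≠ 0 := by exact_mod_cast (hP p hp).ne_zero
    rw [collisionDensity]
    field_simp
  rw [h4, div_le_iff₀ (by positivity)]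
  nlinarith

/-- Gallagher's larger sieve. -/
lemma sum_log_div_card_residues_le (P : Finset ℕ) (hP : ∀ p ∈ P, p.Prime) (N : ℕ)
    (R : Finset ℕ) (hR : R ⊆ Finset.Icc 1 N) (hR0 : R.Nonempty) (hPR : ∀ p ∈ P, p ≤ R.card) :
    ∑ p ∈ P, Real.log p / (residues p R).card ≤ Real.log N + Real.log 4 := by
  refine le_trans (Finset.sum_le_sum fun p hp => ?_)
    (sum_mul_collisionDensity_le P hP N R hR hR0 hPR)
  have hp0 : (0 : ℝ) < p := by exact_mod_cast (hP p hp).pos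
  have hc : (0 : ℝ) < R.card := by exact_mod_cast hR0.card_pos
  have hr : (0 : ℝ) < (residues p R).card := by
    exact_mod_cast (hR0.image _).card_pos
  have h := sq_card_le_card_residues_mul_collisions R p
  have h' : (R.card : ℝ) ^ 2 ≤ (residues p R).card * collisions R p := by exact_mod_cast h
  have h0 : Real.log p / p * collisionDensity R p =
      Real.log p * (collisions R p / (R.card : ℝ) ^ 2) := by
    rw [collisionDensity]; field_simp
  rw [h0, div_eq_mul_inv]
  refine mul_le_mul_of_nonneg_left ?_ (Real.log_natCast_nonneg p)
  rw [inv_eq_one_div, div_le_div_iff₀ hr (by positivity)]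
  linarith

section Representations

variable {G : Type*} [AddCommGroup G] [DecidableEq G]

/-- The number of representations of `x` as a sum of an element of `A` and an element of `B`. -/
def repCount (A B : Finset G) (x : G) : ℕ := (A.filter fun a => x - a ∈ B).card

lemma repCount_comm (A B : Finset G) (x : G) : repCount A B x = repCount B A x := by
  refine Finset.card_bij (fun a _ => x - a) ?_ ?_ ?_
  · intro a ha
    rw [Finset.mem_filter] at ha ⊢
    exact ⟨ha.2, by simpa using ha.1⟩
  · intro a _ b _ h
    simpa using h
  · intro b hb
    rw [Finset.mem_filter] at hb
    exact ⟨x - b, Finset.mem_filter.2 ⟨hb.2, by simpa using hb.1⟩, by simp⟩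

lemma repCount_le_left (A B : Finset G) (x : G) : repCount A B x ≤ A.card :=
  Finset.card_filter_le _ _

lemma repCount_le_right (A B : Finset G) (x : G) : repCount A B x ≤ B.card :=
  repCount_comm A B x ▸ repCount_le_left B A x

lemma sum_repCount [Fintype G] (A B : Finset G) : ∑ x, repCount A B x = A.card * B.card := by
  simp only [repCount, Finset.card_filter]
  rw [Finset.sum_comm, ← smul_eq_mul, ← Finset.sum_const]
  refine Finset.sum_congr rfl fun a _ => ?_
  rw [← Finset.card_filter]
  refine Finset.card_bij (fun x _ => x - a) ?_ ?_ ?_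
  · intro x hx
    exact (Finset.mem_filter.1 hx).2
  · intro x _ y _ h
    simpa using h
  · intro b hb
    exact ⟨b + a, by simpa using hb, by simp⟩

lemma repCount_union_left {A A' : Finset G} (h : Disjoint A A') (B : Finset G) (x : G) :
    repCount (A ∪ A') B x = repCount A B x + repCount A' B x := by
  rw [repCount, Finset.filter_union, Finset.card_union_of_disjoint
    (Finset.disjoint_filter_filter h)]
  rfl

lemma repCount_union_right {B B' : Finset G} (A : Finset G) (h : Disjoint B B') (x : G) :
    repCount A (B ∪ B') x = repCount A B x + repCount A B' x := by
  rw [repCount_comm, repCount_union_left h, repCount_comm B, repCount_comm B']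

lemma repCount_eq_union_inter_add (A B : Finset G) (x : G) :
    repCount A B x = repCount (A ∪ B) (A ∩ B) x + repCount (A \ B) (B \ A) x := by
  have key : ∀ X Y I : Finset G, Disjoint X I → Disjoint Y I → Disjoint (X ∪ I) Y →
      repCount (X ∪ I) (Y ∪ I) x = repCount (X ∪ I ∪ Y) I x + repCount X Y x := by
    intro X Y I h1 h2 h3
    rw [repCount_union_left h3, repCount_union_right _ h2, repCount_union_left h1,
      repCount_comm I Y]
    ring
  have hA : A \ B ∪ A ∩ B = A := Finset.sdiff_union_inter A B
  have hB : B \ A ∪ A ∩ B = B := by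
    rw [Finset.inter_comm]; exact Finset.sdiff_union_inter B A
  have h := key (A \ B) (B \ A) (A ∩ B) (Finset.disjoint_sdiff_inter A B)
    (by rw [Finset.inter_comm]; exact Finset.disjoint_sdiff_inter B A)
    (by rw [hA]; exact Finset.disjoint_sdiff)
  rwa [hA, hB, Finset.union_sdiff_self_eq_union] at h

end Representations

/-- Some translate of `B` meets `A` without being contained in it. -/
lemma exists_translate_inter_nonempty {p : ℕ} [Fact p.Prime] (A B : Finset (ZMod p))
    (hA : A.Nonempty) (hAp : A.card < p) (hB : 1 < B.card) :
    ∃ c : ZMod p, (A ∩ B.image (· + c)).Nonempty ∧ (A ∩ B.image (· + c)).card < B.card := by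
  by_contra! hcon
  have hsub : ∀ c : ZMod p, (A ∩ B.image (· + c)).Nonempty → B.image (· + c) ⊆ A := by
    intro c hc
    have h1 := hcon c hc
    have h2 : (B.image (· + c)).card = B.card :=
      Finset.card_image_of_injective _ (add_left_injective c)
    rw [← h2] at h1
    have := Finset.eq_of_subset_of_card_le Finset.inter_subset_right h1
    rw [← this]
    exact Finset.inter_subset_left
  obtain ⟨b, hb, b', hb', hne⟩ := Finset.one_lt_card.1 hB
  have hd : b' - b ≠ 0 := sub_ne_zero.2 hne.symm
  have hstep : ∀ a ∈ A, a + (b' - b) ∈ A := by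
    intro a ha
    refine hsub (a - b) ⟨a, ?_⟩ ?_
    · exact Finset.mem_inter.2 ⟨ha, Finset.mem_image.2 ⟨b, hb, by ring⟩⟩
    · exact Finset.mem_image.2 ⟨b', hb', by ring⟩
  have hmul : ∀ (k : ℕ) (a : ZMod p), a ∈ A → a + k * (b' - b) ∈ A := by
    intro k
    induction k with
    | zero => intro a ha; simpa using ha
    | succ k ih =>
      intro a ha
      have := hstep _ (ih a ha)
      push_cast
      convert this using 1
      ring
  obtain ⟨a, ha⟩ := hA
  have huniv : A = Finset.univ := by
    refine Finset.eq_univ_of_forall fun x => ?_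
    have := hmul ((x - a) / (b' - b)).val a ha
    rw [ZMod.natCast_zmod_val, div_mul_cancel₀ _ hd] at this
    simpa using this
  rw [huniv, Finset.card_univ, ZMod.card] at hAp
  exact lt_irrefl _ hAp

lemma sum_min_repCount_translate {p : ℕ} [Fact p.Prime] (A B : Finset (ZMod p)) (c : ZMod p)
    (t : ℕ) : ∑ x, min t (repCount A (B.image (· + c)) x) = ∑ x, min t (repCount A B x) := by
  rw [← Equiv.sum_comp (Equiv.addRight c)]
  refine Finset.sum_congr rfl fun x _ => ?_
  congr 1
  unfold repCount
  congr 1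
  refine Finset.filter_congr fun (a : ZMod p) _ => ?_
  simp only [Equiv.coe_addRight, Finset.mem_image]
  constructor
  · rintro ⟨b, hb, h⟩
    have : x - a = b := by linear_combination -h
    rwa [this]
  · intro h
    exact ⟨_, h, by ring⟩

/-- Pollard's theorem. -/
theorem pollard_sum_min_repCount {p : ℕ} [Fact p.Prime] (m : ℕ) :
    ∀ (A B : Finset (ZMod p)) (t : ℕ), B.card = m → t ≤ A.card → t ≤ B.card →
      A.card + B.card ≤ p + t →
      t * (A.card + B.card) ≤ ∑ x, min t (repCount A B x) + t * t := by
  induction m using Nat.strong_induction_on with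
  | _ m ih =>
  intro A B t hm htA htB hp
  rcases Nat.eq_zero_or_pos t with rfl | ht
  · simp
  rcases htB.eq_or_lt with h | h
  · have h1 : ∑ x, min t (repCount A B x) = A.card * B.card := by
      rw [← sum_repCount]
      refine Finset.sum_congr rfl fun x _ => min_eq_right ?_
      rw [h]
      exact repCount_le_right A B x
    rw [h1, ← h]
    nlinarith
  obtain ⟨c, hne, hlt⟩ := exists_translate_inter_nonempty A B
    (Finset.card_pos.1 (by omega)) (by omega) (by omega)
  rw [← sum_min_repCount_translate A B c t]
  have hcard : (B.image (· + c)).card = B.card :=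
    Finset.card_image_of_injective _ (add_left_injective c)
  rw [← hcard] at hm htB hp h hlt ⊢
  generalize B.image (· + c) = B' at *
  have hi := hne.card_pos
  have hUI := Finset.card_union_add_card_inter A B'
  have hA0 := Finset.card_sdiff_add_card_inter A B'
  have hB0 := Finset.card_sdiff_add_card_inter B' A
  rw [Finset.inter_comm B' A] at hB0
  rcases le_or_gt t (A ∩ B').card with hti | hti
  · have h1 := ih _ (by omega) (A ∪ B') (A ∩ B') t rfl (by omega) hti (by omega)
    rw [hUI] at h1
    refine h1.trans (Nat.add_le_add_right (Finset.sum_le_sum fun x _ => ?_) _)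
    rw [repCount_eq_union_inter_add A B']
    exact min_le_min_left _ (Nat.le_add_right _ _)
  · have h1 := ih _ (by omega) (A \ B') (B' \ A) (t - (A ∩ B').card) rfl (by omega) (by omega)
      (by omega)
    have h2 : ∑ x, (repCount (A ∪ B') (A ∩ B') x +
        min (t - (A ∩ B').card) (repCount (A \ B') (B' \ A) x)) ≤
        ∑ x, min t (repCount A B' x) := by
      refine Finset.sum_le_sum fun x _ => ?_
      rw [repCount_eq_union_inter_add A B']
      have := repCount_le_right (A ∪ B') (A ∩ B') x
      omega
    rw [Finset.sum_add_distrib, sum_repCount] at h2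
    obtain ⟨u, hu⟩ := Nat.exists_eq_add_of_lt hti
    have hu' : t - (A ∩ B').card = u + 1 := by omega
    rw [hu'] at h1 h2
    generalize ∑ x, min (u + 1) (repCount (A \ B') (B' \ A) x) = s at h1 h2
    generalize ∑ x, min t (repCount A B' x) = s' at h2 ⊢
    clear ih hne
    have e1 : (A \ B').card + (B' \ A).card + 2 * (A ∩ B').card = A.card + B'.card := by omega
    have e2 : (A ∪ B').card + (A ∩ B').card = A.card + B'.card := by omega
    zify at *
    have e3 : (t : ℤ) = (A ∩ B').card + (u + 1) := by omega
    generalize ((A ∩ B').card : ℤ) = i at *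
    have e4 : ((A \ B').card : ℤ) + (B' \ A).card = A.card + B'.card - 2 * i := by omega
    have e5 : ((A ∪ B').card : ℤ) = A.card + B'.card - i := by omega
    rw [e4] at h1
    rw [e5] at h2
    rw [e3]
    nlinarith

/-- Lower bound for the number of popular sums. -/
lemma le_card_popular {p : ℕ} [Fact p.Prime] (A B : Finset (ZMod p)) (τ : ℝ) (hτ : 0 < τ)
    (hA : τ + 1 ≤ A.card) (hB : τ + 1 ≤ B.card) (hAB : A.card + B.card ≤ p) :
    (A.card : ℝ) + B.card - 2 * τ - 1 ≤
      (Finset.univ.filter fun x => τ ^ 2 / p ≤ (repCount A B x : ℝ)).card := by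
  have hp0 : (0 : ℝ) < p := by exact_mod_cast (Fact.out : p.Prime).pos
  set t := ⌈τ⌉₊ with ht
  have ht1 : τ ≤ t := Nat.le_ceil τ
  have ht2 : (t : ℝ) < τ + 1 := Nat.ceil_lt_add_one hτ.le
  have htA : t ≤ A.card := by exact_mod_cast (ht2.le.trans hA)
  have htB : t ≤ B.card := by exact_mod_cast (ht2.le.trans hB)
  have h1 := pollard_sum_min_repCount _ A B t rfl htA htB (by omega)
  set D := Finset.univ.filter fun x => τ ^ 2 / p ≤ (repCount A B x : ℝ) with hD
  have h2 : ((∑ x, min t (repCount A B x) : ℕ) : ℝ) ≤ t * D.card + τ ^ 2 := by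
    push_cast
    calc ∑ x, min (t : ℝ) (repCount A B x) ≤ ∑ x, ((if x ∈ D then (t : ℝ) else 0) + τ ^ 2 / p) := by
          refine Finset.sum_le_sum fun x _ => ?_
          split_ifs with hx
          · have : 0 ≤ τ ^ 2 / p := by positivity
            linarith [min_le_left (t : ℝ) (repCount A B x)]
          · have : ¬ τ ^ 2 / p ≤ (repCount A B x : ℝ) := fun h =>
              hx (Finset.mem_filter.2 ⟨Finset.mem_univ _, h⟩)
            linarith [min_le_right (t : ℝ) (repCount A B x)]
      _ = t * D.card + τ ^ 2 := by
          rw [Finset.sum_add_distrib, Finset.sum_ite_mem, Finset.univ_inter, Finset.sum_const,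
            Finset.sum_const, Finset.card_univ, ZMod.card, nsmul_eq_mul, nsmul_eq_mul]
          field_simp
  have h3 : (t : ℝ) * (A.card + B.card) ≤ t * D.card + τ ^ 2 + t * t := by
    have : ((t * (A.card + B.card) : ℕ) : ℝ) ≤
      ((∑ x, min t (repCount A B x) + t * t : ℕ) : ℝ) := by exact_mod_cast h1
    push_cast at this h2
    linarith
  have ht0 : (0 : ℝ) < t := hτ.trans_le ht1
  have h4 : (t : ℝ) * (A.card + B.card) ≤ t * (D.card + τ + t) := by nlinarith
  have := le_of_mul_le_mul_left h4 ht0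
  linarith

open scoped Pointwise in
lemma card_add_card_add_card_le_of_sum_ne_zero {p : ℕ} [Fact p.Prime]
    (A₁ A₂ A₃ : Finset (ZMod p)) (h₁ : A₁.Nonempty) (h₂ : A₂.Nonempty) (h₃ : A₃.Nonempty)
    (h0 : ∀ x ∈ A₁, ∀ y ∈ A₂, ∀ z ∈ A₃, x + y + z ≠ 0) :
    A₁.card + A₂.card + A₃.card ≤ p + 1 := by
  have hp : p.Prime := Fact.out
  have c1 := ZMod.cauchy_davenport hp h₁ h₂
  have c2 := ZMod.cauchy_davenport hp (h₁.add h₂) h₃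
  have h : (A₁ + A₂ + A₃).card < p := by
    refine lt_of_lt_of_eq (Finset.card_lt_card (Finset.ssubset_univ_iff.2 fun h => ?_))
      (Finset.card_univ.trans (ZMod.card p))
    have h00 : (0 : ZMod p) ∈ A₁ + A₂ + A₃ := h ▸ Finset.mem_univ _
    obtain ⟨u, hu, z, hz, huz⟩ := Finset.mem_add.1 h00
    obtain ⟨x, hx, y, hy, rfl⟩ := Finset.mem_add.1 hu
    exact h0 x hx y hy z hz huz
  have k1 := h₁.card_pos
  have k2 := h₂.card_pos
  have k3 := h₃.card_pos
  omega

/-- The uniform probability density on `A`. -/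
noncomputable def uniformDensity {α : Type*} [DecidableEq α] (A : Finset α) (x : α) : ℝ :=
  if x ∈ A then (A.card : ℝ)⁻¹ else 0

lemma uniformDensity_nonneg {α : Type*} [DecidableEq α] (A : Finset α) (x : α) : 0 ≤ uniformDensity A x := by
  unfold uniformDensity
  split_ifs <;> positivity

lemma sum_uniformDensity_mul {α : Type*} [Fintype α] [DecidableEq α]
    (A : Finset α) (g : α → ℝ) :
    ∑ x, uniformDensity A x * g x = (A.card : ℝ)⁻¹ * ∑ x ∈ A, g x := by
  simp only [uniformDensity, ite_mul, zero_mul]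
  rw [Finset.sum_ite_mem, Finset.univ_inter, Finset.mul_sum]

lemma sum_uniformDensity {α : Type*} [Fintype α] [DecidableEq α]
    (A : Finset α) (hA : A.Nonempty) : ∑ x, uniformDensity A x = 1 := by
  have := sum_uniformDensity_mul A fun _ => 1
  have hc : (A.card : ℝ) ≠ 0 := by exact_mod_cast hA.card_pos.ne'
  simpa [hc] using this

lemma support_nonempty_of_sum_eq_one {α : Type*} [Fintype α]
    {A : Finset α} {μ : α → ℝ} (h1 : ∑ x, μ x = 1)
    (hA : ∀ x, x ∉ A → μ x = 0) : A.Nonempty := by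
  by_contra h
  rw [Finset.not_nonempty_iff_eq_empty] at h
  rw [h] at hA
  rw [Finset.sum_eq_zero fun x _ => hA x (Finset.notMem_empty x)] at h1
  exact zero_ne_one h1

lemma sum_sq_sub_uniformDensity {α : Type*} [Fintype α] [DecidableEq α]
    {A : Finset α} {μ : α → ℝ} (h1 : ∑ x, μ x = 1)
    (hA : ∀ x, x ∉ A → μ x = 0) :
    ∑ x, (μ x - uniformDensity A x) ^ 2 = ∑ x, μ x ^ 2 - (A.card : ℝ)⁻¹ := by
  have hne := support_nonempty_of_sum_eq_one h1 hA
  have hc : (A.card : ℝ) ≠ 0 := by exact_mod_cast hne.card_pos.ne'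
  have hs : ∑ x ∈ A, μ x = 1 := by
    rw [← h1]
    exact Finset.sum_subset (Finset.subset_univ _) fun x _ hx => hA x hx
  have e : ∀ x, (μ x - uniformDensity A x) ^ 2 =
      μ x ^ 2 - 2 * (uniformDensity A x * μ x) + uniformDensity A x * uniformDensity A x := by
    intro x; ring
  simp only [e]
  rw [Finset.sum_add_distrib, Finset.sum_sub_distrib, ← Finset.mul_sum, sum_uniformDensity_mul,
    sum_uniformDensity_mul, hs]
  have : ∑ x ∈ A, uniformDensity A x = 1 := by
    rw [Finset.sum_congr rfl fun x hx => by rw [uniformDensity, if_pos hx], Finset.sum_const,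
      nsmul_eq_mul, mul_inv_cancel₀ hc]
  rw [this]
  ring

lemma inv_card_le_sum_sq {α : Type*} [Fintype α] [DecidableEq α]
    {A : Finset α} {μ : α → ℝ} (h1 : ∑ x, μ x = 1)
    (hA : ∀ x, x ∉ A → μ x = 0) : (A.card : ℝ)⁻¹ ≤ ∑ x, μ x ^ 2 := by
  have h := sum_sq_sub_uniformDensity h1 hA
  have : 0 ≤ ∑ x, (μ x - uniformDensity A x) ^ 2 := Finset.sum_nonneg fun x _ => sq_nonneg _
  linarith

lemma sq_sum_abs_sub_uniformDensity_le {α : Type*} [Fintype α] [DecidableEq α]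
    {A : Finset α} {μ : α → ℝ} (h1 : ∑ x, μ x = 1)
    (hA : ∀ x, x ∉ A → μ x = 0) :
    (∑ x, |μ x - uniformDensity A x|) ^ 2 ≤ A.card * (∑ x, μ x ^ 2 - (A.card : ℝ)⁻¹) := by
  have hs : ∑ x, |μ x - uniformDensity A x| = ∑ x ∈ A, |μ x - uniformDensity A x| := by
    refine (Finset.sum_subset (Finset.subset_univ _) fun x _ hx => ?_).symm
    rw [hA x hx, uniformDensity, if_neg hx, sub_zero, abs_zero]
  rw [hs, ← sum_sq_sub_uniformDensity h1 hA]
  refine sq_sum_le_card_mul_sum_sq.trans ?_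
  simp only [sq_abs]
  refine mul_le_mul_of_nonneg_left ?_ (Nat.cast_nonneg _)
  exact Finset.sum_le_sum_of_subset_of_nonneg (Finset.subset_univ _) fun x _ _ => sq_nonneg _

/-- Changing the marginals of a product measure changes averages by at most the sum of the
`L¹` distances. -/
lemma sum_mul_mul_le_of_close {α : Type*} [Fintype α]
    (μ₁ μ₂ μ₃ ν₁ ν₂ ν₃ : α → ℝ)
    (hμ₂ : ∀ x, 0 ≤ μ₂ x) (hμ₃ : ∀ x, 0 ≤ μ₃ x) (hν₁ : ∀ x, 0 ≤ ν₁ x) (hν₂ : ∀ x, 0 ≤ ν₂ x)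
    (sμ₂ : ∑ x, μ₂ x = 1) (sμ₃ : ∑ x, μ₃ x = 1) (sν₁ : ∑ x, ν₁ x = 1) (sν₂ : ∑ x, ν₂ x = 1)
    (g : α → α → α → ℝ) (K : ℝ) (hg : ∀ x y z, |g x y z| ≤ K) :
    ∑ x, ∑ y, ∑ z, ν₁ x * ν₂ y * ν₃ z * g x y z ≤
      ∑ x, ∑ y, ∑ z, μ₁ x * μ₂ y * μ₃ z * g x y z +
      K * (∑ x, |μ₁ x - ν₁ x| + ∑ x, |μ₂ x - ν₂ x| + ∑ x, |μ₃ x - ν₃ x|) := by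
  have key : ∀ x y z, ν₁ x * ν₂ y * ν₃ z * g x y z ≤ μ₁ x * μ₂ y * μ₃ z * g x y z +
      K * (|μ₁ x - ν₁ x| * (μ₂ y * μ₃ z) + ν₁ x * (|μ₂ y - ν₂ y| * μ₃ z) +
        ν₁ x * (ν₂ y * |μ₃ z - ν₃ z|)) := by
    intro x y z
    have e : ν₁ x * ν₂ y * ν₃ z * g x y z - μ₁ x * μ₂ y * μ₃ z * g x y z =
        (-(μ₁ x - ν₁ x) * (μ₂ y * μ₃ z) + ν₁ x * (-(μ₂ y - ν₂ y) * μ₃ z) +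
        ν₁ x * (ν₂ y * -(μ₃ z - ν₃ z))) * g x y z := by ring
    set D := |μ₁ x - ν₁ x| * (μ₂ y * μ₃ z) + ν₁ x * (|μ₂ y - ν₂ y| * μ₃ z) +
        ν₁ x * (ν₂ y * |μ₃ z - ν₃ z|) with hD
    have hb : |-(μ₁ x - ν₁ x) * (μ₂ y * μ₃ z) + ν₁ x * (-(μ₂ y - ν₂ y) * μ₃ z) +
        ν₁ x * (ν₂ y * -(μ₃ z - ν₃ z))| ≤ D := by
      refine (abs_add_three _ _ _).trans (le_of_eq ?_)
      simp only [abs_mul, abs_neg, abs_of_nonneg (hμ₂ _), abs_of_nonneg (hμ₃ _),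
        abs_of_nonneg (hν₁ _), abs_of_nonneg (hν₂ _), hD]
    have h2 := le_abs_self ((-(μ₁ x - ν₁ x) * (μ₂ y * μ₃ z) + ν₁ x * (-(μ₂ y - ν₂ y) * μ₃ z) +
        ν₁ x * (ν₂ y * -(μ₃ z - ν₃ z))) * g x y z)
    rw [abs_mul] at h2
    have h3 := mul_le_mul hb (hg x y z) (abs_nonneg _) ((abs_nonneg _).trans hb)
    linarith
  have h := Finset.sum_le_sum fun x (_ : x ∈ Finset.univ) =>
    Finset.sum_le_sum fun y (_ : y ∈ Finset.univ) =>
    Finset.sum_le_sum fun z (_ : z ∈ Finset.univ) => key x y z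
  refine h.trans (le_of_eq ?_)
  simp only [Finset.sum_add_distrib, ← Finset.mul_sum, ← Finset.sum_mul, sμ₂, sμ₃, sν₁, sν₂,
    mul_one, one_mul]

lemma tangent_le_inv {a : ℝ} (h0 : 0 < a) (h1 : a ≤ 1) :
    6 - 9 * a + 9 * (a - 1 / 3) ^ 2 ≤ 1 / a := by
  rw [le_div_iff₀ h0]
  nlinarith [sq_nonneg (a - 1 / 3), mul_nonneg (sub_nonneg.2 h1) (sq_nonneg (a - 1 / 3))]

lemma le_sum_inv_of_card_le {p : ℕ} [Fact p.Prime] (A₁ A₂ A₃ : Finset (ZMod p))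
    (h₁ : A₁.Nonempty) (h₂ : A₂.Nonempty) (h₃ : A₃.Nonempty)
    (h : A₁.card + A₂.card + A₃.card ≤ p + 1) :
    9 - 9 / (p : ℝ) + 9 * (((A₁.card : ℝ) / p - 1 / 3) ^ 2 + ((A₂.card : ℝ) / p - 1 / 3) ^ 2 +
      ((A₃.card : ℝ) / p - 1 / 3) ^ 2) ≤
      p * (A₁.card : ℝ)⁻¹ + p * (A₂.card : ℝ)⁻¹ + p * (A₃.card : ℝ)⁻¹ := by
  have hp0 : (0 : ℝ) < p := by exact_mod_cast (Fact.out : p.Prime).pos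
  have key : ∀ A : Finset (ZMod p), A.Nonempty →
      6 - 9 * ((A.card : ℝ) / p) + 9 * ((A.card : ℝ) / p - 1 / 3) ^ 2 ≤ p * (A.card : ℝ)⁻¹ := by
    intro A hA
    have hc : (0 : ℝ) < A.card := by exact_mod_cast hA.card_pos
    have hc' : (A.card : ℝ) ≤ p := by exact_mod_cast (Finset.card_le_univ A).trans_eq (ZMod.card p)
    have := tangent_le_inv (div_pos hc hp0) ((div_le_one hp0).2 hc')
    rwa [one_div_div, div_eq_mul_inv (p : ℝ)] at this
  have e : ((A₁.card : ℝ) + A₂.card + A₃.card) / p ≤ 1 + 1 / p := by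
    rw [div_le_iff₀ hp0, add_mul, one_mul, one_div, inv_mul_cancel₀ hp0.ne']
    exact_mod_cast h
  rw [add_div, add_div] at e
  have e9 : (9 : ℝ) / p = 9 * (1 / p) := by ring
  rw [e9]
  linarith [key A₁ h₁, key A₂ h₂, key A₃ h₃]

/-- Three densities whose supports have no zero sum cannot be too equidistributed. -/
lemma nine_sub_le_sum_sq {p : ℕ} [Fact p.Prime] {A₁ A₂ A₃ : Finset (ZMod p)}
    (h0 : ∀ x ∈ A₁, ∀ y ∈ A₂, ∀ z ∈ A₃, x + y + z ≠ 0) {μ₁ μ₂ μ₃ : ZMod p → ℝ}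
    (s₁ : ∑ x, μ₁ x = 1) (s₂ : ∑ x, μ₂ x = 1) (s₃ : ∑ x, μ₃ x = 1)
    (m₁ : ∀ x, x ∉ A₁ → μ₁ x = 0) (m₂ : ∀ x, x ∉ A₂ → μ₂ x = 0) (m₃ : ∀ x, x ∉ A₃ → μ₃ x = 0) :
    9 - 9 / (p : ℝ) ≤ p * ∑ x, μ₁ x ^ 2 + p * ∑ x, μ₂ x ^ 2 + p * ∑ x, μ₃ x ^ 2 := by
  have n₁ := support_nonempty_of_sum_eq_one s₁ m₁
  have n₂ := support_nonempty_of_sum_eq_one s₂ m₂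
  have n₃ := support_nonempty_of_sum_eq_one s₃ m₃
  have h := le_sum_inv_of_card_le A₁ A₂ A₃ n₁ n₂ n₃
    (card_add_card_add_card_le_of_sum_ne_zero A₁ A₂ A₃ n₁ n₂ n₃ h0)
  have hp0 : (0 : ℝ) ≤ p := by positivity
  have k₁ := mul_le_mul_of_nonneg_left (inv_card_le_sum_sq s₁ m₁) hp0
  have k₂ := mul_le_mul_of_nonneg_left (inv_card_le_sum_sq s₂ m₂) hp0
  have k₃ := mul_le_mul_of_nonneg_left (inv_card_le_sum_sq s₃ m₃) hp0
  have q₁ := sq_nonneg ((A₁.card : ℝ) / p - 1 / 3)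
  have q₂ := sq_nonneg ((A₂.card : ℝ) / p - 1 / 3)
  have q₃ := sq_nonneg ((A₃.card : ℝ) / p - 1 / 3)
  linarith

/-- Near-equality in `nine_sub_le_sum_sq` forces each support to have density close to `1/3`
and each density to be close to uniform on its support. -/
lemma near_uniform_of_sum_sq_le {p : ℕ} [Fact p.Prime] (hp : 10 ^ 51 ≤ p)
    {A₁ A₂ A₃ : Finset (ZMod p)}
    (h0 : ∀ x ∈ A₁, ∀ y ∈ A₂, ∀ z ∈ A₃, x + y + z ≠ 0) {μ₁ μ₂ μ₃ : ZMod p → ℝ}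
    (s₁ : ∑ x, μ₁ x = 1) (s₂ : ∑ x, μ₂ x = 1) (s₃ : ∑ x, μ₃ x = 1)
    (m₁ : ∀ x, x ∉ A₁ → μ₁ x = 0) (m₂ : ∀ x, x ∉ A₂ → μ₂ x = 0) (m₃ : ∀ x, x ∉ A₃ → μ₃ x = 0)
    (hκ : p * ∑ x, μ₁ x ^ 2 + p * ∑ x, μ₂ x ^ 2 + p * ∑ x, μ₃ x ^ 2 ≤ 9 + 1 / 10 ^ 50) :
    (|(A₁.card : ℝ) / p - 1 / 3| ≤ 1 / 10 ^ 25 ∧ ∑ x, |μ₁ x - uniformDensity A₁ x| ≤ 2 / 10 ^ 25) ∧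
    (|(A₂.card : ℝ) / p - 1 / 3| ≤ 1 / 10 ^ 25 ∧ ∑ x, |μ₂ x - uniformDensity A₂ x| ≤ 2 / 10 ^ 25) ∧
    (|(A₃.card : ℝ) / p - 1 / 3| ≤ 1 / 10 ^ 25 ∧
      ∑ x, |μ₃ x - uniformDensity A₃ x| ≤ 2 / 10 ^ 25) := by
  have n₁ := support_nonempty_of_sum_eq_one s₁ m₁
  have n₂ := support_nonempty_of_sum_eq_one s₂ m₂
  have n₃ := support_nonempty_of_sum_eq_one s₃ m₃
  have h := le_sum_inv_of_card_le A₁ A₂ A₃ n₁ n₂ n₃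
    (card_add_card_add_card_le_of_sum_ne_zero A₁ A₂ A₃ n₁ n₂ n₃ h0)
  have hp0 : (0 : ℝ) < p := by exact_mod_cast (Fact.out : p.Prime).pos
  have hp' : (10 : ℝ) ^ 51 ≤ p := by exact_mod_cast hp
  have h9 : 9 / (p : ℝ) ≤ 1 / 10 ^ 50 := by
    rw [div_le_div_iff₀ hp0 (by positivity)]
    linarith
  have k : ∀ {A : Finset (ZMod p)} {μ : ZMod p → ℝ}, ∑ x, μ x = 1 → (∀ x, x ∉ A → μ x = 0) →
      p * (A.card : ℝ)⁻¹ ≤ p * ∑ x, μ x ^ 2 :=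
    fun s m => mul_le_mul_of_nonneg_left (inv_card_le_sum_sq s m) hp0.le
  have k₁ := k s₁ m₁
  have k₂ := k s₂ m₂
  have k₃ := k s₃ m₃
  have q₁ := sq_nonneg ((A₁.card : ℝ) / p - 1 / 3)
  have q₂ := sq_nonneg ((A₂.card : ℝ) / p - 1 / 3)
  have q₃ := sq_nonneg ((A₃.card : ℝ) / p - 1 / 3)
  have concl : ∀ {A : Finset (ZMod p)} {μ : ZMod p → ℝ}, ∑ x, μ x = 1 →
      (∀ x, x ∉ A → μ x = 0) → 9 * ((A.card : ℝ) / p - 1 / 3) ^ 2 ≤ 2 / 10 ^ 50 →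
      p * ∑ x, μ x ^ 2 - p * (A.card : ℝ)⁻¹ ≤ 2 / 10 ^ 50 →
      |(A.card : ℝ) / p - 1 / 3| ≤ 1 / 10 ^ 25 ∧
        ∑ x, |μ x - uniformDensity A x| ≤ 2 / 10 ^ 25 := by
    intro A μ s m c1 c2
    constructor
    · refine abs_le_of_sq_le_sq ?_ (by positivity)
      rw [div_pow, one_pow, ← pow_mul]
      linarith
    · refine le_of_sq_le_sq ?_ (by positivity)
      refine (sq_sum_abs_sub_uniformDensity_le s m).trans ?_
      have hc' : (A.card : ℝ) ≤ p := by
        exact_mod_cast (Finset.card_le_univ A).trans_eq (ZMod.card p)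
      have hd : 0 ≤ ∑ x, μ x ^ 2 - (A.card : ℝ)⁻¹ := sub_nonneg.2 (inv_card_le_sum_sq s m)
      have := mul_le_mul_of_nonneg_right hc' hd
      rw [div_pow, ← pow_mul]
      linarith
  refine ⟨concl s₁ m₁ ?_ ?_, concl s₂ m₂ ?_ ?_, concl s₃ m₃ ?_ ?_⟩ <;> linarith

/-- The reciprocal density of representations of `x` in `A + B`, capped at `10 ^ 14`. -/
noncomputable def capWeight {p : ℕ} (A B : Finset (ZMod p)) (x : ZMod p) : ℝ :=
  p / max (repCount A B x : ℝ) (p / 10 ^ 14)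

lemma capWeight_le {p : ℕ} [Fact p.Prime] (A B : Finset (ZMod p)) (x : ZMod p) :
    capWeight A B x ≤ 10 ^ 14 := by
  have hp0 : (0 : ℝ) < p := by exact_mod_cast (Fact.out : p.Prime).pos
  rw [capWeight, div_le_iff₀ (by positivity)]
  have := le_max_right (repCount A B x : ℝ) (p / 10 ^ 14)
  linarith

lemma capWeight_nonneg {p : ℕ} (A B : Finset (ZMod p)) (x : ZMod p) : 0 ≤ capWeight A B x := by
  unfold capWeight; positivity

lemma le_capWeight {p : ℕ} [Fact p.Prime] (A B : Finset (ZMod p)) (x : ZMod p) {K : ℝ}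
    (h1 : (repCount A B x : ℝ) * K ≤ p) (hK : K ≤ 10 ^ 14) : K ≤ capWeight A B x := by
  have hp0 : (0 : ℝ) < p := by exact_mod_cast (Fact.out : p.Prime).pos
  rw [capWeight, le_div_iff₀ (by positivity)]
  rcases max_cases (repCount A B x : ℝ) (p / 10 ^ 14) with ⟨h, _⟩ | ⟨h, _⟩
  · rw [h]; linarith
  · rw [h]
    have : K * (p / 10 ^ 14) ≤ 10 ^ 14 * (p / 10 ^ 14) :=
      mul_le_mul_of_nonneg_right hK (by positivity)
    linarith

lemma le_capWeight_of_card {p : ℕ} [Fact p.Prime] (A B : Finset (ZMod p)) (x : ZMod p)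
    (hA : |(A.card : ℝ) / p - 1 / 3| ≤ 1 / 10 ^ 25) : 3 - 1 / 10 ^ 20 ≤ capWeight A B x := by
  have hp0 : (0 : ℝ) < p := by exact_mod_cast (Fact.out : p.Prime).pos
  refine le_capWeight A B x ?_ (by norm_num)
  have h1 : (repCount A B x : ℝ) ≤ A.card := by exact_mod_cast repCount_le_left A B x
  have h2 := (abs_le.1 hA).2
  have h3 : (A.card : ℝ) ≤ (1 / 3 + 1 / 10 ^ 25) * p := by
    rw [← div_le_iff₀ hp0]; linarith
  nlinarith

lemma capWeight_le_div {p : ℕ} [Fact p.Prime] (A B : Finset (ZMod p)) (x : ZMod p) {m : ℕ}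
    (h0 : 0 < m) (hm : m ≤ repCount A B x) : capWeight A B x ≤ p / m := by
  have h1 : (m : ℝ) ≤ repCount A B x := by exact_mod_cast hm
  exact div_le_div_of_nonneg_left (by positivity) (by exact_mod_cast h0)
    (h1.trans (le_max_left _ _))

lemma sum_sum_comp_add {p : ℕ} [Fact p.Prime] (A B : Finset (ZMod p)) (g : ZMod p → ℝ) :
    ∑ x ∈ A, ∑ y ∈ B, g (x + y) = ∑ b, repCount A B b * g b := by
  have h : ∀ b, (repCount A B b : ℝ) * g b = ∑ x ∈ A, if b - x ∈ B then g b else 0 := by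
    intro b
    rw [← Finset.sum_filter, Finset.sum_const, nsmul_eq_mul]
    rfl
  simp only [h]
  conv_rhs => rw [Finset.sum_comm]
  refine Finset.sum_congr rfl fun x _ => ?_
  rw [← Equiv.sum_comp (Equiv.addLeft x)]
  simp only [Equiv.coe_addLeft, add_sub_cancel_left]
  rw [Finset.sum_ite_mem, Finset.univ_inter]

lemma card_bounds_of_density {p : ℕ} [Fact p.Prime] {A : Finset (ZMod p)}
    (hA : |(A.card : ℝ) / p - 1 / 3| ≤ 1 / 10 ^ 25) :
    (1 / 3 - 1 / 10 ^ 25) * p ≤ (A.card : ℝ) ∧ (A.card : ℝ) ≤ (1 / 3 + 1 / 10 ^ 25) * p := by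
  have hp0 : (0 : ℝ) < p := by exact_mod_cast (Fact.out : p.Prime).pos
  have h := abs_le.1 hA
  constructor
  · rw [← le_div_iff₀ hp0]; linarith
  · rw [← div_le_iff₀ hp0]; linarith

lemma le_card_popular_of_density {p : ℕ} [Fact p.Prime] (hp : 10 ^ 51 ≤ p)
    {A B : Finset (ZMod p)} (hA : |(A.card : ℝ) / p - 1 / 3| ≤ 1 / 10 ^ 25)
    (hB : |(B.card : ℝ) / p - 1 / 3| ≤ 1 / 10 ^ 25) {σ : ℝ} (h0 : 0 < σ) (h1 : σ ≤ 1 / 20) :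
    (2 / 3 - 3 / 10 ^ 25 - 2 * σ) * p ≤
      ((Finset.univ.filter fun x => σ ^ 2 * p ≤ (repCount A B x : ℝ)).card : ℝ) := by
  have hp0 : (0 : ℝ) < p := by exact_mod_cast (Fact.out : p.Prime).pos
  have hp' : (10 : ℝ) ^ 51 ≤ p := by exact_mod_cast hp
  obtain ⟨a1, a2⟩ := card_bounds_of_density hA
  obtain ⟨b1, b2⟩ := card_bounds_of_density hB
  have hσp : σ * p ≤ 1 / 20 * p := mul_le_mul_of_nonneg_right h1 hp0.le
  have hle : A.card + B.card ≤ p := by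
    have : (A.card : ℝ) + B.card ≤ p := by linarith
    exact_mod_cast this
  have h := le_card_popular A B (σ * p) (by positivity) (by linarith) (by linarith) hle
  have e : (σ * p) ^ 2 / p = σ ^ 2 * p := by field_simp
  rw [e] at h
  linarith

lemma le_sum_sum_capWeight {p : ℕ} [Fact p.Prime] (hp : 10 ^ 51 ≤ p)
    {A B : Finset (ZMod p)} (hA : |(A.card : ℝ) / p - 1 / 3| ≤ 1 / 10 ^ 25)
    (hB : |(B.card : ℝ) / p - 1 / 3| ≤ 1 / 10 ^ 25) :
    (6 - 3 / 10 ^ 6) * ((A.card : ℝ) * B.card) ≤ ∑ y ∈ A, ∑ z ∈ B, capWeight A B (y + z) := by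
  have hp0 : (0 : ℝ) < p := by exact_mod_cast (Fact.out : p.Prime).pos
  obtain ⟨a1, a2⟩ := card_bounds_of_density hA
  obtain ⟨b1, b2⟩ := card_bounds_of_density hB
  have h := le_card_popular_of_density hp hA hB (σ := 1 / 10 ^ 7) (by positivity) (by norm_num)
  rw [sum_sum_comp_add]
  set D := Finset.univ.filter fun x => (1 / 10 ^ 7) ^ 2 * (p : ℝ) ≤ (repCount A B x : ℝ) with hD
  have h1 : (p : ℝ) * D.card ≤ ∑ b, repCount A B b * capWeight A B b := by
    calc (p : ℝ) * D.card = ∑ b ∈ D, (p : ℝ) := by rw [Finset.sum_const, nsmul_eq_mul]; ring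
      _ = ∑ b ∈ D, repCount A B b * capWeight A B b := by
        refine Finset.sum_congr rfl fun b hb => ?_
        have hb' := (Finset.mem_filter.1 hb).2
        have e : ((1 : ℝ) / 10 ^ 7) ^ 2 * p = p / 10 ^ 14 := by ring
        rw [e] at hb'
        have hpos : (0 : ℝ) < repCount A B b := lt_of_lt_of_le (by positivity) hb'
        rw [capWeight, max_eq_left hb']
        field_simp
      _ ≤ _ := Finset.sum_le_sum_of_subset_of_nonneg (Finset.subset_univ _) fun b _ _ =>
        mul_nonneg (Nat.cast_nonneg _) (capWeight_nonneg _ _ _)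
  refine le_trans ?_ h1
  have h2 : (A.card : ℝ) * B.card ≤ ((1 / 3 + 1 / 10 ^ 25) * p) * ((1 / 3 + 1 / 10 ^ 25) * p) :=
    mul_le_mul a2 b2 (Nat.cast_nonneg _) (by positivity)
  have h3 := mul_le_mul_of_nonneg_left h hp0.le
  have h4 : (0 : ℝ) ≤ p * p := by positivity
  norm_num at h2 h3 ⊢
  nlinarith

open scoped Pointwise in
lemma repCount_add_repCount_neg_le {p : ℕ} {A₁ B : Finset (ZMod p)}
    (h0 : ∀ x ∈ A₁, ∀ b ∈ B, x + b ≠ 0) (s : ZMod p) :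
    repCount A₁ B s + repCount A₁ (-A₁) s ≤ A₁.card := by
  unfold repCount
  rw [← Finset.card_union_of_disjoint]
  · exact Finset.card_le_card (Finset.union_subset (Finset.filter_subset _ _)
      (Finset.filter_subset _ _))
  · rw [Finset.disjoint_filter]
    intro a _ hb hn
    rw [Finset.mem_neg'] at hn
    exact h0 _ hn _ hb (by ring)

open scoped Pointwise in
lemma le_sum_sum_sum_capWeight {p : ℕ} [Fact p.Prime] (hp : 10 ^ 51 ≤ p)
    {A₁ A₂ A₃ : Finset (ZMod p)} (h0 : ∀ x ∈ A₁, ∀ y ∈ A₂, ∀ z ∈ A₃, x + y + z ≠ 0)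
    (hA₁ : |(A₁.card : ℝ) / p - 1 / 3| ≤ 1 / 10 ^ 25)
    (hA₂ : |(A₂.card : ℝ) / p - 1 / 3| ≤ 1 / 10 ^ 25)
    (hA₃ : |(A₃.card : ℝ) / p - 1 / 3| ≤ 1 / 10 ^ 25) :
    (3 + 3.9 / 10 ^ 5) * ((A₁.card : ℝ) * (A₂.card * A₃.card)) ≤
      ∑ x ∈ A₁, ∑ y ∈ A₂, ∑ z ∈ A₃, capWeight A₁ (A₂ + A₃) (x + (y + z)) := by
  have hp0 : (0 : ℝ) < p := by exact_mod_cast (Fact.out : p.Prime).pos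
  obtain ⟨a1, a2⟩ := card_bounds_of_density hA₁
  obtain ⟨b1, b2⟩ := card_bounds_of_density hA₂
  obtain ⟨c1, c2⟩ := card_bounds_of_density hA₃
  have hneg : |((-A₁).card : ℝ) / p - 1 / 3| ≤ 1 / 10 ^ 25 := by rwa [Finset.card_neg]
  have hD := le_card_popular_of_density hp hA₁ hneg (σ := 1 / 20) (by positivity) le_rfl
  have hE := le_card_popular_of_density hp hA₂ hA₃ (σ := 1 / 20) (by positivity) le_rfl
  set D := Finset.univ.filter fun x => (1 / 20) ^ 2 * (p : ℝ) ≤ (repCount A₁ (-A₁) x : ℝ)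
  set E := Finset.univ.filter fun x => (1 / 20) ^ 2 * (p : ℝ) ≤ (repCount A₂ A₃ x : ℝ)
  have h0' : ∀ x ∈ A₁, ∀ b ∈ A₂ + A₃, x + b ≠ 0 := by
    intro x hx b hb
    obtain ⟨y, hy, z, hz, rfl⟩ := Finset.mem_add.1 hb
    rw [← add_assoc]
    exact h0 x hx y hy z hz
  have hpt : ∀ s, (3 - 1 / 10 ^ 20) + 1 / 50 * (if s ∈ D then (1 : ℝ) else 0) ≤
      capWeight A₁ (A₂ + A₃) s := by
    intro s
    split_ifs with hs
    · refine le_capWeight A₁ (A₂ + A₃) s ?_ (by norm_num)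
      have hs' := (Finset.mem_filter.1 hs).2
      have hr : (repCount A₁ (A₂ + A₃) s : ℝ) + repCount A₁ (-A₁) s ≤ A₁.card := by
        exact_mod_cast repCount_add_repCount_neg_le h0' s
      norm_num at *
      nlinarith
    · simpa using le_capWeight_of_card A₁ (A₂ + A₃) s hA₁
  have hcount : ∀ x, 1 / 500 * ((A₂.card : ℝ) * A₃.card) ≤
      ∑ y ∈ A₂, ∑ z ∈ A₃, if x + (y + z) ∈ D then (1 : ℝ) else 0 := by
    intro x
    rw [sum_sum_comp_add A₂ A₃ fun b => if x + b ∈ D then (1 : ℝ) else 0]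
    set D' := D.image (· - x) with hD'
    have hDc : D'.card = D.card := Finset.card_image_of_injective _ (sub_left_injective)
    have hmem : ∀ b ∈ D', x + b ∈ D := by
      intro b hb
      obtain ⟨d, hd, rfl⟩ := Finset.mem_image.1 hb
      simpa using hd
    have hun : (E ∪ D').card ≤ p := (Finset.card_le_univ _).trans_eq (ZMod.card p)
    have hinter : (E.card : ℝ) + D.card ≤ p + (E ∩ D').card := by
      have := Finset.card_union_add_card_inter E D'
      have : E.card + D.card ≤ p + (E ∩ D').card := by omega
      exact_mod_cast this
    have h1 : (1 / 20) ^ 2 * (p : ℝ) * (E ∩ D').card ≤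
        ∑ b, (repCount A₂ A₃ b : ℝ) * if x + b ∈ D then (1 : ℝ) else 0 := by
      calc (1 / 20) ^ 2 * (p : ℝ) * (E ∩ D').card = ∑ b ∈ E ∩ D', (1 / 20) ^ 2 * (p : ℝ) := by
            rw [Finset.sum_const, nsmul_eq_mul]; ring
        _ ≤ ∑ b ∈ E ∩ D', (repCount A₂ A₃ b : ℝ) * if x + b ∈ D then (1 : ℝ) else 0 := by
            refine Finset.sum_le_sum fun b hb => ?_
            obtain ⟨hb1, hb2⟩ := Finset.mem_inter.1 hb
            rw [if_pos (hmem b hb2), mul_one]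
            exact (Finset.mem_filter.1 hb1).2
        _ ≤ _ := Finset.sum_le_sum_of_subset_of_nonneg (Finset.subset_univ _) fun b _ _ =>
            mul_nonneg (Nat.cast_nonneg _) (by split_ifs <;> norm_num)
    refine le_trans ?_ h1
    have h2 : (A₂.card : ℝ) * A₃.card ≤
        ((1 / 3 + 1 / 10 ^ 25) * p) * ((1 / 3 + 1 / 10 ^ 25) * p) :=
      mul_le_mul b2 c2 (Nat.cast_nonneg _) (by positivity)
    have h3 : 13 / 100 * (p : ℝ) ≤ (E ∩ D').card := by
      norm_num at *
      linarith
    have h4 : (0 : ℝ) ≤ p * p := by positivity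
    have h5 := mul_le_mul_of_nonneg_left h3 hp0.le
    norm_num at h2 ⊢
    nlinarith
  have hfin : ∀ x ∈ A₁, (3 + 3.9 / 10 ^ 5) * ((A₂.card : ℝ) * A₃.card) ≤
      ∑ y ∈ A₂, ∑ z ∈ A₃, capWeight A₁ (A₂ + A₃) (x + (y + z)) := by
    intro x _
    have h1 := Finset.sum_le_sum fun y (_ : y ∈ A₂) => Finset.sum_le_sum fun z (_ : z ∈ A₃) =>
      hpt (x + (y + z))
    refine le_trans ?_ h1
    simp only [Finset.sum_add_distrib, Finset.sum_const, ← Finset.mul_sum, nsmul_eq_mul]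
    have h2 := hcount x
    have h4 : (0 : ℝ) ≤ (A₂.card : ℝ) * A₃.card := by positivity
    norm_num at h2 ⊢
    nlinarith
  refine le_trans (le_of_eq ?_) (Finset.sum_le_sum hfin)
  rw [Finset.sum_const, nsmul_eq_mul]
  ring

open scoped Pointwise in
/-- The local gain: on average over `μ₁ × μ₂ × μ₃`, the two capped weights add up to strictly
more than `9`. -/
lemma local_gain {p : ℕ} [Fact p.Prime] (hp : 10 ^ 51 ≤ p)
    {A₁ A₂ A₃ : Finset (ZMod p)}
    (h0 : ∀ x ∈ A₁, ∀ y ∈ A₂, ∀ z ∈ A₃, x + y + z ≠ 0) {μ₁ μ₂ μ₃ : ZMod p → ℝ}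
    (n₂ : ∀ x, 0 ≤ μ₂ x) (n₃ : ∀ x, 0 ≤ μ₃ x)
    (s₁ : ∑ x, μ₁ x = 1) (s₂ : ∑ x, μ₂ x = 1) (s₃ : ∑ x, μ₃ x = 1)
    (m₁ : ∀ x, x ∉ A₁ → μ₁ x = 0) (m₂ : ∀ x, x ∉ A₂ → μ₂ x = 0) (m₃ : ∀ x, x ∉ A₃ → μ₃ x = 0)
    (hκ : p * ∑ x, μ₁ x ^ 2 + p * ∑ x, μ₂ x ^ 2 + p * ∑ x, μ₃ x ^ 2 ≤ 9 + 1 / 10 ^ 50) :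
    9 + 1 / 10 ^ 5 ≤ ∑ x, ∑ y, ∑ z, μ₁ x * μ₂ y * μ₃ z *
      (capWeight A₂ A₃ (y + z) + capWeight A₁ (A₂ + A₃) (x + (y + z))) := by
  obtain ⟨⟨d₁, l₁⟩, ⟨d₂, l₂⟩, ⟨d₃, l₃⟩⟩ := near_uniform_of_sum_sq_le hp h0 s₁ s₂ s₃ m₁ m₂ m₃ hκ
  have e₁ := support_nonempty_of_sum_eq_one s₁ m₁
  have e₂ := support_nonempty_of_sum_eq_one s₂ m₂
  have e₃ := support_nonempty_of_sum_eq_one s₃ m₃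
  have hchange := sum_mul_mul_le_of_close μ₁ μ₂ μ₃ (uniformDensity A₁) (uniformDensity A₂)
    (uniformDensity A₃) n₂ n₃ (uniformDensity_nonneg A₁) (uniformDensity_nonneg A₂) s₂ s₃
    (sum_uniformDensity A₁ e₁) (sum_uniformDensity A₂ e₂)
    (fun x y z => capWeight A₂ A₃ (y + z) + capWeight A₁ (A₂ + A₃) (x + (y + z))) (2 * 10 ^ 14)
    (fun x y z => by
      rw [abs_of_nonneg (add_nonneg (capWeight_nonneg _ _ _) (capWeight_nonneg _ _ _))]
      linarith [capWeight_le A₂ A₃ (y + z), capWeight_le A₁ (A₂ + A₃) (x + (y + z))])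
  have hunif : ∑ x, ∑ y, ∑ z, uniformDensity A₁ x * uniformDensity A₂ y * uniformDensity A₃ z *
      (capWeight A₂ A₃ (y + z) + capWeight A₁ (A₂ + A₃) (x + (y + z))) =
      (A₁.card : ℝ)⁻¹ * ((A₂.card : ℝ)⁻¹ * ((A₃.card : ℝ)⁻¹ *
      (∑ x ∈ A₁, ∑ y ∈ A₂, ∑ z ∈ A₃,
        (capWeight A₂ A₃ (y + z) + capWeight A₁ (A₂ + A₃) (x + (y + z)))))) := by
    simp only [mul_assoc, ← Finset.mul_sum, sum_uniformDensity_mul]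
  have hX := le_sum_sum_capWeight hp d₂ d₃
  have hY := le_sum_sum_sum_capWeight hp h0 d₁ d₂ d₃
  simp only [Finset.sum_add_distrib] at hunif
  rw [Finset.sum_const, nsmul_eq_mul] at hunif
  have p₁ : (0 : ℝ) < A₁.card := by exact_mod_cast e₁.card_pos
  have p₂ : (0 : ℝ) < A₂.card := by exact_mod_cast e₂.card_pos
  have p₃ : (0 : ℝ) < A₃.card := by exact_mod_cast e₃.card_pos
  have hlow : 9 + 3 / 10 ^ 5 ≤ (A₁.card : ℝ)⁻¹ * ((A₂.card : ℝ)⁻¹ * ((A₃.card : ℝ)⁻¹ *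
      (A₁.card * ∑ y ∈ A₂, ∑ z ∈ A₃, capWeight A₂ A₃ (y + z) +
        ∑ x ∈ A₁, ∑ y ∈ A₂, ∑ z ∈ A₃, capWeight A₁ (A₂ + A₃) (x + (y + z))))) := by
    rw [← mul_assoc, ← mul_assoc, ← mul_inv, ← mul_inv, inv_mul_eq_div, le_div_iff₀ (by positivity)]
    have h1 := mul_le_mul_of_nonneg_left hX p₁.le
    have h2 : 0 ≤ (A₁.card : ℝ) * (A₂.card * A₃.card) := by positivity
    norm_num at hY h1 ⊢
    nlinarith
  rw [← hunif] at hlow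
  have hl : ∑ x, |μ₁ x - uniformDensity A₁ x| + ∑ x, |μ₂ x - uniformDensity A₂ x| +
      ∑ x, |μ₃ x - uniformDensity A₃ x| ≤ 6 / 10 ^ 25 := by linarith
  norm_num at *
  linarith

/-- The Fourier coefficient of a real-valued function on `ZMod p`. -/
noncomputable def zmodFourier {p : ℕ} [NeZero p] (f : ZMod p → ℝ) (r : ZMod p) : ℂ :=
  ∑ x, (f x : ℂ) * ZMod.stdAddChar (r * x)

/-- The threefold convolution on `ZMod p`. -/
noncomputable def tripleConv {p : ℕ} [NeZero p] (μ₁ μ₂ μ₃ : ZMod p → ℝ) (x : ZMod p) : ℝ :=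
  ∑ a, ∑ b, μ₁ a * μ₂ b * μ₃ (x - (a + b))

section Fourier

variable {p : ℕ} [NeZero p]

lemma sum_stdAddChar_mul (y : ZMod p) :
    ∑ r : ZMod p, ZMod.stdAddChar (r * y) = if y = 0 then (p : ℂ) else 0 := by
  have := AddChar.sum_mulShift (R := ZMod p) (R' := ℂ) y (ZMod.isPrimitive_stdAddChar p)
  rw [this, ZMod.card]
  split_ifs <;> simp

lemma norm_stdAddChar (x : ZMod p) : ‖(ZMod.stdAddChar x : ℂ)‖ = 1 := by
  exact AddChar.norm_apply _ _

lemma stdAddChar_neg_eq_conj (x : ZMod p) :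
    (ZMod.stdAddChar (-x) : ℂ) = (starRingEnd ℂ) (ZMod.stdAddChar x) := by
  exact AddChar.map_neg_eq_conj _ _

lemma sum_zmodFourier_mul (f : ZMod p → ℝ) (x : ZMod p) :
    ∑ r, zmodFourier f r * ZMod.stdAddChar (-(r * x)) = p * f x := by
  have h : ∀ r, zmodFourier f r * ZMod.stdAddChar (-(r * x)) =
      ∑ y, (f y : ℂ) * ZMod.stdAddChar (r * (y - x)) := by
    intro r
    rw [zmodFourier, Finset.sum_mul]
    refine Finset.sum_congr rfl fun y _ => ?_
    rw [mul_assoc, ← AddChar.map_add_eq_mul]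
    congr 2
    ring
  simp only [h]
  rw [Finset.sum_comm]
  simp only [← Finset.mul_sum, sum_stdAddChar_mul, sub_eq_zero]
  rw [Finset.sum_congr rfl (g := fun y => if y = x then (f y : ℂ) * p else 0) fun y _ => by
    split_ifs <;> simp]
  rw [Finset.sum_ite_eq' Finset.univ x, if_pos (Finset.mem_univ _), mul_comm]

lemma conj_zmodFourier (f : ZMod p → ℝ) (r : ZMod p) :
    (starRingEnd ℂ) (zmodFourier f r) = ∑ x, (f x : ℂ) * ZMod.stdAddChar (-(r * x)) := by
  rw [zmodFourier, map_sum]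
  refine Finset.sum_congr rfl fun x _ => ?_
  rw [map_mul, Complex.conj_ofReal, stdAddChar_neg_eq_conj]

lemma sum_sq_norm_zmodFourier (f : ZMod p → ℝ) :
    ∑ r, ‖zmodFourier f r‖ ^ 2 = p * ∑ x, f x ^ 2 := by
  have h : ((∑ r, ‖zmodFourier f r‖ ^ 2 : ℝ) : ℂ) = ((p * ∑ x, f x ^ 2 : ℝ) : ℂ) := by
    push_cast
    simp only [← Complex.mul_conj', conj_zmodFourier, Finset.mul_sum]
    rw [Finset.sum_comm]
    refine Finset.sum_congr rfl fun x _ => ?_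
    have := sum_zmodFourier_mul f x
    calc ∑ r, zmodFourier f r * ((f x : ℂ) * ZMod.stdAddChar (-(r * x)))
        = f x * ∑ r, zmodFourier f r * ZMod.stdAddChar (-(r * x)) := by
          rw [Finset.mul_sum]; exact Finset.sum_congr rfl fun r _ => by ring
      _ = _ := by rw [this]; ring
  exact_mod_cast h

lemma norm_zmodFourier_le (f : ZMod p → ℝ) (hf : ∀ x, 0 ≤ f x) (r : ZMod p) :
    ‖zmodFourier f r‖ ≤ ∑ x, f x := by
  refine (norm_sum_le _ _).trans (Finset.sum_le_sum fun x _ => ?_)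
  rw [norm_mul, norm_stdAddChar, mul_one, Complex.norm_real, Real.norm_of_nonneg (hf x)]

lemma zmodFourier_tripleConv (μ₁ μ₂ μ₃ : ZMod p → ℝ) (r : ZMod p) :
    zmodFourier (tripleConv μ₁ μ₂ μ₃) r =
      zmodFourier μ₁ r * zmodFourier μ₂ r * zmodFourier μ₃ r := by
  have h1 : zmodFourier (tripleConv μ₁ μ₂ μ₃) r =
      ∑ a, ∑ b, ∑ x, ((μ₁ a : ℂ) * μ₂ b * μ₃ (x - (a + b))) * ZMod.stdAddChar (r * x) := by
    simp only [zmodFourier, tripleConv]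
    push_cast
    simp only [Finset.sum_mul]
    rw [Finset.sum_comm]
    refine Finset.sum_congr rfl fun a _ => ?_
    rw [Finset.sum_comm]
  rw [h1, zmodFourier, zmodFourier, zmodFourier, Finset.sum_mul_sum, Finset.sum_mul]
  refine Finset.sum_congr rfl fun a _ => ?_
  rw [Finset.sum_mul]
  refine Finset.sum_congr rfl fun b _ => ?_
  rw [Finset.mul_sum, ← Equiv.sum_comp (Equiv.addRight (a + b))]
  refine Finset.sum_congr rfl fun c _ => ?_
  simp only [Equiv.coe_addRight, add_sub_cancel_right, mul_add, AddChar.map_add_eq_mul]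
  ring

lemma norm_stdAddChar_sub_le (u v : ZMod p) :
    ‖(ZMod.stdAddChar u : ℂ) - ZMod.stdAddChar v‖ ≤
      2 * Real.pi * |((u.val : ℝ) - v.val) / p| := by
  have hp0 : (p : ℂ) ≠ 0 := by exact_mod_cast NeZero.ne p
  have hf : ∀ u : ZMod p, (ZMod.stdAddChar u : ℂ) =
      Complex.exp (2 * Real.pi * Complex.I * u.val / p) := by
    intro u
    conv_lhs => rw [← ZMod.natCast_zmod_val u]
    have := ZMod.stdAddChar_coe (N := p) (u.val : ℤ)
    push_cast at this
    exact this
  have e : (ZMod.stdAddChar u : ℂ) - ZMod.stdAddChar v = ZMod.stdAddChar v *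
      (Complex.exp (Complex.I * ((2 * Real.pi * (((u.val : ℝ) - v.val) / p) : ℝ) : ℂ)) - 1) := by
    rw [mul_sub, mul_one, hf u, hf v, ← Complex.exp_add]
    congr 2
    push_cast
    field_simp
    ring
  rw [e, norm_mul, norm_stdAddChar, one_mul]
  refine (Real.norm_exp_I_mul_ofReal_sub_one_le).trans (le_of_eq ?_)
  rw [Real.norm_eq_abs, abs_mul, abs_of_pos (by positivity : 0 < 2 * Real.pi)]

lemma mul_tripleConv_eq (μ₁ μ₂ μ₃ : ZMod p → ℝ) (x : ZMod p) :
    ((p * tripleConv μ₁ μ₂ μ₃ x : ℝ) : ℂ) = ∑ r, zmodFourier μ₁ r * zmodFourier μ₂ r *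
      zmodFourier μ₃ r * ZMod.stdAddChar (-(r * x)) := by
  simp only [← zmodFourier_tripleConv, sum_zmodFourier_mul]
  push_cast
  rfl

/-- Points that agree up to `1 / K` in every large-spectrum frequency give nearly equal values of
a threefold convolution. -/
lemma mul_tripleConv_sub_zero_le {μ₁ μ₂ μ₃ : ZMod p → ℝ}
    (n₁ : ∀ x, 0 ≤ μ₁ x) (s₁ : ∑ x, μ₁ x = 1)
    (k₂ : p * ∑ x, μ₂ x ^ 2 ≤ 10) (k₃ : p * ∑ x, μ₃ x ^ 2 ≤ 10)
    {η τ : ℝ} (hη : 0 ≤ η) (hτ : 0 ≤ τ) (x : ZMod p)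
    (hx : ∀ r, η ≤ ‖zmodFourier μ₁ r‖ → ‖(ZMod.stdAddChar (-(r * x)) : ℂ) - 1‖ ≤ τ) :
    p * tripleConv μ₁ μ₂ μ₃ x ≤ p * tripleConv μ₁ μ₂ μ₃ 0 + 10 * (τ + 2 * η) := by
  have h1 : ((p * tripleConv μ₁ μ₂ μ₃ x - p * tripleConv μ₁ μ₂ μ₃ 0 : ℝ) : ℂ) =
      ∑ r, zmodFourier μ₁ r * zmodFourier μ₂ r * zmodFourier μ₃ r *
        ((ZMod.stdAddChar (-(r * x)) : ℂ) - 1) := by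
    rw [Complex.ofReal_sub, mul_tripleConv_eq, mul_tripleConv_eq, ← Finset.sum_sub_distrib]
    refine Finset.sum_congr rfl fun r _ => ?_
    rw [mul_zero, neg_zero, AddChar.map_zero_eq_one]
    ring
  have h2 : ‖((p * tripleConv μ₁ μ₂ μ₃ x - p * tripleConv μ₁ μ₂ μ₃ 0 : ℝ) : ℂ)‖ ≤
      ∑ r, (‖zmodFourier μ₂ r‖ ^ 2 + ‖zmodFourier μ₃ r‖ ^ 2) / 2 * (τ + 2 * η) := by
    rw [h1]
    refine (norm_sum_le _ _).trans (Finset.sum_le_sum fun r _ => ?_)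
    rw [norm_mul, norm_mul, norm_mul]
    have a1 : ‖zmodFourier μ₁ r‖ * ‖(ZMod.stdAddChar (-(r * x)) : ℂ) - 1‖ ≤ τ + 2 * η := by
      have b1 := norm_zmodFourier_le μ₁ n₁ r
      rw [s₁] at b1
      have b2 : ‖(ZMod.stdAddChar (-(r * x)) : ℂ) - 1‖ ≤ 2 := by
        refine (norm_sub_le _ _).trans ?_
        rw [norm_stdAddChar, norm_one]
        norm_num
      have b3 := norm_nonneg (zmodFourier μ₁ r)
      have b4 := norm_nonneg ((ZMod.stdAddChar (-(r * x)) : ℂ) - 1)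
      rcases le_or_gt η ‖zmodFourier μ₁ r‖ with h | h
      · have := hx r h
        nlinarith
      · nlinarith
    have a2 : ‖zmodFourier μ₂ r‖ * ‖zmodFourier μ₃ r‖ ≤
        (‖zmodFourier μ₂ r‖ ^ 2 + ‖zmodFourier μ₃ r‖ ^ 2) / 2 := by
      nlinarith [sq_nonneg (‖zmodFourier μ₂ r‖ - ‖zmodFourier μ₃ r‖)]
    calc _ = ‖zmodFourier μ₂ r‖ * ‖zmodFourier μ₃ r‖ *
          (‖zmodFourier μ₁ r‖ * ‖(ZMod.stdAddChar (-(r * x)) : ℂ) - 1‖) := by ring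
      _ ≤ _ := mul_le_mul a2 a1 (by positivity) (by positivity)
  rw [← Finset.sum_mul, ← Finset.sum_div, Finset.sum_add_distrib, sum_sq_norm_zmodFourier,
    sum_sq_norm_zmodFourier, Complex.norm_real, Real.norm_eq_abs] at h2
  have h3 := le_abs_self (p * tripleConv μ₁ μ₂ μ₃ x - p * tripleConv μ₁ μ₂ μ₃ 0 : ℝ)
  have h4 : (p * ∑ x, μ₂ x ^ 2 + p * ∑ x, μ₃ x ^ 2) / 2 * (τ + 2 * η) ≤ 10 * (τ + 2 * η) :=
    mul_le_mul_of_nonneg_right (by linarith) (by positivity)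
  linarith

/-- The correlation of `f` with the difference set of `V`, in terms of Fourier coefficients. -/
lemma mul_sum_sum_sub_eq (f : ZMod p → ℝ) (V : Finset (ZMod p)) :
    ((p * ∑ v ∈ V, ∑ w ∈ V, f (v - w) : ℝ) : ℂ) =
      ∑ r, zmodFourier f r * (‖∑ v ∈ V, (ZMod.stdAddChar (r * v) : ℂ)‖ ^ 2 : ℝ) := by
  have h : ∀ r : ZMod p, ((‖∑ v ∈ V, (ZMod.stdAddChar (r * v) : ℂ)‖ ^ 2 : ℝ) : ℂ) =
      ∑ v ∈ V, ∑ w ∈ V, ZMod.stdAddChar (-(r * (v - w))) := by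
    intro r
    rw [Complex.ofReal_pow, ← Complex.mul_conj', map_sum, Finset.sum_mul_sum, Finset.sum_comm]
    refine Finset.sum_congr rfl fun v _ => Finset.sum_congr rfl fun w _ => ?_
    rw [← stdAddChar_neg_eq_conj, ← AddChar.map_add_eq_mul]
    congr 1
    ring
  simp only [h, Finset.mul_sum]
  push_cast
  conv_rhs => rw [Finset.sum_comm]
  refine Finset.sum_congr rfl fun v _ => ?_
  conv_rhs => rw [Finset.sum_comm]
  refine Finset.sum_congr rfl fun w _ => ?_
  exact (sum_zmodFourier_mul f (v - w)).symm

lemma sum_sq_norm_sum_stdAddChar (V : Finset (ZMod p)) :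
    ∑ r : ZMod p, ‖∑ v ∈ V, (ZMod.stdAddChar (r * v) : ℂ)‖ ^ 2 = p * V.card := by
  have := sum_sq_norm_zmodFourier fun x : ZMod p => if x ∈ V then (1 : ℝ) else 0
  have e : ∀ r, zmodFourier (fun x : ZMod p => if x ∈ V then (1 : ℝ) else 0) r =
      ∑ v ∈ V, (ZMod.stdAddChar (r * v) : ℂ) := by
    intro r
    have h := Finset.sum_ite_mem Finset.univ V fun x => (ZMod.stdAddChar (r * x) : ℂ)
    rw [Finset.univ_inter] at h
    rw [zmodFourier, ← h]
    refine Finset.sum_congr rfl fun x _ => ?_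
    split_ifs <;> simp_all
  simp only [e] at this
  rw [this]
  simp

end Fourier

/-- Pigeonhole: a function to a finite type has a fibre of at least average size. -/
lemma exists_large_fiber {α β : Type*} [Fintype α] [Fintype β] [Nonempty β] [DecidableEq β]
    (F : α → β) :
    ∃ y, Fintype.card α ≤ Fintype.card β * (Finset.univ.filter fun x => F x = y).card := by
  obtain ⟨y, -, hy⟩ := Finset.exists_max_image (Finset.univ : Finset β)
    (fun y => (Finset.univ.filter fun x => F x = y).card) Finset.univ_nonempty
  refine ⟨y, ?_⟩
  have h := Finset.card_eq_sum_card_fiberwise (f := F) (s := Finset.univ) (t := Finset.univ)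
    (fun x _ => Finset.mem_coe.2 (Finset.mem_univ _))
  rw [← Finset.card_univ, h, ← Finset.card_univ, ← smul_eq_mul, ← Finset.sum_const]
  exact Finset.sum_le_sum fun z hz => hy z hz

/-- A function dominated by a threefold convolution that vanishes at `0` has a large
nontrivial Fourier coefficient, uniformly in `p`. -/
lemma exists_large_zmodFourier (m : ℝ) (hm : 0 < m) :
    ∃ ρ : ℝ, 0 < ρ ∧ ∀ (p : ℕ) [NeZero p] (f μ₁ μ₂ μ₃ : ZMod p → ℝ),
      (∀ x, 0 ≤ μ₁ x) → ∑ x, μ₁ x = 1 → p * ∑ x, μ₁ x ^ 2 ≤ 10 → p * ∑ x, μ₂ x ^ 2 ≤ 10 →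
      p * ∑ x, μ₃ x ^ 2 ≤ 10 → (∀ x, f x ≤ tripleConv μ₁ μ₂ μ₃ x) →
      tripleConv μ₁ μ₂ μ₃ 0 = 0 → m ≤ ∑ x, f x →
      ∃ r, r ≠ 0 ∧ ρ ≤ ‖zmodFourier f r‖ := by
  obtain ⟨K, hK⟩ := exists_nat_gt (320 / m)
  obtain ⟨k, hk⟩ := exists_nat_gt (10 / (m / 80) ^ 2)
  have hK0 : (0 : ℝ) < K := lt_trans (by positivity) hK
  have hK1 : 1 ≤ K := by exact_mod_cast hK0
  refine ⟨m / (4 * K ^ k), by positivity, ?_⟩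
  intro p _ f μ₁ μ₂ μ₃ n₁ s₁ k₁ k₂ k₃ hf h0 hfm
  by_contra! hcon
  have hp0 : (0 : ℝ) < p := by exact_mod_cast Nat.pos_of_ne_zero (NeZero.ne p)
  set S := Finset.univ.filter fun r => m / 80 ≤ ‖zmodFourier μ₁ r‖ with hS
  have hScard : S.card ≤ k := by
    have h1 : (S.card : ℝ) * (m / 80) ^ 2 ≤ 10 := by
      rw [← nsmul_eq_mul, ← Finset.sum_const]
      calc ∑ r ∈ S, (m / 80) ^ 2 ≤ ∑ r ∈ S, ‖zmodFourier μ₁ r‖ ^ 2 :=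
            Finset.sum_le_sum fun r hr =>
              pow_le_pow_left₀ (by positivity) (Finset.mem_filter.1 hr).2 2
        _ ≤ ∑ r, ‖zmodFourier μ₁ r‖ ^ 2 :=
            Finset.sum_le_sum_of_subset_of_nonneg (Finset.subset_univ _) fun r _ _ => by positivity
        _ ≤ 10 := by rw [sum_sq_norm_zmodFourier]; exact k₁
    have h2 : (S.card : ℝ) < k := lt_of_le_of_lt ((le_div_iff₀ (by positivity)).2 h1) hk
    exact_mod_cast h2.le
  have hfl : ∀ u : ZMod p, K * u.val / p < K := by
    intro u
    rw [Nat.div_lt_iff_lt_mul (Nat.pos_of_ne_zero (NeZero.ne p))]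
    exact Nat.mul_lt_mul_of_pos_left (ZMod.val_lt u) hK1
  have : Nonempty (Fin K) := ⟨⟨0, hK1⟩⟩
  obtain ⟨y, hy⟩ := exists_large_fiber fun (x : ZMod p) (r : S) =>
    (⟨K * (r.1 * x).val / p, hfl _⟩ : Fin K)
  set V := Finset.univ.filter fun x : ZMod p =>
    (fun r : S => (⟨K * (r.1 * x).val / p, hfl _⟩ : Fin K)) = y with hV
  have hVcard : (p : ℝ) ≤ K ^ k * V.card := by
    rw [ZMod.card, Fintype.card_fun, Fintype.card_fin, Fintype.card_coe] at hy
    have h1 : p ≤ K ^ k * V.card := hy.trans (Nat.mul_le_mul_right _ (Nat.pow_le_pow_right hK1 hScard))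
    exact_mod_cast h1
  have hV0 : (0 : ℝ) < V.card := by
    by_contra h
    have : (V.card : ℝ) = 0 := le_antisymm (not_lt.1 h) (Nat.cast_nonneg _)
    rw [this] at hVcard
    linarith
  have hpair : ∀ v ∈ V, ∀ w ∈ V, p * f (v - w) ≤ m / 2 := by
    intro v hv w hw
    have h1 := mul_tripleConv_sub_zero_le (μ₂ := μ₂) (μ₃ := μ₃) n₁ s₁ k₂ k₃ (η := m / 80)
      (τ := m / 40) (by positivity) (by positivity) (v - w) ?_
    · rw [h0] at h1
      have := mul_le_mul_of_nonneg_left (hf (v - w)) hp0.le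
      linarith
    intro r hr
    have e : (ZMod.stdAddChar (-(r * (v - w))) : ℂ) - 1 = ZMod.stdAddChar (-(r * v)) *
        ((ZMod.stdAddChar (r * w) : ℂ) - ZMod.stdAddChar (r * v)) := by
      have q : -(r * (v - w)) = -(r * v) + r * w := by ring
      have q' : (ZMod.stdAddChar (-(r * v)) : ℂ) * ZMod.stdAddChar (r * v) = 1 := by
        rw [← AddChar.map_add_eq_mul, neg_add_cancel, AddChar.map_zero_eq_one]
      rw [q, AddChar.map_add_eq_mul, mul_sub, q']
    rw [e, norm_mul, norm_stdAddChar, one_mul]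
    refine (norm_stdAddChar_sub_le _ _).trans ?_
    have hrS : r ∈ S := Finset.mem_filter.2 ⟨Finset.mem_univ _, hr⟩
    have c1 := congrArg Fin.val (congrFun (Finset.mem_filter.1 hv).2 ⟨r, hrS⟩)
    have c2 := congrArg Fin.val (congrFun (Finset.mem_filter.1 hw).2 ⟨r, hrS⟩)
    dsimp only at c1 c2
    set a := (r * v).val
    set b := (r * w).val
    have hpn : 0 < p := Nat.pos_of_ne_zero (NeZero.ne p)
    have f1 := Nat.div_add_mod (K * a) p
    have f2 := Nat.div_add_mod (K * b) p
    have g1 := Nat.mod_lt (K * a) hpn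
    have g2 := Nat.mod_lt (K * b) hpn
    rw [c1] at f1
    rw [c2] at f2
    have h3 : |(K : ℝ) * (b - a)| ≤ p := by
      have f1' : (p : ℝ) * (y ⟨r, hrS⟩ : ℕ) + ((K * a % p : ℕ) : ℝ) = K * a := by exact_mod_cast f1
      have f2' : (p : ℝ) * (y ⟨r, hrS⟩ : ℕ) + ((K * b % p : ℕ) : ℝ) = K * b := by exact_mod_cast f2
      have g1' : ((K * a % p : ℕ) : ℝ) < p := by exact_mod_cast g1
      have g2' : ((K * b % p : ℕ) : ℝ) < p := by exact_mod_cast g2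
      have z1 : (0 : ℝ) ≤ ((K * a % p : ℕ) : ℝ) := Nat.cast_nonneg _
      have z2 : (0 : ℝ) ≤ ((K * b % p : ℕ) : ℝ) := Nat.cast_nonneg _
      rw [abs_le]
      constructor <;> linarith
    rw [abs_mul, abs_of_pos hK0] at h3
    rw [abs_div, abs_of_pos hp0]
    have h4 : |(b : ℝ) - a| / p ≤ 1 / K := by
      rw [div_le_div_iff₀ hp0 hK0]
      linarith
    have h5 : 1 / (K : ℝ) ≤ m / 320 := by
      rw [div_lt_iff₀ hm] at hK
      rw [div_le_div_iff₀ hK0 (by norm_num)]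
      linarith
    have h6 := Real.pi_lt_four
    have h7 := Real.pi_pos
    nlinarith
  have hup : p * ∑ v ∈ V, ∑ w ∈ V, f (v - w) ≤ m / 2 * (V.card : ℝ) ^ 2 := by
    simp only [Finset.mul_sum]
    refine (Finset.sum_le_sum fun v hv => Finset.sum_le_sum fun w hw => hpair v hv w hw).trans
      (le_of_eq ?_)
    simp only [Finset.sum_const, nsmul_eq_mul]
    ring
  have hre := congrArg Complex.re (mul_sum_sum_sub_eq f V)
  rw [Complex.ofReal_re, Complex.re_sum] at hre
  simp only [Complex.re_mul_ofReal] at hre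
  rw [← Finset.add_sum_erase _ _ (Finset.mem_univ (0 : ZMod p))] at hre
  have hz : (zmodFourier f 0).re = ∑ x, f x := by
    simp [zmodFourier]
  have hz' : ‖∑ v ∈ V, (ZMod.stdAddChar ((0 : ZMod p) * v) : ℂ)‖ ^ 2 = (V.card : ℝ) ^ 2 := by
    simp
  rw [hz, hz'] at hre
  have hlow : -(m / (4 * K ^ k) * (p * V.card)) ≤ ∑ r ∈ Finset.univ.erase (0 : ZMod p),
      (zmodFourier f r).re * ‖∑ v ∈ V, (ZMod.stdAddChar (r * v) : ℂ)‖ ^ 2 := by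
    rw [← sum_sq_norm_sum_stdAddChar V, Finset.mul_sum, ← Finset.sum_neg_distrib]
    calc _ ≤ ∑ r ∈ Finset.univ.erase (0 : ZMod p),
          -(m / (4 * K ^ k) * ‖∑ v ∈ V, (ZMod.stdAddChar (r * v) : ℂ)‖ ^ 2) := by
          rw [← Finset.add_sum_erase _ _ (Finset.mem_univ (0 : ZMod p))]
          have : 0 ≤ m / (4 * K ^ k) * ‖∑ v ∈ V, (ZMod.stdAddChar ((0 : ZMod p) * v) : ℂ)‖ ^ 2 := by
            positivity
          linarith
      _ ≤ _ := by
          refine Finset.sum_le_sum fun r hr => ?_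
          have h1 := hcon r (Finset.ne_of_mem_erase hr)
          have h2 := (abs_le.1 (Complex.abs_re_le_norm (zmodFourier f r))).1
          have h3 : 0 ≤ ‖∑ v ∈ V, (ZMod.stdAddChar (r * v) : ℂ)‖ ^ 2 := by positivity
          nlinarith
  have h1 : m / (4 * K ^ k) * (p * V.card) ≤ m / 4 * (V.card : ℝ) ^ 2 := by
    have : m / (4 * K ^ k) * (p * V.card) ≤ m / (4 * K ^ k) * ((K ^ k * V.card) * V.card) := by
      gcongr
    refine this.trans (le_of_eq ?_)
    field_simp
  have h2 : m * (V.card : ℝ) ^ 2 ≤ (∑ x, f x) * (V.card : ℝ) ^ 2 :=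
    mul_le_mul_of_nonneg_right hfm (by positivity)
  have h3 : 0 < m * (V.card : ℝ) ^ 2 := by positivity
  linarith

/-- The additive character `x ↦ exp (2πix)` of the reals. -/
noncomputable def phase (x : ℝ) : ℂ := Complex.exp (Complex.I * (2 * Real.pi * x : ℝ))

lemma norm_phase (x : ℝ) : ‖phase x‖ = 1 := Complex.norm_exp_I_mul_ofReal _

lemma phase_add (x y : ℝ) : phase (x + y) = phase x * phase y := by
  rw [phase, phase, phase, ← Complex.exp_add]
  congr 1
  push_cast
  ring

lemma phase_intCast (m : ℤ) : phase m = 1 := by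
  rw [phase, Complex.exp_eq_one_iff]
  exact ⟨m, by push_cast; ring⟩

lemma phase_neg (x : ℝ) : phase (-x) = (starRingEnd ℂ) (phase x) := by
  rw [phase, phase, ← Complex.exp_conj]
  congr 1
  rw [map_mul, Complex.conj_I, Complex.conj_ofReal]
  push_cast
  ring

lemma phase_fract (x : ℝ) : phase (Int.fract x) = phase x := by
  conv_rhs => rw [← Int.floor_add_fract x, phase_add, phase_intCast, one_mul]

lemma phase_mul_natCast (x : ℝ) (s : ℕ) : phase (x * s) = phase x ^ s := by
  rw [phase, phase, ← Complex.exp_nat_mul]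
  congr 1
  push_cast
  ring

lemma stdAddChar_intCast_mul_natCast {p : ℕ} [NeZero p] (r : ℤ) (s : ℕ) :
    (ZMod.stdAddChar ((r : ZMod p) * (s : ZMod p)) : ℂ) = phase (r / p * s) := by
  have : ((r : ZMod p) * (s : ZMod p)) = ((r * s : ℤ) : ZMod p) := by push_cast; rfl
  rw [this, ZMod.stdAddChar_coe, phase]
  congr 1
  push_cast
  ring

lemma two_mul_min_le_sin {f : ℝ} (h0 : 0 < f) (h1 : f < 1) :
    2 * min f (1 - f) ≤ Real.sin (Real.pi * f) := by
  have hπ := Real.pi_pos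
  rcases le_total f (1 / 2) with h | h
  · have := Real.mul_le_sin (x := Real.pi * f) (by positivity) (by nlinarith)
    rw [show 2 / Real.pi * (Real.pi * f) = 2 * f by field_simp] at this
    exact le_trans (mul_le_mul_of_nonneg_left (min_le_left _ _) two_pos.le) this
  · have := Real.mul_le_sin (x := Real.pi * (1 - f))
      (mul_nonneg hπ.le (by linarith)) (by nlinarith)
    rw [show 2 / Real.pi * (Real.pi * (1 - f)) = 2 * (1 - f) by field_simp,
      show Real.pi * (1 - f) = Real.pi - Real.pi * f by ring, Real.sin_pi_sub] at this
    exact le_trans (mul_le_mul_of_nonneg_left (min_le_right _ _) two_pos.le) this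

lemma norm_sum_phase_le (L : ℕ) (x : ℝ) : ‖∑ s ∈ Finset.range L, phase (x * s)‖ ≤ L := by
  refine (norm_sum_le _ _).trans ?_
  simp [norm_phase]

lemma norm_sum_phase_le_of_fract_pos (L : ℕ) {x : ℝ} (hx : 0 < Int.fract x) :
    ‖∑ s ∈ Finset.range L, phase (x * s)‖ ≤ (Int.fract x)⁻¹ + (1 - Int.fract x)⁻¹ := by
  set f := Int.fract x with hf
  have h1 : f < 1 := Int.fract_lt_one x
  have hsin := two_mul_min_le_sin hx h1
  have hm : 0 < min f (1 - f) := lt_min hx (by linarith)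
  have hn : ‖phase x - 1‖ = 2 * Real.sin (Real.pi * f) := by
    rw [← phase_fract, phase, Complex.norm_exp_I_mul_ofReal_sub_one,
      show 2 * Real.pi * Int.fract x / 2 = Real.pi * f by rw [hf]; ring, Real.norm_eq_abs,
      abs_of_pos (by linarith)]
  have hne : phase x ≠ 1 := by
    intro h
    rw [h, sub_self, norm_zero] at hn
    linarith
  simp_rw [phase_mul_natCast]
  rw [geom_sum_eq hne, norm_div, hn, div_le_iff₀ (by linarith)]
  have h2 : ‖phase x ^ L - 1‖ ≤ 2 := by
    refine (norm_sub_le _ _).trans ?_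
    rw [norm_pow, norm_phase]
    norm_num
  have h3 : (min f (1 - f))⁻¹ ≤ f⁻¹ + (1 - f)⁻¹ := by
    have a : 0 < f⁻¹ := inv_pos.2 hx
    have b : 0 < (1 - f)⁻¹ := inv_pos.2 (by linarith)
    rcases min_choice f (1 - f) with h | h <;> rw [h] <;> linarith
  calc ‖phase x ^ L - 1‖ ≤ 2 := h2
    _ ≤ (min f (1 - f))⁻¹ * (2 * (2 * min f (1 - f))) := by field_simp; norm_num
    _ ≤ _ := by gcongr

/-- The sum of reciprocals of `H⁻¹`-separated points of `[H⁻¹, 1)`. -/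
lemma sum_inv_le_of_separated {ι : Type*} (J : Finset ι) (y : ι → ℝ) (H : ℕ) (hH : 0 < H)
    (h1 : ∀ j ∈ J, y j < 1) (h0 : ∀ j ∈ J, 1 / (H : ℝ) ≤ y j)
    (hs : ∀ j ∈ J, ∀ k ∈ J, j ≠ k → 1 / (H : ℝ) ≤ |y j - y k|) :
    ∑ j ∈ J, (y j)⁻¹ ≤ H * (1 + Real.log H) := by
  have hH' : (0 : ℝ) < H := by exact_mod_cast hH
  have hy : ∀ j ∈ J, 1 ≤ H * y j := fun j hj => by
    have := h0 j hj
    rw [div_le_iff₀ hH'] at this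
    linarith
  have hfl : ∀ j ∈ J, 1 ≤ ⌊H * y j⌋₊ := fun j hj => Nat.le_floor (by simpa using hy j hj)
  have hle : ∀ j ∈ J, (⌊H * y j⌋₊ : ℝ) ≤ H * y j := fun j hj =>
    Nat.floor_le (by linarith [hy j hj])
  have hlt : ∀ j ∈ J, H * y j < ⌊H * y j⌋₊ + 1 := fun j _ => Nat.lt_floor_add_one _
  have inj : Set.InjOn (fun j => ⌊H * y j⌋₊) J := by
    intro j hj k hk e
    by_contra hne
    have a := hs j hj k hk hne
    rw [div_le_iff₀ hH'] at a
    have e' : (⌊H * y j⌋₊ : ℝ) = ⌊H * y k⌋₊ := by exact_mod_cast e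
    have b := hle j hj
    have c := hlt j hj
    have b' := hle k hk
    have c' := hlt k hk
    rcases abs_cases (y j - y k) with ⟨h, _⟩ | ⟨h, _⟩ <;> rw [h] at a <;> nlinarith
  calc ∑ j ∈ J, (y j)⁻¹ ≤ ∑ j ∈ J, H * ((⌊H * y j⌋₊ : ℝ))⁻¹ := by
        refine Finset.sum_le_sum fun j hj => ?_
        have a : (0 : ℝ) < ⌊H * y j⌋₊ := by exact_mod_cast hfl j hj
        have b : 0 < y j := lt_of_lt_of_le (by positivity) (h0 j hj)
        rw [inv_le_iff_one_le_mul₀ b, ← div_eq_mul_inv, div_mul_eq_mul_div, one_le_div a]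
        exact hle j hj
    _ = H * ∑ b ∈ J.image fun j => ⌊H * y j⌋₊, (b : ℝ)⁻¹ := by
        rw [← Finset.mul_sum, Finset.sum_image inj]
    _ ≤ H * ∑ b ∈ Finset.Icc 1 H, (b : ℝ)⁻¹ := by
        gcongr
        intro b hb
        obtain ⟨j, hj, rfl⟩ := Finset.mem_image.1 hb
        refine Finset.mem_Icc.2 ⟨hfl j hj, ?_⟩
        refine Nat.floor_le_of_le ?_
        nlinarith [h1 j hj]
    _ ≤ _ := by
        gcongr
        have := harmonic_le_one_add_log H
        rw [harmonic_eq_sum_Icc] at this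
        push_cast at this
        exact this

/-- A dual large sieve inequality, with a logarithmic loss. -/
lemma sum_sq_norm_sum_phase_le {ι : Type*} [DecidableEq ι] (J : Finset ι) (β : ι → ℝ) (H : ℕ)
    (hH : 0 < H)
    (hs : ∀ j ∈ J, ∀ k ∈ J, j ≠ k → ∀ m : ℤ, 1 / (H : ℝ) ≤ |β j - β k - m|)
    (c : ι → ℂ) (hc : ∀ j ∈ J, ‖c j‖ ≤ 1) (L : ℕ) :
    ∑ s ∈ Finset.range L, ‖∑ j ∈ J, c j * phase (β j * s)‖ ^ 2 ≤
      J.card * (L + 2 * H * (1 + Real.log H)) := by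
  have hH' : (0 : ℝ) < H := by exact_mod_cast hH
  have key : ∀ j ∈ J, ∑ k ∈ J, ‖∑ s ∈ Finset.range L, phase ((β j - β k) * s)‖ ≤
      L + 2 * H * (1 + Real.log H) := by
    intro j hj
    rw [← Finset.add_sum_erase J _ hj]
    refine add_le_add (norm_sum_phase_le _ _) ?_
    have hfl : ∀ k ∈ J.erase j, 1 / (H : ℝ) ≤ Int.fract (β j - β k) ∧
        1 / (H : ℝ) ≤ 1 - Int.fract (β j - β k) := by
      intro k hk
      obtain ⟨hkj, hk⟩ := Finset.mem_erase.1 hk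
      have a := hs j hj k hk (Ne.symm hkj) ⌊β j - β k⌋
      have b := hs j hj k hk (Ne.symm hkj) (⌊β j - β k⌋ + 1)
      rw [Int.self_sub_floor, abs_of_nonneg (Int.fract_nonneg _)] at a
      push_cast at b
      rw [← sub_sub, Int.self_sub_floor, abs_sub_comm, abs_of_nonneg
        (by linarith [Int.fract_lt_one (β j - β k)])] at b
      exact ⟨a, b⟩
    have hsep : ∀ k ∈ J.erase j, ∀ l ∈ J.erase j, k ≠ l →
        1 / (H : ℝ) ≤ |Int.fract (β j - β k) - Int.fract (β j - β l)| := by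
      intro k hk l hl hkl
      have := hs l (Finset.mem_erase.1 hl).2 k (Finset.mem_erase.1 hk).2 (Ne.symm hkl)
        (⌊β j - β k⌋ - ⌊β j - β l⌋)
      rw [← Int.self_sub_floor, ← Int.self_sub_floor]
      push_cast at this
      convert this using 2
      ring
    calc ∑ k ∈ J.erase j, ‖∑ s ∈ Finset.range L, phase ((β j - β k) * s)‖
        ≤ ∑ k ∈ J.erase j, ((Int.fract (β j - β k))⁻¹ + (1 - Int.fract (β j - β k))⁻¹) :=
          Finset.sum_le_sum fun k hk => norm_sum_phase_le_of_fract_pos L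
            (lt_of_lt_of_le (by positivity) (hfl k hk).1)
      _ = ∑ k ∈ J.erase j, (Int.fract (β j - β k))⁻¹ +
          ∑ k ∈ J.erase j, (1 - Int.fract (β j - β k))⁻¹ := Finset.sum_add_distrib
      _ ≤ H * (1 + Real.log H) + H * (1 + Real.log H) := by
          refine add_le_add ?_ ?_
          · exact sum_inv_le_of_separated _ _ H hH (fun k _ => Int.fract_lt_one _)
              (fun k hk => (hfl k hk).1) hsep
          · refine sum_inv_le_of_separated _ _ H hH (fun k hk => ?_)
              (fun k hk => (hfl k hk).2) fun k hk l hl hkl => ?_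
            · have : 0 < 1 / (H : ℝ) := by positivity
              linarith [(hfl k hk).1]
            · rw [sub_sub_sub_cancel_left]
              exact hsep l hl k hk (Ne.symm hkl)
      _ = _ := by ring
  have expand : ((∑ s ∈ Finset.range L, ‖∑ j ∈ J, c j * phase (β j * s)‖ ^ 2 : ℝ) : ℂ) =
      ∑ j ∈ J, ∑ k ∈ J, c j * (starRingEnd ℂ) (c k) *
        ∑ s ∈ Finset.range L, phase ((β j - β k) * s) := by
    push_cast
    simp_rw [← Complex.mul_conj', map_sum, Finset.sum_mul_sum, Finset.mul_sum]
    rw [Finset.sum_comm]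
    refine Finset.sum_congr rfl fun j _ => ?_
    rw [Finset.sum_comm]
    refine Finset.sum_congr rfl fun k _ => Finset.sum_congr rfl fun s _ => ?_
    rw [sub_mul, sub_eq_add_neg, phase_add, phase_neg, map_mul]
    ring
  calc ∑ s ∈ Finset.range L, ‖∑ j ∈ J, c j * phase (β j * s)‖ ^ 2
      ≤ ‖((∑ s ∈ Finset.range L, ‖∑ j ∈ J, c j * phase (β j * s)‖ ^ 2 : ℝ) : ℂ)‖ := by
        rw [Complex.norm_real]
        exact Real.le_norm_self _
    _ ≤ ∑ j ∈ J, ∑ k ∈ J, ‖∑ s ∈ Finset.range L, phase ((β j - β k) * s)‖ := by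
        rw [expand]
        refine (norm_sum_le _ _).trans (Finset.sum_le_sum fun j hj => ?_)
        refine (norm_sum_le _ _).trans (Finset.sum_le_sum fun k hk => ?_)
        rw [norm_mul, norm_mul, RCLike.norm_conj]
        exact mul_le_of_le_one_left (norm_nonneg _)
          (mul_le_one₀ (hc j hj) (norm_nonneg _) (hc k hk))
    _ ≤ ∑ j ∈ J, (L + 2 * H * (1 + Real.log H)) := Finset.sum_le_sum key
    _ = _ := by rw [Finset.sum_const, nsmul_eq_mul]

/-- Sums of two fractions with distinct prime denominators are well separated modulo one. -/
lemma one_div_le_abs_add_sub_add_sub {H p q p' q' : ℕ} {r : ℕ → ℤ} (hp : p.Prime) (hq : q.Prime)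
    (hp' : p'.Prime) (hq' : q'.Prime) (hr : ¬ (p : ℤ) ∣ r p) (h1 : p ≠ q) (h2 : p ≠ p')
    (h3 : p ≠ q') (hH : p * q * p' * q' ≤ H) (m : ℤ) :
    1 / (H : ℝ) ≤ |(r p / p + r q / q) - (r p' / p' + r q' / q' : ℝ) - m| := by
  set D : ℕ := p * q * p' * q' with hD
  have a := hp.pos
  have b := hq.pos
  have a' := hp'.pos
  have b' := hq'.pos
  have hD0 : 0 < D := by positivity
  have hD' : (0 : ℝ) < D := by exact_mod_cast hD0
  set z : ℤ := r p * (q * p' * q') +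
    p * (r q * (p' * q') - r p' * (q * q') - r q' * (q * p') - m * (q * p' * q')) with hz
  have hz0 : z ≠ 0 := by
    intro h
    have d : (p : ℤ) ∣ r p * (q * p' * q' : ℕ) := by
      have : r p * (q * p' * q' : ℕ) = p * -(r q * (p' * q') - r p' * (q * q') -
        r q' * (q * p') - m * (q * p' * q')) := by push_cast; linarith
      exact ⟨_, this⟩
    rcases Int.Prime.dvd_mul' hp d with h | h
    · exact hr h
    · have h := Int.natCast_dvd_natCast.1 h
      rcases hp.dvd_mul.1 h with h | h
      · rcases hp.dvd_mul.1 h with h | h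
        · exact h1 ((Nat.prime_dvd_prime_iff_eq hp hq).1 h)
        · exact h2 ((Nat.prime_dvd_prime_iff_eq hp hp').1 h)
      · exact h3 ((Nat.prime_dvd_prime_iff_eq hp hq').1 h)
  have e : (r p / p + r q / q) - (r p' / p' + r q' / q' : ℝ) - m = z / D := by
    rw [hz, hD]
    push_cast
    field_simp
    ring
  rw [e, abs_div, abs_of_pos hD']
  have hz1 : (1 : ℝ) ≤ |(z : ℝ)| := by exact_mod_cast Int.one_le_abs hz0
  have hH' : (D : ℝ) ≤ H := by exact_mod_cast hH
  gcongr

/-- A fourth moment bound for exponential sums over fractions with prime denominators. -/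
lemma sum_norm_sum_phase_pow_four_le (S : Finset ℕ) (hS : ∀ p ∈ S, p.Prime) (r : ℕ → ℤ)
    (hr : ∀ p ∈ S, ¬ (p : ℤ) ∣ r p) (H : ℕ) (hH0 : 0 < H) (hH : ∀ p ∈ S, p ^ 4 ≤ H)
    (c : ℕ → ℂ) (hc : ∀ p ∈ S, ‖c p‖ ≤ 1) (L : ℕ) :
    ∑ s ∈ Finset.range L, ‖∑ p ∈ S, c p * phase (r p / p * s)‖ ^ 4 ≤
      10 * (S.card : ℝ) ^ 2 * (L + 2 * H * (1 + Real.log H)) := by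
  have hprod : ∀ a ∈ S, ∀ b ∈ S, ∀ c ∈ S, ∀ d ∈ S, a * b * c * d ≤ H := by
    intro a ha b hb c hc d hd
    obtain ⟨m, hm, hmax⟩ := S.exists_max_image id ⟨a, ha⟩
    refine le_trans ?_ (hH m hm)
    rw [show m ^ 4 = m * m * m * m by ring]
    exact Nat.mul_le_mul (Nat.mul_le_mul (Nat.mul_le_mul (hmax a ha) (hmax b hb)) (hmax c hc))
      (hmax d hd)
  set J := (S ×ˢ S).filter fun x => x.1 < x.2 with hJ
  set β : ℕ × ℕ → ℝ := fun x => r x.1 / x.1 + r x.2 / x.2 with hβ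
  set d : ℕ × ℕ → ℂ := fun x => c x.1 * c x.2 with hd
  have memJ : ∀ x ∈ J, x.1 ∈ S ∧ x.2 ∈ S ∧ x.1 < x.2 := fun x hx => by
    simp only [hJ, Finset.mem_filter, Finset.mem_product] at hx
    exact ⟨hx.1.1, hx.1.2, hx.2⟩
  have sep : ∀ x ∈ J, ∀ y ∈ J, x ≠ y → ∀ m : ℤ, 1 / (H : ℝ) ≤ |β x - β y - m| := by
    rintro ⟨p, q⟩ hx ⟨p', q'⟩ hy hxy m
    obtain ⟨hp, hq, hpq⟩ := memJ _ hx
    obtain ⟨hp', hq', hpq'⟩ := memJ _ hy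
    simp only [hβ] at hp hq hpq hp' hq' hpq' ⊢
    have hne : p ≠ p' ∨ q ≠ q' := by
      by_contra! h
      exact hxy (by rw [h.1, h.2])
    by_cases h : p ≠ p' ∧ p ≠ q'
    · exact one_div_le_abs_add_sub_add_sub (hS p hp) (hS q hq) (hS p' hp') (hS q' hq') (hr p hp)
        hpq.ne h.1 h.2 (hprod p hp q hq p' hp' q' hq') m
    · have h' : q ≠ p' ∧ q ≠ q' := by omega
      have := one_div_le_abs_add_sub_add_sub (hS q hq) (hS p hp) (hS p' hp') (hS q' hq') (hr q hq)
        hpq.ne' h'.1 h'.2 (hprod q hq p hp p' hp' q' hq') m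
      rwa [add_comm (r q / q : ℝ)] at this
  have cardJ : (J.card : ℝ) ≤ (S.card : ℝ) ^ 2 := by
    rw [sq]
    exact_mod_cast (Finset.card_filter_le _ _).trans (Finset.card_product S S).le
  have sieve := sum_sq_norm_sum_phase_le J β H hH0 sep d
    (fun x hx => by
      rw [norm_mul]
      exact mul_le_one₀ (hc _ (memJ x hx).1) (norm_nonneg _) (hc _ (memJ x hx).2.1)) L
  have sq_eq : ∀ s : ℕ, (∑ p ∈ S, c p * phase (r p / p * s)) ^ 2 =
      2 * ∑ x ∈ J, d x * phase (β x * s) + ∑ p ∈ S, (c p * phase (r p / p * s)) ^ 2 := by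
    intro s
    set u : ℕ → ℂ := fun p => c p * phase (r p / p * s) with hu
    have hterm : ∀ x : ℕ × ℕ, d x * phase (β x * s) = u x.1 * u x.2 := by
      intro x
      simp only [hd, hβ, hu, add_mul, phase_add]
      ring
    simp_rw [hterm]
    rw [sq, Finset.sum_mul_sum, ← Finset.sum_product',
      ← Finset.sum_filter_add_sum_filter_not (S ×ˢ S) (fun x => x.1 < x.2)
        (fun x => u x.1 * u x.2),
      ← Finset.sum_filter_add_sum_filter_not ((S ×ˢ S).filter fun x => ¬ x.1 < x.2)
        (fun x => x.2 < x.1) (fun x => u x.1 * u x.2)]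
    have e1 : ∑ x ∈ ((S ×ˢ S).filter fun x => ¬ x.1 < x.2) with x.2 < x.1, u x.1 * u x.2 =
        ∑ x ∈ J, u x.1 * u x.2 := by
      refine Finset.sum_nbij' Prod.swap Prod.swap ?_ ?_ ?_ ?_ ?_
      · intro x hx
        simp only [Finset.mem_filter, Finset.mem_product, hJ, Prod.fst_swap, Prod.snd_swap] at hx ⊢
        tauto
      · intro x hx
        simp only [Finset.mem_filter, Finset.mem_product, hJ, Prod.fst_swap, Prod.snd_swap] at hx ⊢
        refine ⟨⟨⟨hx.1.2, hx.1.1⟩, by omega⟩, hx.2⟩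
      · intro x _; simp
      · intro x _; simp
      · intro x _; simp [mul_comm]
    have e2 : ∑ x ∈ ((S ×ˢ S).filter fun x => ¬ x.1 < x.2) with ¬ x.2 < x.1, u x.1 * u x.2 =
        ∑ p ∈ S, u p ^ 2 := by
      refine Finset.sum_nbij' Prod.fst (fun p => (p, p)) ?_ ?_ ?_ ?_ ?_
      · intro x hx
        simp only [Finset.mem_filter, Finset.mem_product] at hx ⊢
        exact hx.1.1.1
      · intro x hx
        simp only [Finset.mem_filter, Finset.mem_product]
        simp [hx]
      · rintro ⟨x, y⟩ hx
        simp only [Finset.mem_filter, Finset.mem_product] at hx ⊢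
        have : x = y := by omega
        rw [this]
      · intro x _; simp
      · rintro ⟨x, y⟩ hx
        simp only [Finset.mem_filter, Finset.mem_product] at hx ⊢
        have : x = y := by omega
        rw [this, sq]
    rw [e1, e2]
    ring
  have pt : ∀ s : ℕ, ‖∑ p ∈ S, c p * phase (r p / p * s)‖ ^ 4 ≤
      8 * ‖∑ x ∈ J, d x * phase (β x * s)‖ ^ 2 + 2 * (S.card : ℝ) ^ 2 := by
    intro s
    have hD : ‖∑ p ∈ S, (c p * phase (r p / p * s)) ^ 2‖ ≤ S.card := by
      refine (norm_sum_le _ _).trans ?_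
      rw [Finset.card_eq_sum_ones, Nat.cast_sum]
      refine Finset.sum_le_sum fun p hp => ?_
      rw [norm_pow, norm_mul, norm_phase, mul_one, Nat.cast_one]
      exact pow_le_one₀ (norm_nonneg _) (hc p hp)
    have hle := norm_add_le (2 * ∑ x ∈ J, d x * phase (β x * s))
      (∑ p ∈ S, (c p * phase (r p / p * s)) ^ 2)
    rw [← sq_eq, norm_pow, norm_mul] at hle
    norm_num at hle
    rw [show ∀ x : ℝ, x ^ 4 = (x ^ 2) ^ 2 by intro x; ring]
    set a := ‖∑ x ∈ J, d x * phase (β x * s)‖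
    have ha : 0 ≤ a := norm_nonneg _
    set b : ℝ := (S.card : ℝ)
    calc (‖∑ p ∈ S, c p * phase (r p / p * s)‖ ^ 2) ^ 2 ≤ (2 * a + b) ^ 2 := by
          gcongr
          linarith
      _ ≤ _ := by nlinarith [sq_nonneg (2 * a - b)]
  have hlog : 0 ≤ Real.log H := Real.log_natCast_nonneg H
  have hbd : (0 : ℝ) ≤ 2 * H * (1 + Real.log H) := by positivity
  calc ∑ s ∈ Finset.range L, ‖∑ p ∈ S, c p * phase (r p / p * s)‖ ^ 4
      ≤ ∑ s ∈ Finset.range L,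
        (8 * ‖∑ x ∈ J, d x * phase (β x * s)‖ ^ 2 + 2 * (S.card : ℝ) ^ 2) :=
        Finset.sum_le_sum fun s _ => pt s
    _ = 8 * ∑ s ∈ Finset.range L, ‖∑ x ∈ J, d x * phase (β x * s)‖ ^ 2 +
        L * (2 * (S.card : ℝ) ^ 2) := by
        rw [Finset.sum_add_distrib, ← Finset.mul_sum]
        simp
    _ ≤ 8 * (J.card * (L + 2 * H * (1 + Real.log H))) + L * (2 * (S.card : ℝ) ^ 2) := by gcongr
    _ ≤ 8 * ((S.card : ℝ) ^ 2 * (L + 2 * H * (1 + Real.log H))) +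
        (L + 2 * H * (1 + Real.log H)) * (2 * (S.card : ℝ) ^ 2) := by
        gcongr
        linarith
    _ = _ := by ring

/-- If `T` has many large exponential sums with prime denominators, its fibres must be large. -/
lemma pow_four_le_of_large_sums {ι : Type*} (T : Finset ι) (σ : ι → ℕ) (L : ℕ)
    (hσ : ∀ t ∈ T, σ t < L) (B : ℝ) (hB : ∀ s, ((T.filter fun t => σ t = s).card : ℝ) ≤ B)
    (S : Finset ℕ) (hS : ∀ p ∈ S, p.Prime) (r : ℕ → ℤ)
    (hr : ∀ p ∈ S, ¬ (p : ℤ) ∣ r p) (H : ℕ) (hH0 : 0 < H) (hH : ∀ p ∈ S, p ^ 4 ≤ H)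
    {η : ℝ} (hη : 0 ≤ η) (hlarge : ∀ p ∈ S, η ≤ ‖∑ t ∈ T, phase (r p / p * σ t)‖) :
    (η * S.card) ^ 4 ≤
      (T.card : ℝ) ^ 3 * (B * (10 * (S.card : ℝ) ^ 2 * (L + 2 * H * (1 + Real.log H)))) := by
  set X : ℕ → ℂ := fun p => ∑ t ∈ T, phase (r p / p * σ t) with hX
  set c : ℕ → ℂ := fun p => (starRingEnd ℂ) (X p) / ‖X p‖ with hc
  have hcn : ∀ p ∈ S, ‖c p‖ ≤ 1 := by
    intro p _
    simp only [hc, norm_div, RCLike.norm_conj, Complex.norm_real, norm_norm]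
    exact div_self_le_one _
  have hcX : ∀ p, c p * X p = ‖X p‖ := by
    intro p
    by_cases h : X p = 0
    · simp [h]
    · have : (‖X p‖ : ℂ) ≠ 0 := by simpa using h
      simp only [hc]
      rw [div_mul_eq_mul_div, mul_comm, Complex.mul_conj', sq, mul_div_assoc, div_self this, mul_one]
  set Z : ℕ → ℂ := fun s => ∑ p ∈ S, c p * phase (r p / p * s) with hZ
  have e : ∑ p ∈ S, c p * X p = ∑ t ∈ T, Z (σ t) := by
    simp only [hX, hZ, Finset.mul_sum]
    exact Finset.sum_comm
  have h1 : η * S.card ≤ ∑ t ∈ T, ‖Z (σ t)‖ := by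
    calc η * S.card = ∑ p ∈ S, η := by rw [Finset.sum_const, nsmul_eq_mul, mul_comm]
      _ ≤ ∑ p ∈ S, ‖X p‖ := Finset.sum_le_sum hlarge
      _ = ‖((∑ p ∈ S, ‖X p‖ : ℝ) : ℂ)‖ := by
        rw [Complex.norm_real, Real.norm_eq_abs,
          abs_of_nonneg (Finset.sum_nonneg fun _ _ => norm_nonneg _)]
      _ = ‖∑ t ∈ T, Z (σ t)‖ := by
        rw [← e]
        push_cast
        simp_rw [hcX]
      _ ≤ _ := norm_sum_le _ _
  have h2 : (∑ t ∈ T, ‖Z (σ t)‖) ^ 4 ≤ (T.card : ℝ) ^ 3 * ∑ t ∈ T, ‖Z (σ t)‖ ^ 4 := by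
    have a := sq_sum_le_card_mul_sum_sq (s := T) (f := fun t => ‖Z (σ t)‖)
    have b := sq_sum_le_card_mul_sum_sq (s := T) (f := fun t => ‖Z (σ t)‖ ^ 2)
    calc (∑ t ∈ T, ‖Z (σ t)‖) ^ 4 = ((∑ t ∈ T, ‖Z (σ t)‖) ^ 2) ^ 2 := by ring
      _ ≤ ((T.card : ℝ) * ∑ t ∈ T, ‖Z (σ t)‖ ^ 2) ^ 2 := by gcongr
      _ = (T.card : ℝ) ^ 2 * (∑ t ∈ T, ‖Z (σ t)‖ ^ 2) ^ 2 := by ring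
      _ ≤ (T.card : ℝ) ^ 2 * (T.card * ∑ t ∈ T, (‖Z (σ t)‖ ^ 2) ^ 2) := by gcongr
      _ = _ := by simp_rw [← pow_mul]; ring
  have h3 : ∑ t ∈ T, ‖Z (σ t)‖ ^ 4 ≤ B * ∑ s ∈ Finset.range L, ‖Z s‖ ^ 4 := by
    rw [← Finset.sum_fiberwise_of_maps_to (t := Finset.range L) (g := σ)
      (fun t ht => Finset.mem_range.2 (hσ t ht)), Finset.mul_sum]
    refine Finset.sum_le_sum fun s _ => ?_
    rw [Finset.sum_congr rfl (g := fun _ => ‖Z s‖ ^ 4)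
      (fun t ht => by rw [(Finset.mem_filter.1 ht).2]), Finset.sum_const, nsmul_eq_mul]
    gcongr
    exact hB s
  have hB0 : 0 ≤ B := (Nat.cast_nonneg _).trans (hB 0)
  calc (η * S.card) ^ 4 ≤ (∑ t ∈ T, ‖Z (σ t)‖) ^ 4 := by gcongr
    _ ≤ (T.card : ℝ) ^ 3 * (B * ∑ s ∈ Finset.range L, ‖Z s‖ ^ 4) :=
      h2.trans (by gcongr)
    _ ≤ _ := by
      gcongr
      exact sum_norm_sum_phase_pow_four_le S hS r hr H hH0 hH c hcn L

/-- The distribution of `A` in residue classes modulo `p`. -/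
noncomputable def residueDensity (p : ℕ) (A : Finset ℕ) (x : ZMod p) : ℝ :=
  ((A.filter fun a : ℕ => (a : ZMod p) = x).card : ℝ) / A.card

lemma residueDensity_nonneg (p : ℕ) (A : Finset ℕ) (x : ZMod p) : 0 ≤ residueDensity p A x := by
  unfold residueDensity
  positivity

lemma residueDensity_eq_zero {p : ℕ} {A : Finset ℕ} (x : ZMod p) (hx : x ∉ residues p A) :
    residueDensity p A x = 0 := by
  rw [residueDensity, Finset.filter_eq_empty_iff.2, Finset.card_empty]
  · simp
  · rintro a ha rfl
    exact hx (Finset.mem_image_of_mem _ ha)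

section

variable {p : ℕ} [NeZero p]

lemma sum_residueDensity_mul (A : Finset ℕ) (g : ZMod p → ℝ) :
    ∑ x, residueDensity p A x * g x = (∑ a ∈ A, g a) / A.card := by
  rw [← Finset.sum_fiberwise A (fun a : ℕ => (a : ZMod p)), Finset.sum_div]
  refine Finset.sum_congr rfl fun x _ => ?_
  rw [Finset.sum_congr rfl (g := fun _ => g x)
    (fun a ha => by rw [(Finset.mem_filter.1 ha).2]), Finset.sum_const, nsmul_eq_mul,
    residueDensity]
  ring

lemma sum_residueDensity {A : Finset ℕ} (hA : A.Nonempty) : ∑ x, residueDensity p A x = 1 := by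
  have := sum_residueDensity_mul (p := p) A fun _ => 1
  have h : (A.card : ℝ) ≠ 0 := by exact_mod_cast hA.card_pos.ne'
  simpa [h] using this

lemma mul_sum_sq_residueDensity (A : Finset ℕ) :
    p * ∑ x, residueDensity p A x ^ 2 = collisionDensity A p := by
  have h : (collisions A p : ℝ) =
      ∑ x : ZMod p, ((A.filter fun a : ℕ => (a : ZMod p) = x).card : ℝ) ^ 2 := by
    rw [collisions_eq_sum_sq]
    push_cast
    refine Finset.sum_subset (Finset.subset_univ _) fun x _ hx => ?_
    rw [Finset.filter_eq_empty_iff.2]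
    · simp
    · rintro a ha rfl
      exact hx (Finset.mem_image_of_mem _ ha)
  rw [collisionDensity, h, mul_div_assoc, Finset.sum_div]
  simp only [residueDensity, div_pow]

end

lemma sum_ne_zero_of_not_dvd {p : ℕ} {A₁ A₂ A₃ : Finset ℕ}
    (h0 : ∀ a₁ ∈ A₁, ∀ a₂ ∈ A₂, ∀ a₃ ∈ A₃, ¬ p ∣ a₁ + a₂ + a₃) :
    ∀ x ∈ residues p A₁, ∀ y ∈ residues p A₂, ∀ z ∈ residues p A₃, x + y + z ≠ 0 := by
  intro x hx y hy z hz h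
  obtain ⟨a, ha, rfl⟩ := Finset.mem_image.1 hx
  obtain ⟨b, hb, rfl⟩ := Finset.mem_image.1 hy
  obtain ⟨c, hc, rfl⟩ := Finset.mem_image.1 hz
  refine h0 a ha b hb c hc ?_
  rw [← ZMod.natCast_eq_zero_iff]
  exact_mod_cast h

/-- The sums of three sets avoid multiples of the prime `p`, while the three sets are nearly as
equidistributed modulo `p` as this allows. -/
structure NearExtremal (A₁ A₂ A₃ : Finset ℕ) (p : ℕ) : Prop where
  prime : p.Prime
  large : 10 ^ 100 ≤ p
  not_dvd : ∀ a₁ ∈ A₁, ∀ a₂ ∈ A₂, ∀ a₃ ∈ A₃, ¬ p ∣ a₁ + a₂ + a₃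
  collisionDensity_le : collisionDensity A₁ p + collisionDensity A₂ p + collisionDensity A₃ p ≤
    9 + 1 / 10 ^ 50

lemma nine_sub_le_collisionDensity {A₁ A₂ A₃ : Finset ℕ} {p : ℕ} (hp : p.Prime)
    (n₁ : A₁.Nonempty) (n₂ : A₂.Nonempty) (n₃ : A₃.Nonempty)
    (h0 : ∀ a₁ ∈ A₁, ∀ a₂ ∈ A₂, ∀ a₃ ∈ A₃, ¬ p ∣ a₁ + a₂ + a₃) :
    9 - 9 / p ≤ collisionDensity A₁ p + collisionDensity A₂ p + collisionDensity A₃ p := by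
  have : Fact p.Prime := ⟨hp⟩
  have := nine_sub_le_sum_sq (sum_ne_zero_of_not_dvd h0) (sum_residueDensity n₁)
    (sum_residueDensity n₂) (sum_residueDensity n₃) residueDensity_eq_zero residueDensity_eq_zero
    residueDensity_eq_zero
  simpa only [mul_sum_sq_residueDensity] using this

lemma collisionDensity_nonneg (A : Finset ℕ) (p : ℕ) : 0 ≤ collisionDensity A p := by
  unfold collisionDensity
  positivity

open scoped Pointwise in
/-- The larger-sieve weight of the fibres of `A₂ + A₃` over `b`. -/
noncomputable def pairWeight (A₂ A₃ : Finset ℕ) (p b : ℕ) : ℝ :=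
  capWeight (residues p A₂) (residues p A₃) b

open scoped Pointwise in
/-- The larger-sieve weight of the fibres of `A₁ + (A₂ + A₃)` over `s`. -/
noncomputable def tripleWeight (A₁ A₂ A₃ : Finset ℕ) (p s : ℕ) : ℝ :=
  capWeight (residues p A₁) (residues p A₂ + residues p A₃) s

lemma NearExtremal.mul_card_le_sum {A₁ A₂ A₃ : Finset ℕ} {p : ℕ} (h : NearExtremal A₁ A₂ A₃ p)
    (n₁ : A₁.Nonempty) (n₂ : A₂.Nonempty) (n₃ : A₃.Nonempty) :
    (9 + 1 / 10 ^ 5) * (A₁.card * A₂.card * A₃.card : ℝ) ≤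
      ∑ a₁ ∈ A₁, ∑ a₂ ∈ A₂, ∑ a₃ ∈ A₃,
        (pairWeight A₂ A₃ p (a₂ + a₃) + tripleWeight A₁ A₂ A₃ p (a₁ + (a₂ + a₃))) := by
  have : Fact p.Prime := ⟨h.prime⟩
  have := local_gain (le_trans (by norm_num) h.large) (sum_ne_zero_of_not_dvd h.not_dvd) (residueDensity_nonneg p A₂)
    (residueDensity_nonneg p A₃) (sum_residueDensity n₁)
    (sum_residueDensity n₂) (sum_residueDensity n₃) residueDensity_eq_zero residueDensity_eq_zero
    residueDensity_eq_zero (by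
      simpa only [mul_sum_sq_residueDensity] using h.collisionDensity_le)
  simp_rw [mul_assoc, ← Finset.mul_sum] at this
  rw [sum_residueDensity_mul] at this
  simp_rw [sum_residueDensity_mul] at this
  have c₁ : (0 : ℝ) < A₁.card := by exact_mod_cast n₁.card_pos
  have c₂ : (0 : ℝ) < A₂.card := by exact_mod_cast n₂.card_pos
  have c₃ : (0 : ℝ) < A₃.card := by exact_mod_cast n₃.card_pos
  simp_rw [← Finset.sum_div, div_div] at this
  rw [le_div_iff₀ (by positivity)] at this
  simp only [pairWeight, tripleWeight, Nat.cast_add]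
  linarith

lemma tripleConv_residueDensity {p : ℕ} [NeZero p] {A₁ A₂ A₃ : Finset ℕ} (x : ZMod p) :
    tripleConv (residueDensity p A₁) (residueDensity p A₂) (residueDensity p A₃) x =
      (((A₁ ×ˢ A₂ ×ˢ A₃).filter fun t : ℕ × ℕ × ℕ =>
        ((t.1 + t.2.1 + t.2.2 : ℕ) : ZMod p) = x).card : ℝ) /
        (A₁.card * A₂.card * A₃.card) := by
  unfold tripleConv
  simp_rw [mul_assoc, ← Finset.mul_sum]
  rw [sum_residueDensity_mul]
  simp_rw [sum_residueDensity_mul]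
  rw [← Finset.sum_div, div_div, mul_comm (A₂.card : ℝ)]
  have : ∀ a b : ℕ, residueDensity p A₃ (x - ((a : ZMod p) + b)) =
      (∑ c ∈ A₃, if ((a + b + c : ℕ) : ZMod p) = x then (1 : ℝ) else 0) / A₃.card := by
    intro a b
    rw [residueDensity, Finset.card_filter]
    push_cast
    simp only [eq_sub_iff_add_eq, add_comm]
  simp_rw [this, ← Finset.sum_div]
  rw [div_div, Finset.card_filter, Finset.sum_product]
  simp_rw [Finset.sum_product]
  push_cast
  congr 1
  ring

lemma exists_large_sum_phase (m : ℝ) (hm : 0 < m) : ∃ ρ : ℝ, 0 < ρ ∧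
    ∀ (A₁ A₂ A₃ : Finset ℕ) (p : ℕ), NearExtremal A₁ A₂ A₃ p → A₁.Nonempty → A₂.Nonempty →
      A₃.Nonempty → ∀ F ⊆ A₁ ×ˢ A₂ ×ˢ A₃, m * (A₁.card * A₂.card * A₃.card : ℝ) ≤ F.card →
        ∃ r : ℤ, ¬ (p : ℤ) ∣ r ∧ ρ * (A₁.card * A₂.card * A₃.card : ℝ) ≤
          ‖∑ t ∈ F, phase (r / p * (t.1 + t.2.1 + t.2.2 : ℕ))‖ := by
  obtain ⟨ρ, hρ, H⟩ := exists_large_zmodFourier m hm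
  refine ⟨ρ, hρ, fun A₁ A₂ A₃ p h n₁ n₂ n₃ F hF hFm => ?_⟩
  have : Fact p.Prime := ⟨h.prime⟩
  have c₁ : (0 : ℝ) < A₁.card := by exact_mod_cast n₁.card_pos
  have c₂ : (0 : ℝ) < A₂.card := by exact_mod_cast n₂.card_pos
  have c₃ : (0 : ℝ) < A₃.card := by exact_mod_cast n₃.card_pos
  set n : ℝ := A₁.card * A₂.card * A₃.card with hn
  have hn0 : 0 < n := by positivity
  set σ : ℕ × ℕ × ℕ → ℕ := fun t => t.1 + t.2.1 + t.2.2 with hσ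
  set f : ZMod p → ℝ := fun x => ((F.filter fun t => (σ t : ZMod p) = x).card : ℝ) / n with hf
  have k := h.collisionDensity_le
  have k₁ := collisionDensity_nonneg A₁ p
  have k₂ := collisionDensity_nonneg A₂ p
  have k₃ := collisionDensity_nonneg A₃ p
  norm_num at k
  obtain ⟨r, hr0, hr⟩ := H p f (residueDensity p A₁) (residueDensity p A₂) (residueDensity p A₃)
    (residueDensity_nonneg p A₁) (sum_residueDensity n₁)
    (by rw [mul_sum_sq_residueDensity]; linarith) (by rw [mul_sum_sq_residueDensity]; linarith)
    (by rw [mul_sum_sq_residueDensity]; linarith)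
    (by
      intro x
      rw [tripleConv_residueDensity]
      simp only [hf]
      gcongr)
    (by
      rw [tripleConv_residueDensity, Finset.filter_eq_empty_iff.2]
      · simp
      · rintro ⟨a, b, c⟩ ht
        simp only [Finset.mem_product] at ht
        rw [ZMod.natCast_eq_zero_iff]
        exact h.not_dvd a ht.1 b ht.2.1 c ht.2.2)
    (by
      simp only [hf]
      rw [← Finset.sum_div, le_div_iff₀ hn0]
      refine hFm.trans_eq ?_
      rw [Finset.card_eq_sum_card_fiberwise (t := Finset.univ) (f := fun t => (σ t : ZMod p))
        (fun _ _ => Finset.mem_coe.2 (Finset.mem_univ _))]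
      push_cast
      rfl)
  refine ⟨(r.val : ℤ), ?_, ?_⟩
  · rw [← ZMod.intCast_zmod_eq_zero_iff_dvd]
    simpa using hr0
  · have e : zmodFourier f r = (∑ t ∈ F, phase (((r.val : ℤ) : ℝ) / p * σ t)) / n := by
      rw [zmodFourier, ← Finset.sum_fiberwise F (fun t => (σ t : ZMod p)), Finset.sum_div]
      refine Finset.sum_congr rfl fun x _ => ?_
      rw [Finset.sum_congr rfl (g := fun _ => (ZMod.stdAddChar (r * x) : ℂ)) (fun t ht => by
        rw [← stdAddChar_intCast_mul_natCast, (Finset.mem_filter.1 ht).2]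
        simp), Finset.sum_const, nsmul_eq_mul]
      simp only [hf]
      push_cast
      ring
    rw [e, norm_div, Complex.norm_real, Real.norm_eq_abs, abs_of_pos hn0, le_div_iff₀ hn0] at hr
    exact hr

/-- Three sets of `n` positive integers up to `N`, with `N` not much larger than `n ^ 3`, none of
whose sums is divisible by a prime up to `n`. -/
structure SievedTriple (A₁ A₂ A₃ : Finset ℕ) (N n : ℕ) : Prop where
  two_le : 2 ≤ n
  subset₁ : A₁ ⊆ Finset.Icc 1 N
  subset₂ : A₂ ⊆ Finset.Icc 1 N
  subset₃ : A₃ ⊆ Finset.Icc 1 N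
  card₁ : A₁.card = n
  card₂ : A₂.card = n
  card₃ : A₃.card = n
  log_le : Real.log N ≤ (3 + 1 / 10 ^ 100) * Real.log n
  not_dvd : ∀ p, p.Prime → p ≤ n → ∀ a₁ ∈ A₁, ∀ a₂ ∈ A₂, ∀ a₃ ∈ A₃, ¬ p ∣ a₁ + a₂ + a₃

lemma mertensWeight_nonneg (S : Finset ℕ) : 0 ≤ mertensWeight S :=
  Finset.sum_nonneg fun p _ => div_nonneg (Real.log_natCast_nonneg p) (Nat.cast_nonneg p)

lemma mertensWeight_mono {S T : Finset ℕ} (h : S ⊆ T) : mertensWeight S ≤ mertensWeight T :=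
  Finset.sum_le_sum_of_subset_of_nonneg h fun p _ _ =>
    div_nonneg (Real.log_natCast_nonneg p) (Nat.cast_nonneg p)

lemma mertensWeight_union_le (S T : Finset ℕ) :
    mertensWeight (S ∪ T) ≤ mertensWeight S + mertensWeight T := by
  unfold mertensWeight
  rw [← Finset.sum_union_inter]
  exact le_add_of_nonneg_right (mertensWeight_nonneg (S ∩ T))

namespace SievedTriple

variable {A₁ A₂ A₃ : Finset ℕ} {N n : ℕ}

lemma nonempty₁ (h : SievedTriple A₁ A₂ A₃ N n) : A₁.Nonempty :=
  Finset.card_pos.1 (by rw [h.card₁]; linarith [h.two_le])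

lemma nonempty₂ (h : SievedTriple A₁ A₂ A₃ N n) : A₂.Nonempty :=
  Finset.card_pos.1 (by rw [h.card₂]; linarith [h.two_le])

lemma nonempty₃ (h : SievedTriple A₁ A₂ A₃ N n) : A₃.Nonempty :=
  Finset.card_pos.1 (by rw [h.card₃]; linarith [h.two_le])

lemma log_pos (h : SievedTriple A₁ A₂ A₃ N n) : 0 < Real.log n :=
  Real.log_pos (by exact_mod_cast h.two_le)

end SievedTriple

open scoped Classical in
/-- The primes up to `n` modulo which `A₁`, `A₂`, `A₃` are nearly extremal. -/
noncomputable def goodPrimes (A₁ A₂ A₃ : Finset ℕ) (n : ℕ) : Finset ℕ :=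
  n.primesLE.filter fun p => NearExtremal A₁ A₂ A₃ p

lemma mem_goodPrimes {A₁ A₂ A₃ : Finset ℕ} {n p : ℕ} :
    p ∈ goodPrimes A₁ A₂ A₃ n ↔ p ≤ n ∧ NearExtremal A₁ A₂ A₃ p := by
  simp only [goodPrimes, Finset.mem_filter, Nat.mem_primesLE]
  exact ⟨fun h => ⟨h.1.1, h.2⟩, fun h => ⟨⟨h.1, h.2.prime⟩, h.2⟩⟩

/-- Few primes fail to be nearly extremal. -/
lemma exists_mertensWeight_sdiff_goodPrimes_le : ∃ K : ℝ, 0 < K ∧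
    ∀ (A₁ A₂ A₃ : Finset ℕ) (N n : ℕ), SievedTriple A₁ A₂ A₃ N n →
      mertensWeight (n.primesLE \ goodPrimes A₁ A₂ A₃ n) ≤ 1 / 10 ^ 48 * Real.log n + K := by
  obtain ⟨C, hC, hM⟩ := exists_abs_mertensWeight_sub_log_le
  set K₁ : ℝ := Real.log ((10 ^ 100 : ℕ) : ℝ) + Real.log 4 with hK₁
  have hl4 : 0 < Real.log 4 := Real.log_pos (by norm_num)
  have hK₁0 : 0 < K₁ := add_pos (Real.log_pos (by norm_num)) hl4
  refine ⟨K₁ + 10 ^ 50 * (3 * Real.log 4 + 9 * (C + K₁)), by positivity,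
    fun A₁ A₂ A₃ N n h => ?_⟩
  have hn1 : 1 ≤ n := by linarith [h.two_le]
  set small := n.primesLE.filter (· < 10 ^ 100) with hsmall
  set Q := n.primesLE.filter (10 ^ 100 ≤ ·) with hQ
  set bad := Q \ goodPrimes A₁ A₂ A₃ n with hbad
  have hsmall_le : mertensWeight small ≤ K₁ := by
    refine (mertensWeight_mono fun p hp => ?_).trans
      (mertensWeight_primesLE_le (10 ^ 100) (Nat.one_le_pow _ _ (by norm_num)))
    simp only [hsmall, Finset.mem_filter, Nat.mem_primesLE] at hp
    exact Nat.mem_primesLE.2 ⟨hp.2.le, hp.1.2⟩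
  have hcover : n.primesLE \ goodPrimes A₁ A₂ A₃ n ⊆ small ∪ bad := by
    intro p hp
    simp only [hsmall, hbad, hQ, Finset.mem_union, Finset.mem_sdiff, Finset.mem_filter] at hp ⊢
    by_cases hlt : p < 10 ^ 100
    · exact Or.inl ⟨hp.1, hlt⟩
    · exact Or.inr ⟨⟨hp.1, not_lt.1 hlt⟩, hp.2⟩
  have hQ_ge : Real.log n - C - K₁ ≤ mertensWeight Q := by
    have a := (abs_le.1 (hM n (by exact_mod_cast hn1))).1
    rw [Nat.floor_natCast] at a
    have b : n.primesLE ⊆ small ∪ Q := by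
      intro p hp
      simp only [hsmall, hQ, Finset.mem_union, Finset.mem_filter]
      exact (lt_or_ge p (10 ^ 100)).imp (fun x => ⟨hp, x⟩) fun x => ⟨hp, x⟩
    have := (mertensWeight_mono b).trans (mertensWeight_union_le _ _)
    linarith
  have hQprime : ∀ p ∈ Q, p.Prime ∧ p ≤ n ∧ 10 ^ 100 ≤ p := by
    intro p hp
    simp only [hQ, Finset.mem_filter, Nat.mem_primesLE] at hp
    exact ⟨hp.1.2, hp.1.1, hp.2⟩
  set κ : ℕ → ℝ := fun p =>
    collisionDensity A₁ p + collisionDensity A₂ p + collisionDensity A₃ p with hκ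
  have hsum : ∑ p ∈ Q, Real.log p / p * κ p ≤ 3 * (Real.log N + Real.log 4) := by
    have s₁ := sum_mul_collisionDensity_le Q (fun p hp => (hQprime p hp).1) N A₁ h.subset₁
      h.nonempty₁ (fun p hp => by rw [h.card₁]; exact (hQprime p hp).2.1)
    have s₂ := sum_mul_collisionDensity_le Q (fun p hp => (hQprime p hp).1) N A₂ h.subset₂
      h.nonempty₂ (fun p hp => by rw [h.card₂]; exact (hQprime p hp).2.1)
    have s₃ := sum_mul_collisionDensity_le Q (fun p hp => (hQprime p hp).1) N A₃ h.subset₃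
      h.nonempty₃ (fun p hp => by rw [h.card₃]; exact (hQprime p hp).2.1)
    simp only [hκ, mul_add, Finset.sum_add_distrib]
    linarith
  have hw : ∀ p : ℕ, 0 ≤ Real.log p / p := fun p =>
    div_nonneg (Real.log_natCast_nonneg p) (Nat.cast_nonneg p)
  have hterm : ∀ p ∈ Q, 0 ≤ κ p - 9 + 9 / 10 ^ 100 := by
    intro p hp
    obtain ⟨hpp, hpn, hpl⟩ := hQprime p hp
    have a := nine_sub_le_collisionDensity hpp h.nonempty₁ h.nonempty₂ h.nonempty₃
      (h.not_dvd p hpp hpn)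
    have b : (9 : ℝ) / p ≤ 9 / 10 ^ 100 := by
      have : ((10 ^ 100 : ℕ) : ℝ) ≤ p := by exact_mod_cast hpl
      rw [Nat.cast_pow, Nat.cast_ofNat] at this
      gcongr
    simp only [hκ]
    linarith
  have hbad_term : ∀ p ∈ bad, 1 / 10 ^ 50 ≤ κ p - 9 + 9 / 10 ^ 100 := by
    intro p hp
    obtain ⟨hpQ, hpG⟩ := Finset.mem_sdiff.1 hp
    obtain ⟨hpp, hpn, hpl⟩ := hQprime p hpQ
    have : 9 + 1 / 10 ^ 50 < κ p := by
      by_contra! hle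
      exact hpG (mem_goodPrimes.2 ⟨hpn,
        ⟨hpp, hpl, h.not_dvd p hpp hpn, hle⟩⟩)
    have : (0 : ℝ) < 9 / 10 ^ 100 := by positivity
    linarith
  have hchain : 1 / 10 ^ 50 * mertensWeight bad ≤
      3 * (Real.log N + Real.log 4) - (9 - 9 / 10 ^ 100) * mertensWeight Q := by
    calc 1 / 10 ^ 50 * mertensWeight bad
        ≤ ∑ p ∈ bad, Real.log p / p * (κ p - 9 + 9 / 10 ^ 100) := by
          rw [mertensWeight, Finset.mul_sum]
          refine Finset.sum_le_sum fun p hp => ?_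
          rw [mul_comm]
          exact mul_le_mul_of_nonneg_left (hbad_term p hp) (hw p)
      _ ≤ ∑ p ∈ Q, Real.log p / p * (κ p - 9 + 9 / 10 ^ 100) :=
          Finset.sum_le_sum_of_subset_of_nonneg Finset.sdiff_subset fun p hp _ =>
            mul_nonneg (hw p) (hterm p hp)
      _ = ∑ p ∈ Q, Real.log p / p * κ p - (9 - 9 / 10 ^ 100) * mertensWeight Q := by
          rw [mertensWeight, Finset.mul_sum, ← Finset.sum_sub_distrib]
          exact Finset.sum_congr rfl fun p _ => by ring
      _ ≤ _ := by linarith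
  have hlog := h.log_le
  have hlp := h.log_pos
  have hbadK : mertensWeight bad ≤
      1 / 10 ^ 48 * Real.log n + 10 ^ 50 * (3 * Real.log 4 + 9 * (C + K₁)) := by
    have : (9 - 9 / 10 ^ 100) * (Real.log n - C - K₁) ≤ (9 - 9 / 10 ^ 100) * mertensWeight Q :=
      mul_le_mul_of_nonneg_left hQ_ge (by norm_num)
    have h1 : 1 / 10 ^ 50 * mertensWeight bad ≤
        12 / 10 ^ 100 * Real.log n + (3 * Real.log 4 + 9 * (C + K₁)) := by
      linarith
    have h2 : 1 / 10 ^ 50 * mertensWeight bad ≤ 1 / 10 ^ 50 *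
        (1 / 10 ^ 48 * Real.log n + 10 ^ 50 * (3 * Real.log 4 + 9 * (C + K₁))) := by
      linarith
    exact le_of_mul_le_mul_left h2 (by positivity)
  have := (mertensWeight_mono hcover).trans (mertensWeight_union_le _ _)
  linarith

/-- Nearly extremal primes are distributed like all primes on a logarithmic scale. -/
lemma exists_le_mertensWeight_goodPrimes : ∃ K : ℝ, 0 < K ∧
    ∀ (A₁ A₂ A₃ : Finset ℕ) (N n : ℕ), SievedTriple A₁ A₂ A₃ N n → ∀ v : ℝ, 1 ≤ v → v ≤ n →
      (Real.log v - (1 / 10 ^ 48 * Real.log n + K) ≤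
        mertensWeight ((goodPrimes A₁ A₂ A₃ n).filter fun p : ℕ => (p : ℝ) ≤ v)) ∧
      ∀ u : ℝ, 1 ≤ u →
        Real.log v - Real.log u - (1 / 10 ^ 48 * Real.log n + K) ≤
        mertensWeight ((goodPrimes A₁ A₂ A₃ n).filter fun p : ℕ => u < p ∧ (p : ℝ) ≤ v) := by
  obtain ⟨C, hC, hM⟩ := exists_abs_mertensWeight_sub_log_le
  obtain ⟨K, hK, hbad⟩ := exists_mertensWeight_sdiff_goodPrimes_le
  refine ⟨2 * C + K, by positivity, fun A₁ A₂ A₃ N n h v hv hvn => ?_⟩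
  have hb := hbad A₁ A₂ A₃ N n h
  have a := (abs_le.1 (hM v hv)).1
  set G := goodPrimes A₁ A₂ A₃ n
  refine ⟨?_, fun u hu => ?_⟩
  · have hsub : ⌊v⌋₊.primesLE ⊆ (G.filter fun p : ℕ => (p : ℝ) ≤ v) ∪ (n.primesLE \ G) := by
      intro p hp
      rw [Nat.mem_primesLE, Nat.le_floor_iff (by linarith)] at hp
      have hpn : p ≤ n := by exact_mod_cast hp.1.trans hvn
      simp only [Finset.mem_union, Finset.mem_filter, Finset.mem_sdiff, Nat.mem_primesLE]
      tauto
    have := (mertensWeight_mono hsub).trans (mertensWeight_union_le _ _)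
    linarith
  · have b := (abs_le.1 (hM u hu)).2
    have hsub : ⌊v⌋₊.primesLE ⊆ ((G.filter fun p : ℕ => u < p ∧ (p : ℝ) ≤ v) ∪
        (n.primesLE \ G)) ∪ ⌊u⌋₊.primesLE := by
      intro p hp
      rw [Nat.mem_primesLE, Nat.le_floor_iff (by linarith)] at hp
      have hpn : p ≤ n := by exact_mod_cast hp.1.trans hvn
      simp only [Finset.mem_union, Finset.mem_filter, Finset.mem_sdiff, Nat.mem_primesLE,
        Nat.le_floor_iff (by linarith : (0 : ℝ) ≤ u)]
      have := lt_or_ge u (p : ℝ)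
      tauto
    have := (mertensWeight_mono hsub).trans (mertensWeight_union_le _ _)
    have := mertensWeight_union_le (G.filter fun p : ℕ => u < p ∧ (p : ℝ) ≤ v) (n.primesLE \ G)
    linarith

lemma capWeight_mul_card_residues_le {p : ℕ} (hp : p.Prime) {A P : Finset ℕ} (B : Finset (ZMod p))
    (hP : P.Nonempty) (hPA : P ⊆ A) (s : ℕ) (hB : ∀ a ∈ P, (s : ZMod p) - (a : ZMod p) ∈ B) :
    capWeight (residues p A) B s * (residues p P).card ≤ p := by
  have : Fact p.Prime := ⟨hp⟩
  have hm : 0 < (residues p P).card := (hP.image _).card_pos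
  have hle : (residues p P).card ≤ repCount (residues p A) B s := by
    refine Finset.card_le_card fun x hx => ?_
    obtain ⟨a, ha, rfl⟩ := Finset.mem_image.1 hx
    exact Finset.mem_filter.2 ⟨Finset.mem_image_of_mem _ (hPA ha), hB a ha⟩
  rw [← le_div_iff₀ (by exact_mod_cast hm)]
  exact capWeight_le_div _ _ _ hm hle

namespace NearExtremal

variable {A₁ A₂ A₃ : Finset ℕ} {p : ℕ}

lemma card_residues (h : NearExtremal A₁ A₂ A₃ p) (n₁ : A₁.Nonempty) (n₂ : A₂.Nonempty)
    (n₃ : A₃.Nonempty) :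
    |((residues p A₁).card : ℝ) / p - 1 / 3| ≤ 1 / 10 ^ 25 ∧
      |((residues p A₂).card : ℝ) / p - 1 / 3| ≤ 1 / 10 ^ 25 := by
  have : Fact p.Prime := ⟨h.prime⟩
  have := near_uniform_of_sum_sq_le (le_trans (by norm_num) h.large)
    (sum_ne_zero_of_not_dvd h.not_dvd) (sum_residueDensity n₁)
    (sum_residueDensity n₂) (sum_residueDensity n₃) residueDensity_eq_zero residueDensity_eq_zero
    residueDensity_eq_zero (by
      simpa only [mul_sum_sq_residueDensity] using h.collisionDensity_le)
  exact ⟨this.1.1, this.2.1.1⟩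

lemma le_tripleWeight (h : NearExtremal A₁ A₂ A₃ p) (n₁ : A₁.Nonempty) (n₂ : A₂.Nonempty)
    (n₃ : A₃.Nonempty) (s : ℕ) : 3 - 1 / 10 ^ 20 ≤ tripleWeight A₁ A₂ A₃ p s := by
  have : Fact p.Prime := ⟨h.prime⟩
  exact le_capWeight_of_card _ _ _ (h.card_residues n₁ n₂ n₃).1

lemma le_pairWeight (h : NearExtremal A₁ A₂ A₃ p) (n₁ : A₁.Nonempty) (n₂ : A₂.Nonempty)
    (n₃ : A₃.Nonempty) (b : ℕ) : 3 - 1 / 10 ^ 20 ≤ pairWeight A₂ A₃ p b := by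
  have : Fact p.Prime := ⟨h.prime⟩
  exact le_capWeight_of_card _ _ _ (h.card_residues n₁ n₂ n₃).2

end NearExtremal

lemma natCast_sub_mem_residues {p : ℕ} {A : Finset ℕ} {s a b : ℕ} (hb : b ∈ A)
    (h : s = a + b) : (s : ZMod p) - (a : ZMod p) ∈ residues p A := by
  rw [h, Nat.cast_add, add_sub_cancel_left]
  exact Finset.mem_image_of_mem _ hb

open scoped Pointwise in
lemma natCast_sub_mem_residues_add {p : ℕ} {A B : Finset ℕ} {s a b c : ℕ} (hb : b ∈ A)
    (hc : c ∈ B) (h : s = a + (b + c)) :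
    (s : ZMod p) - (a : ZMod p) ∈ residues p A + residues p B := by
  rw [h, Nat.cast_add, add_sub_cancel_left, Nat.cast_add]
  exact Finset.add_mem_add (Finset.mem_image_of_mem _ hb) (Finset.mem_image_of_mem _ hc)

lemma pairWeight_mul_card_residues_le {p : ℕ} (hp : p.Prime) {A₂ A₃ P : Finset ℕ} {b : ℕ}
    (hP : P.Nonempty) (hPA : P ⊆ A₂) (hb : ∀ y ∈ P, ∃ z ∈ A₃, y + z = b) :
    pairWeight A₂ A₃ p b * (residues p P).card ≤ p :=
  capWeight_mul_card_residues_le hp _ hP hPA b fun y hy => by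
    obtain ⟨z, hz, e⟩ := hb y hy
    exact natCast_sub_mem_residues hz e.symm

lemma tripleWeight_mul_card_residues_le {p : ℕ} (hp : p.Prime) {A₁ A₂ A₃ P : Finset ℕ} {s : ℕ}
    (hP : P.Nonempty) (hPA : P ⊆ A₁) (hs : ∀ x ∈ P, ∃ y ∈ A₂, ∃ z ∈ A₃, x + (y + z) = s) :
    tripleWeight A₁ A₂ A₃ p s * (residues p P).card ≤ p :=
  capWeight_mul_card_residues_le hp _ hP hPA s fun x hx => by
    obtain ⟨y, hy, z, hz, e⟩ := hs x hx
    exact natCast_sub_mem_residues_add hy hz e.symm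

/-- A weighted form of the larger sieve. -/
lemma sum_mul_le_of_mul_card_residues_le (Q : Finset ℕ) (hQ : ∀ p ∈ Q, p.Prime) (N : ℕ)
    (P : Finset ℕ) (hPN : P ⊆ Finset.Icc 1 N) (hP : P.Nonempty) (hQP : ∀ p ∈ Q, p ≤ P.card)
    (k : ℕ → ℝ) (hk : ∀ p ∈ Q, k p * (residues p P).card ≤ p) :
    ∑ p ∈ Q, Real.log p / p * k p ≤ Real.log N + Real.log 4 := by
  refine le_trans (Finset.sum_le_sum fun p hp => ?_)
    (sum_log_div_card_residues_le Q hQ N P hPN hP hQP)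
  have hm : (0 : ℝ) < (residues p P).card := by exact_mod_cast (hP.image _).card_pos
  have hp0 : (0 : ℝ) < p := by exact_mod_cast (hQ p hp).pos
  rw [div_mul_eq_mul_div, div_le_div_iff₀ hp0 hm, mul_assoc]
  exact mul_le_mul_of_nonneg_left (hk p hp) (Real.log_natCast_nonneg p)

/-- The larger sieve for a set which occupies few residue classes modulo the good primes. -/
lemma exists_log_card_le : ∃ K : ℝ, 0 < K ∧
    ∀ (A₁ A₂ A₃ : Finset ℕ) (N n : ℕ), SievedTriple A₁ A₂ A₃ N n →
      ∀ P ⊆ Finset.Icc 1 N, P.Nonempty → P.card ≤ n → ∀ k : ℕ → ℝ,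
      (∀ p ∈ goodPrimes A₁ A₂ A₃ n, k p * (residues p P).card ≤ p ∧ 3 - 1 / 10 ^ 20 ≤ k p) →
      ∀ u : ℝ, 1 ≤ u →
      Real.log P.card ≤ Real.log u ∨
      3 * Real.log P.card ≤ 3 * Real.log u + 3 * Real.log n -
        ∑ p ∈ (goodPrimes A₁ A₂ A₃ n).filter (fun p : ℕ => (p : ℝ) ≤ u), Real.log p / p * k p +
          (2 / 10 ^ 20 * Real.log n + K) := by
  obtain ⟨K, hK, hG⟩ := exists_le_mertensWeight_goodPrimes
  refine ⟨3 * K + Real.log 4, by positivity, ?_⟩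
  intro A₁ A₂ A₃ N n h P hPN hP hPn k hk u hu
  have hPpos : (0 : ℝ) < P.card := by exact_mod_cast hP.card_pos
  rcases le_or_gt (P.card : ℝ) u with hle | hlt
  · exact Or.inl (Real.log_le_log hPpos hle)
  right
  set G := goodPrimes A₁ A₂ A₃ n with hGdef
  set G₀ := G.filter fun p : ℕ => (p : ℝ) ≤ u with hG₀
  set G₁ := G.filter fun p : ℕ => u < p ∧ (p : ℝ) ≤ P.card with hG₁
  have hdisj : Disjoint G₀ G₁ := by
    rw [Finset.disjoint_left]
    intro p h0 h1
    exact absurd (Finset.mem_filter.1 h0).2 (not_le.2 (Finset.mem_filter.1 h1).2.1)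
  have hGp : ∀ p ∈ G, p.Prime := fun p hp => (mem_goodPrimes.1 hp).2.prime
  have hsub : ∀ p ∈ G₀ ∪ G₁, p ∈ G := by
    intro p hp
    rcases Finset.mem_union.1 hp with hp | hp <;> exact (Finset.mem_filter.1 hp).1
  have hsieve := sum_mul_le_of_mul_card_residues_le (G₀ ∪ G₁) (fun p hp => hGp p (hsub p hp)) N P
    hPN hP (fun p hp => by
      rcases Finset.mem_union.1 hp with hp | hp
      · have := (Finset.mem_filter.1 hp).2
        exact_mod_cast this.trans hlt.le
      · exact_mod_cast (Finset.mem_filter.1 hp).2.2) k fun p hp => (hk p (hsub p hp)).1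
  rw [Finset.sum_union hdisj] at hsieve
  have hG₁_le : (3 - 1 / 10 ^ 20) * mertensWeight G₁ ≤ ∑ p ∈ G₁, Real.log p / p * k p := by
    rw [mertensWeight, Finset.mul_sum]
    refine Finset.sum_le_sum fun p hp => ?_
    rw [mul_comm]
    exact mul_le_mul_of_nonneg_left (hk p (Finset.mem_filter.1 hp).1).2
      (div_nonneg (Real.log_natCast_nonneg p) (Nat.cast_nonneg p))
  have hmass := (hG A₁ A₂ A₃ N n h P.card (by exact_mod_cast hP.card_pos)
    (by exact_mod_cast hPn)).2 u hu
  have h1 : (3 - 1 / 10 ^ 20) * (Real.log P.card - Real.log u - (1 / 10 ^ 48 * Real.log n + K)) ≤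
      (3 - 1 / 10 ^ 20) * mertensWeight G₁ := mul_le_mul_of_nonneg_left hmass (by norm_num)
  have hlog := h.log_le
  have hln := h.log_pos
  have hD : Real.log P.card ≤ Real.log n := Real.log_le_log hPpos (by exact_mod_cast hPn)
  have hu0 : 0 ≤ Real.log u := Real.log_nonneg hu
  linarith

/-- The cut-off below which primes are used to define the popular triples. -/
noncomputable def cutoff (n : ℕ) : ℝ := (n : ℝ) ^ ((1 : ℝ) / 2 - 1 / (3 * 10 ^ 6))

/-- The good primes below the cut-off. -/
noncomputable def smallGoodPrimes (A₁ A₂ A₃ : Finset ℕ) (n : ℕ) : Finset ℕ :=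
  (goodPrimes A₁ A₂ A₃ n).filter fun p : ℕ => (p : ℝ) ≤ cutoff n

/-- The triples whose total larger-sieve weight is above average. -/
noncomputable def richTriples (A₁ A₂ A₃ : Finset ℕ) (n : ℕ) : Finset (ℕ × ℕ × ℕ) :=
  (A₁ ×ˢ A₂ ×ˢ A₃).filter fun t =>
    (9 + 1 / (2 * 10 ^ 5)) * mertensWeight (smallGoodPrimes A₁ A₂ A₃ n) ≤
      ∑ p ∈ smallGoodPrimes A₁ A₂ A₃ n, Real.log p / p * pairWeight A₂ A₃ p (t.2.1 + t.2.2) +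
      ∑ p ∈ smallGoodPrimes A₁ A₂ A₃ n,
        Real.log p / p * tripleWeight A₁ A₂ A₃ p (t.1 + (t.2.1 + t.2.2))

lemma mem_smallGoodPrimes {A₁ A₂ A₃ : Finset ℕ} {n p : ℕ}
    (hp : p ∈ smallGoodPrimes A₁ A₂ A₃ n) : NearExtremal A₁ A₂ A₃ p :=
  (mem_goodPrimes.1 (Finset.mem_filter.1 hp).1).2

lemma SievedTriple.le_card_richTriples {A₁ A₂ A₃ : Finset ℕ} {N n : ℕ}
    (h : SievedTriple A₁ A₂ A₃ N n) (hW : 0 < mertensWeight (smallGoodPrimes A₁ A₂ A₃ n)) :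
    1 / 10 ^ 20 * (A₁.card * A₂.card * A₃.card : ℝ) ≤ (richTriples A₁ A₂ A₃ n).card := by
  set G := smallGoodPrimes A₁ A₂ A₃ n with hG
  set W := mertensWeight G with hWdef
  set F := richTriples A₁ A₂ A₃ n with hF
  set m : ℝ := A₁.card * A₂.card * A₃.card with hm
  set g : ℕ × ℕ × ℕ → ℝ := fun t =>
    ∑ p ∈ G, Real.log p / p * pairWeight A₂ A₃ p (t.2.1 + t.2.2) +
      ∑ p ∈ G, Real.log p / p * tripleWeight A₁ A₂ A₃ p (t.1 + (t.2.1 + t.2.2)) with hg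
  have hw : ∀ p : ℕ, 0 ≤ Real.log p / p := fun p =>
    div_nonneg (Real.log_natCast_nonneg p) (Nat.cast_nonneg p)
  have hcard : ((A₁ ×ˢ A₂ ×ˢ A₃).card : ℝ) = m := by
    rw [Finset.card_product, Finset.card_product]
    push_cast
    ring
  have hlow : (9 + 1 / 10 ^ 5) * m * W ≤ ∑ t ∈ A₁ ×ˢ A₂ ×ˢ A₃, g t := by
    have e : ∑ t ∈ A₁ ×ˢ A₂ ×ˢ A₃, g t = ∑ p ∈ G, Real.log p / p *
        ∑ t ∈ A₁ ×ˢ A₂ ×ˢ A₃, (pairWeight A₂ A₃ p (t.2.1 + t.2.2) +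
          tripleWeight A₁ A₂ A₃ p (t.1 + (t.2.1 + t.2.2))) := by
      simp only [hg, ← Finset.sum_add_distrib, ← mul_add, Finset.mul_sum]
      exact Finset.sum_comm
    rw [e, hWdef, mertensWeight, Finset.mul_sum]
    refine Finset.sum_le_sum fun p hp => ?_
    rw [mul_comm]
    refine mul_le_mul_of_nonneg_left ?_ (hw p)
    simp_rw [Finset.sum_product]
    exact (mem_smallGoodPrimes hp).mul_card_le_sum h.nonempty₁ h.nonempty₂ h.nonempty₃
  have hup : ∀ t, g t ≤ 2 * 10 ^ 14 * W := by
    intro t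
    have hle : ∀ f : ℕ → ℝ, (∀ p ∈ G, f p ≤ 10 ^ 14) →
        ∑ p ∈ G, Real.log p / p * f p ≤ 10 ^ 14 * W := by
      intro f hf
      rw [hWdef, mertensWeight, Finset.mul_sum]
      refine Finset.sum_le_sum fun p hp => ?_
      rw [mul_comm]
      exact mul_le_mul_of_nonneg_right (hf p hp) (hw p)
    have a := hle (fun p => pairWeight A₂ A₃ p (t.2.1 + t.2.2)) fun p hp => by
      have : Fact p.Prime := ⟨(mem_smallGoodPrimes hp).prime⟩
      exact capWeight_le _ _ _
    have b := hle (fun p => tripleWeight A₁ A₂ A₃ p (t.1 + (t.2.1 + t.2.2))) fun p hp => by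
      have : Fact p.Prime := ⟨(mem_smallGoodPrimes hp).prime⟩
      exact capWeight_le _ _ _
    simp only [hg]
    linarith
  have hsplit : ∑ t ∈ A₁ ×ˢ A₂ ×ˢ A₃, g t ≤
      F.card * (2 * 10 ^ 14 * W) + m * ((9 + 1 / (2 * 10 ^ 5)) * W) := by
    rw [← Finset.sum_filter_add_sum_filter_not (A₁ ×ˢ A₂ ×ˢ A₃)
      fun t => (9 + 1 / (2 * 10 ^ 5)) * W ≤ g t]
    refine add_le_add ?_ ?_
    · rw [← nsmul_eq_mul]
      exact Finset.sum_le_card_nsmul _ _ _ fun t _ => hup t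
    · refine (Finset.sum_le_card_nsmul _ _ ((9 + 1 / (2 * 10 ^ 5)) * W) fun t ht => ?_).trans ?_
      · exact (not_le.1 (Finset.mem_filter.1 ht).2).le
      · rw [nsmul_eq_mul]
        refine mul_le_mul_of_nonneg_right ?_ (by positivity)
        rw [← hcard]
        exact_mod_cast Finset.card_filter_le _ _
  have hm0 : 0 ≤ m := by positivity
  have key : (9 + 1 / 10 ^ 5) * m ≤ F.card * (2 * 10 ^ 14) + m * (9 + 1 / (2 * 10 ^ 5)) := by
    refine le_of_mul_le_mul_right ?_ hW
    linarith
  linarith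

/-- No integer has too many representations as a sum of a rich triple. -/
lemma exists_card_fiber_richTriples_le : ∃ K : ℝ, 0 < K ∧
    ∀ (A₁ A₂ A₃ : Finset ℕ) (N n : ℕ), SievedTriple A₁ A₂ A₃ N n → ∀ s : ℕ,
      (((richTriples A₁ A₂ A₃ n).filter fun t => t.1 + t.2.1 + t.2.2 = s).card : ℝ) ≤
        Real.exp ((3 / 2 - 1 / (6 * 10 ^ 6)) * Real.log n + K) := by
  obtain ⟨K, hK, hG⟩ := exists_le_mertensWeight_goodPrimes
  obtain ⟨K', hK', hsieve⟩ := exists_log_card_le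
  refine ⟨10 * K + K', by positivity, fun A₁ A₂ A₃ N n h s => ?_⟩
  set G := goodPrimes A₁ A₂ A₃ n with hGdef
  set T := (richTriples A₁ A₂ A₃ n).filter fun t => t.1 + t.2.1 + t.2.2 = s with hT
  have hln := h.log_pos
  have hn0 : (0 : ℝ) < n := by exact_mod_cast (by linarith [h.two_le] : 0 < n)
  have hn1 : (1 : ℝ) ≤ n := by exact_mod_cast (by linarith [h.two_le] : 1 ≤ n)
  have hu : 1 ≤ cutoff n := Real.one_le_rpow hn1 (by norm_num)
  have hlogu : Real.log (cutoff n) = ((1 : ℝ) / 2 - 1 / (3 * 10 ^ 6)) * Real.log n :=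
    Real.log_rpow hn0 _
  have hun : cutoff n ≤ n := Real.rpow_le_self_of_one_le hn1 (by norm_num)
  have hW := (hG A₁ A₂ A₃ N n h (cutoff n) hu hun).1
  rw [hlogu] at hW
  have memT : ∀ t ∈ T, t.1 ∈ A₁ ∧ t.2.1 ∈ A₂ ∧ t.2.2 ∈ A₃ ∧ t.1 + t.2.1 + t.2.2 = s ∧
      (9 + 1 / (2 * 10 ^ 5)) * mertensWeight (smallGoodPrimes A₁ A₂ A₃ n) ≤
      ∑ p ∈ smallGoodPrimes A₁ A₂ A₃ n, Real.log p / p * pairWeight A₂ A₃ p (t.2.1 + t.2.2) +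
      ∑ p ∈ smallGoodPrimes A₁ A₂ A₃ n,
        Real.log p / p * tripleWeight A₁ A₂ A₃ p (t.1 + (t.2.1 + t.2.2)) := by
    intro t ht
    simp only [hT, richTriples, Finset.mem_filter, Finset.mem_product] at ht
    exact ⟨ht.1.1.1, ht.1.1.2.1, ht.1.1.2.2, ht.2, ht.1.2⟩
  set P := T.image Prod.fst with hP
  rcases T.eq_empty_or_nonempty with hemp | hne
  · rw [hemp, Finset.card_empty, Nat.cast_zero]
    positivity
  have hPne : P.Nonempty := hne.image _
  have hPA : P ⊆ A₁ := by
    intro a ha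
    obtain ⟨t, ht, rfl⟩ := Finset.mem_image.1 ha
    exact (memT t ht).1
  have hPpos : (0 : ℝ) < P.card := by exact_mod_cast hPne.card_pos
  have hPn : P.card ≤ n := h.card₁ ▸ Finset.card_le_card hPA
  have fiber : ∀ a ∈ P, (P.card : ℝ) * ((T.filter fun t => t.1 = a).card : ℝ) ≤
      Real.exp ((3 / 2 - 1 / (6 * 10 ^ 6)) * Real.log n + (10 * K + K')) := by
    intro a ha
    set R := (T.filter fun t => t.1 = a).image fun t => t.2.1 with hR
    have cardR : R.card = (T.filter fun t => t.1 = a).card := by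
      refine Finset.card_image_of_injOn ?_
      rintro ⟨x, y, z⟩ hx ⟨x', y', z'⟩ hx' e
      simp only [Finset.coe_filter, Set.mem_ofPred_eq] at hx hx' e
      have e₁ := (memT _ hx.1).2.2.2.1
      have e₂ := (memT _ hx'.1).2.2.2.1
      simp only at e₁ e₂
      obtain ⟨_, rfl⟩ := hx
      obtain ⟨_, rfl⟩ := hx'
      subst e
      have : z = z' := by omega
      rw [this]
    obtain ⟨t, ht, rfl⟩ := Finset.mem_image.1 ha
    obtain ⟨ht₁, ht₂, ht₃, hts, htF⟩ := memT t ht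
    have memR : ∀ y ∈ R, y ∈ A₂ ∧ ∃ z ∈ A₃, y + z = t.2.1 + t.2.2 := by
      intro y hy
      obtain ⟨t', ht', rfl⟩ := Finset.mem_image.1 hy
      obtain ⟨ht', e⟩ := Finset.mem_filter.1 ht'
      obtain ⟨_, h₂, h₃, hs, _⟩ := memT t' ht'
      exact ⟨h₂, t'.2.2, h₃, by omega⟩
    have hRne : R.Nonempty := ⟨t.2.1, by
      rw [hR]
      exact Finset.mem_image_of_mem _ (by simp [ht])⟩
    have hRA : R ⊆ A₂ := fun y hy => (memR y hy).1
    have hRpos : (0 : ℝ) < R.card := by exact_mod_cast hRne.card_pos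
    have hRn : R.card ≤ n := h.card₂ ▸ Finset.card_le_card hRA
    have memP : ∀ x ∈ P, ∃ y ∈ A₂, ∃ z ∈ A₃, x + (y + z) = t.1 + (t.2.1 + t.2.2) := by
      intro x hx
      obtain ⟨t', ht', rfl⟩ := Finset.mem_image.1 hx
      obtain ⟨_, h₂, h₃, hs, _⟩ := memT t' ht'
      exact ⟨_, h₂, _, h₃, by omega⟩
    have sP := hsieve A₁ A₂ A₃ N n h P (hPA.trans h.subset₁) hPne hPn
      (fun p => tripleWeight A₁ A₂ A₃ p (t.1 + (t.2.1 + t.2.2)))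
      (fun p hp => ⟨tripleWeight_mul_card_residues_le (mem_goodPrimes.1 hp).2.prime hPne hPA memP,
        (mem_goodPrimes.1 hp).2.le_tripleWeight h.nonempty₁ h.nonempty₂ h.nonempty₃ _⟩)
      (cutoff n) hu
    have sR := hsieve A₁ A₂ A₃ N n h R (hRA.trans h.subset₂) hRne hRn
      (fun p => pairWeight A₂ A₃ p (t.2.1 + t.2.2))
      (fun p hp => ⟨pairWeight_mul_card_residues_le (mem_goodPrimes.1 hp).2.prime hRne hRA
          fun y hy => (memR y hy).2,
        (mem_goodPrimes.1 hp).2.le_pairWeight h.nonempty₁ h.nonempty₂ h.nonempty₃ _⟩)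
      (cutoff n) hu
    rw [hlogu] at sP sR
    have lP : Real.log P.card ≤ Real.log n := Real.log_le_log hPpos (by exact_mod_cast hPn)
    have lR : Real.log R.card ≤ Real.log n := Real.log_le_log hRpos (by exact_mod_cast hRn)
    have hW' : (9 + 1 / (2 * 10 ^ 5)) * (((1 : ℝ) / 2 - 1 / (3 * 10 ^ 6)) * Real.log n -
        (1 / 10 ^ 48 * Real.log n + K)) ≤
        (9 + 1 / (2 * 10 ^ 5)) * mertensWeight (smallGoodPrimes A₁ A₂ A₃ n) :=
      mul_le_mul_of_nonneg_left hW (by norm_num)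
    rw [← cardR, ← Real.log_le_iff_le_exp (by positivity), Real.log_mul hPpos.ne' hRpos.ne']
    simp only [smallGoodPrimes] at htF hW'
    rcases sP with sP | sP
    · linarith
    · rcases sR with sR | sR
      · linarith
      · linarith
  have hsum : (T.card : ℝ) = ∑ a ∈ P, ((T.filter fun t => t.1 = a).card : ℝ) := by
    exact_mod_cast Finset.card_eq_sum_card_image Prod.fst T
  refine le_of_mul_le_mul_left ?_ hPpos
  rw [hsum, Finset.mul_sum, ← nsmul_eq_mul]
  exact Finset.sum_le_card_nsmul _ _ _ fiber

/-- A fourth moment bound at scale `n = exp l` with a power saving forces `l` to be bounded. -/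
lemma exists_le_of_fourth_moment_bound {ρ g : ℝ} (K : ℝ) (hρ : 0 < ρ) (hg0 : 0 < g)
    (hg1 : g < 1) : ∃ Λ : ℝ, 0 ≤ Λ ∧ ∀ l n N s t : ℝ, 1 < l → Real.exp l = n → 0 ≤ t →
      t ≤ n ^ 3 → 0 ≤ N → N ≤ Real.exp ((3 + g / 4) * l) →
      g / 16 * Real.exp ((3 / 4 - g / 8) * l) ≤ s →
      (ρ * n ^ 3 * s) ^ 4 ≤ t ^ 3 * (Real.exp ((3 / 2 - g) * l + K) *
        (10 * s ^ 2 * (3 * N + 1 + 2 * n ^ 3 * (1 + 3 * l)))) → l ≤ Λ := by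
  set C : ℝ := 60 * Real.exp K / (ρ ^ 4 * (g / 16) ^ 2) with hC
  have hC0 : 0 < C := by positivity
  refine ⟨16 * C / g ^ 2, by positivity, ?_⟩
  intro l n N s t hl1 hexp ht0 ht hN0 hNE hs hmoment
  by_contra! hlC
  rw [div_lt_iff₀ (by positivity)] at hlC
  have hn0 : 0 < n := by rw [← hexp]; exact Real.exp_pos _
  have hs0 : 0 < s := lt_of_lt_of_le (by positivity) hs
  set u := Real.exp ((3 / 4 - g / 8) * l) with hu
  set E := Real.exp ((3 + g / 4) * l) with hE
  have hnE : n ^ 3 ≤ E := by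
    rw [← hexp, ← Real.exp_nat_mul]
    refine Real.exp_le_exp.2 ?_
    push_cast
    linarith [mul_pos hg0 (by linarith : 0 < l)]
  have hE1 : 1 ≤ E := Real.one_le_exp (mul_nonneg (by linarith) (by linarith))
  have hbig : (3 * N + 1 + 2 * n ^ 3 * (1 + 3 * l)) ≤ 6 * E * (1 + l) := by
    have : n ^ 3 * (1 + 3 * l) ≤ E * (1 + 3 * l) :=
      mul_le_mul_of_nonneg_right hnE (by linarith)
    linarith [mul_pos (by linarith : 0 < E) (by linarith : 0 < l)]
  set B := Real.exp ((3 / 2 - g) * l + K) with hB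
  have h1 : ρ ^ 4 * n ^ 12 * s ^ 4 ≤
      n ^ 9 * (B * (10 * s ^ 2 * (6 * E * (1 + l)))) := by
    calc ρ ^ 4 * n ^ 12 * s ^ 4 = (ρ * n ^ 3 * s) ^ 4 := by ring
      _ ≤ _ := hmoment
      _ ≤ (n ^ 3) ^ 3 * (B * (10 * s ^ 2 * (6 * E * (1 + l)))) := by gcongr
      _ = _ := by ring
  have h2 : ρ ^ 4 * n ^ 3 * s ^ 2 ≤ 60 * B * E * (1 + l) := by
    have hpos : (0 : ℝ) < n ^ 9 * s ^ 2 := by positivity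
    refine le_of_mul_le_mul_right ?_ hpos
    linarith
  have h3 : ρ ^ 4 * n ^ 3 * (g / 16 * u) ^ 2 ≤ 60 * B * E * (1 + l) :=
    le_trans (by gcongr) h2
  have h4 : ρ ^ 4 * (g / 16) ^ 2 * Real.exp (g / 2 * l) ≤ 60 * Real.exp K * (1 + l) := by
    have e₁ : n ^ 3 * u ^ 2 =
        Real.exp (g / 2 * l) * Real.exp ((9 / 2 - 3 * g / 4) * l) := by
      rw [← hexp, hu, ← Real.exp_nat_mul, ← Real.exp_nat_mul, ← Real.exp_add, ← Real.exp_add]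
      congr 1
      push_cast
      ring
    have e₂ : B * E = Real.exp K * Real.exp ((9 / 2 - 3 * g / 4) * l) := by
      rw [hB, hE, ← Real.exp_add, ← Real.exp_add]
      congr 1
      ring
    refine le_of_mul_le_mul_right ?_ (Real.exp_pos ((9 / 2 - 3 * g / 4) * l))
    calc _ = ρ ^ 4 * (g / 16) ^ 2 * (n ^ 3 * u ^ 2) := by rw [e₁]; ring
      _ = ρ ^ 4 * n ^ 3 * (g / 16 * u) ^ 2 := by ring
      _ ≤ 60 * B * E * (1 + l) := h3
      _ = 60 * (B * E) * (1 + l) := by ring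
      _ = _ := by rw [e₂]; ring
  have h5 : Real.exp (g / 2 * l) ≤ C * (1 + l) := by
    rw [hC, div_mul_eq_mul_div (60 * _), le_div_iff₀ (by positivity), mul_comm]
    exact h4
  have h6 := Real.quadratic_le_exp_of_nonneg (x := g / 2 * l)
    (mul_nonneg (by linarith) (by linarith))
  have h7 : C * (1 + l) ≤ C * (2 * l) := mul_le_mul_of_nonneg_left (by linarith) hC0.le
  have h8 : 16 * C * l < l * g ^ 2 * l := mul_lt_mul_of_pos_right hlC (by linarith)
  have h9 : 0 ≤ g / 2 * l := mul_nonneg (by linarith) (by linarith)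
  nlinarith

/-- There are no sieved triples of large sets. -/
lemma exists_log_le_of_sievedTriple : ∃ Λ : ℝ, 1 ≤ Λ ∧
    ∀ (A₁ A₂ A₃ : Finset ℕ) (N n : ℕ), SievedTriple A₁ A₂ A₃ N n → Real.log n ≤ Λ := by
  obtain ⟨K, hK, hG⟩ := exists_le_mertensWeight_goodPrimes
  obtain ⟨K', hK', hfib⟩ := exists_card_fiber_richTriples_le
  obtain ⟨ρ, hρ, hfour⟩ := exists_large_sum_phase (1 / 10 ^ 20) (by positivity)
  obtain ⟨g, hg⟩ : ∃ g : ℝ, g = 1 / (6 * 10 ^ 6) := ⟨_, rfl⟩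
  rw [← hg] at hfib
  have hg0 : 0 < g := by rw [hg]; positivity
  have hg1 : g < 1 := by rw [hg]; norm_num
  obtain ⟨Λ, hΛ0, hΛ⟩ := exists_le_of_fourth_moment_bound K' hρ hg0 hg1
  refine ⟨1 + 10 * K + 32 * K / g + Λ, ?_, fun A₁ A₂ A₃ N n h => ?_⟩
  · have : 0 ≤ 10 * K + 32 * K / g + Λ := by positivity
    linarith
  by_contra! hlt
  obtain ⟨l, hl⟩ : ∃ l, l = Real.log n := ⟨_, rfl⟩
  rw [← hl] at hlt
  have q₁ : 0 ≤ 32 * K / g := by positivity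
  have hl1 : 1 < l := by linarith
  have hlK : 10 * K < l := by linarith
  have hlg : 32 * K < l * g := by
    rw [← div_lt_iff₀ hg0]
    linarith
  have hn0 : (0 : ℝ) < n := by exact_mod_cast (by linarith [h.two_le] : 0 < n)
  have hn1 : (1 : ℝ) ≤ n := by exact_mod_cast (by linarith [h.two_le] : 1 ≤ n)
  have hexp : Real.exp l = n := by rw [hl, Real.exp_log hn0]
  set G := goodPrimes A₁ A₂ A₃ n with hGdef
  -- the rich triples are dense
  have hW : 0 < mertensWeight (smallGoodPrimes A₁ A₂ A₃ n) := by
    have hun : cutoff n ≤ n := Real.rpow_le_self_of_one_le hn1 (by norm_num)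
    have a := (hG A₁ A₂ A₃ N n h (cutoff n) (Real.one_le_rpow hn1 (by norm_num)) hun).1
    rw [cutoff, Real.log_rpow hn0] at a
    refine lt_of_lt_of_le ?_ a
    rw [← hl]
    linarith
  have hT := h.le_card_richTriples hW
  set T := richTriples A₁ A₂ A₃ n with hTdef
  have hTsub : T ⊆ A₁ ×ˢ A₂ ×ˢ A₃ := Finset.filter_subset _ _
  -- the primes just below `n ^ (3 / 4)`
  set u := Real.exp ((3 / 4 - g / 8) * l) with hu
  set v := Real.exp (3 / 4 * l) with hv
  have hu1 : 1 ≤ u := Real.one_le_exp (mul_nonneg (by linarith) (by linarith))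
  have hv1 : 1 ≤ v := Real.one_le_exp (by linarith)
  have hvn : v ≤ n := by
    rw [← hexp]
    exact Real.exp_le_exp.2 (by linarith)
  set S := G.filter fun p : ℕ => u < p ∧ (p : ℝ) ≤ v with hS
  have hmass := (hG A₁ A₂ A₃ N n h v hv1 hvn).2 u hu1
  rw [hu, hv, Real.log_exp, Real.log_exp] at hmass
  rw [← hu, ← hv] at hmass
  have hSgood : ∀ p ∈ S, NearExtremal A₁ A₂ A₃ p := fun p hp =>
    (mem_goodPrimes.1 (Finset.mem_filter.1 hp).1).2
  have hmass_le : mertensWeight S ≤ S.card * (l / u) := by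
    rw [mertensWeight, ← nsmul_eq_mul]
    refine Finset.sum_le_card_nsmul _ _ _ fun p hp => ?_
    obtain ⟨hpG, hup, -⟩ := Finset.mem_filter.1 hp
    have hp0 : (0 : ℝ) < p := by linarith
    have hpn : (p : ℝ) ≤ n := by exact_mod_cast (mem_goodPrimes.1 hpG).1
    have := Real.log_le_log hp0 hpn
    rw [← hl] at this
    gcongr
  have hScard : g / 16 * u ≤ S.card := by
    have a : g / 16 * l ≤ S.card * (l / u) := by
      refine le_trans ?_ (hmass.trans hmass_le)
      have small : 1 / 10 ^ 48 * l ≤ g / 32 * l :=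
        mul_le_mul_of_nonneg_right (by rw [hg]; norm_num) (by linarith)
      rw [← hl]
      linarith
    have b : S.card * (l / u) = S.card / u * l := by ring
    rw [b] at a
    exact (le_div_iff₀ (by linarith)).1 (le_of_mul_le_mul_right a (by linarith))
  -- large Fourier coefficients
  have hexist : ∀ p, ∃ r : ℤ, p ∈ S → ¬ (p : ℤ) ∣ r ∧
      ρ * (A₁.card * A₂.card * A₃.card : ℝ) ≤
        ‖∑ t ∈ T, phase (r / p * (t.1 + t.2.1 + t.2.2 : ℕ))‖ := by
    intro p
    by_cases hp : p ∈ S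
    · obtain ⟨r, hr⟩ := hfour A₁ A₂ A₃ p (hSgood p hp) h.nonempty₁ h.nonempty₂ h.nonempty₃ T
        hTsub hT
      exact ⟨r, fun _ => hr⟩
    · exact ⟨0, fun hp' => absurd hp' hp⟩
  choose r hr using hexist
  have hA : (A₁.card * A₂.card * A₃.card : ℝ) = n ^ 3 := by
    rw [h.card₁, h.card₂, h.card₃]
    ring
  have hmoment := pow_four_le_of_large_sums T (fun t => t.1 + t.2.1 + t.2.2) (3 * N + 1)
    (by
      intro t ht
      have ht := hTsub ht
      simp only [Finset.mem_product] at ht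
      have a := Finset.mem_Icc.1 (h.subset₁ ht.1)
      have b := Finset.mem_Icc.1 (h.subset₂ ht.2.1)
      have c := Finset.mem_Icc.1 (h.subset₃ ht.2.2)
      omega) _ (hfib A₁ A₂ A₃ N n h) S (fun p hp => (hSgood p hp).prime) r
    (fun p hp => (hr p hp).1) (n ^ 3) (by have := h.two_le; positivity)
    (by
      intro p hp
      have hpv := (Finset.mem_filter.1 hp).2.2
      have : (p : ℝ) ^ (4 : ℕ) ≤ (n : ℝ) ^ (3 : ℕ) := by
        calc (p : ℝ) ^ (4 : ℕ) ≤ v ^ (4 : ℕ) := by gcongr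
          _ = (n : ℝ) ^ (3 : ℕ) := by
            rw [hv, ← hexp, ← Real.exp_nat_mul, ← Real.exp_nat_mul]
            congr 1
            push_cast
            ring
      exact_mod_cast this)
    (η := ρ * n ^ 3) (by positivity) (fun p hp => by rw [← hA]; exact (hr p hp).2)
  push_cast at hmoment
  rw [Real.log_pow, ← hl] at hmoment
  push_cast at hmoment
  -- comparison of sizes
  have hTcard : (T.card : ℝ) ≤ n ^ 3 := by
    have := Finset.card_le_card hTsub
    rw [Finset.card_product, Finset.card_product, ← mul_assoc] at this
    rw [← hA]
    exact_mod_cast this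
  have hN0 : 0 < N := by
    obtain ⟨a, ha⟩ := h.nonempty₁
    have := Finset.mem_Icc.1 (h.subset₁ ha)
    omega
  have hNE : (N : ℝ) ≤ Real.exp ((3 + g / 4) * l) := by
    rw [← Real.log_le_iff_le_exp (by exact_mod_cast hN0), hl]
    refine h.log_le.trans ?_
    refine mul_le_mul_of_nonneg_right ?_ (by linarith)
    rw [hg]
    norm_num
  have := hΛ l n N S.card T.card hl1 hexp (by positivity) hTcard (by positivity) hNE hScard hmoment
  linarith

lemma exists_sievedTriple_of_prime_sums {A₁ A₂ A₃ : Finset ℕ} {N n : ℕ} (hn : 2 ≤ n)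
    (h₁ : A₁ ⊆ Finset.Icc 1 N) (h₂ : A₂ ⊆ Finset.Icc 1 N) (h₃ : A₃ ⊆ Finset.Icc 1 N)
    (c₁ : 2 * n ≤ A₁.card) (c₂ : n ≤ A₂.card) (c₃ : n ≤ A₃.card)
    (hlog : Real.log N ≤ (3 + 1 / 10 ^ 100) * Real.log n)
    (hprime : ∀ a₁ ∈ A₁, ∀ a₂ ∈ A₂, ∀ a₃ ∈ A₃, (a₁ + a₂ + a₃).Prime) :
    ∃ B₁ B₂ B₃ : Finset ℕ, SievedTriple B₁ B₂ B₃ N n := by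
  have hfilter : n ≤ (A₁.filter (n ≤ ·)).card := by
    have a := Finset.card_filter_add_card_filter_not (s := A₁) (n ≤ ·)
    have b : (A₁.filter fun a => ¬ n ≤ a).card ≤ n := by
      rw [← Finset.card_range n]
      refine Finset.card_le_card fun a ha => ?_
      simpa using (Finset.mem_filter.1 ha).2
    omega
  obtain ⟨B₁, hB₁, d₁⟩ := Finset.exists_subset_card_eq hfilter
  obtain ⟨B₂, hB₂, d₂⟩ := Finset.exists_subset_card_eq c₂
  obtain ⟨B₃, hB₃, d₃⟩ := Finset.exists_subset_card_eq c₃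
  refine ⟨B₁, B₂, B₃, hn, (hB₁.trans (Finset.filter_subset _ _)).trans h₁, hB₂.trans h₂,
    hB₃.trans h₃, d₁, d₂, d₃, hlog, ?_⟩
  intro p hp hpn a₁ ha₁ a₂ ha₂ a₃ ha₃ hdvd
  obtain ⟨m₁, hna⟩ := Finset.mem_filter.1 (hB₁ ha₁)
  have := (Nat.prime_dvd_prime_iff_eq hp (hprime a₁ m₁ a₂ (hB₂ ha₂) a₃ (hB₃ ha₃))).1 hdvd
  have := Finset.mem_Icc.1 (h₂ (hB₂ ha₂))
  omega

theorem inverse_ternary_goldbach :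
    ∃ (c : ℝ), c > 0 ∧ ∃ N₀ : ℕ, ∀ N : ℕ, N ≥ N₀ →
      ∀ A₁ A₂ A₃ : Finset ℕ,
        A₁ ⊆ Finset.Icc 1 N → A₂ ⊆ Finset.Icc 1 N → A₃ ⊆ Finset.Icc 1 N →
        (A₁.card : ℝ) ≥ (N : ℝ) ^ ((1:ℝ)/3 - c) →
        (A₂.card : ℝ) ≥ (N : ℝ) ^ ((1:ℝ)/3 - c) →
        (A₃.card : ℝ) ≥ (N : ℝ) ^ ((1:ℝ)/3 - c) →
        ∃ n : ℕ, (∃ a₁ ∈ A₁, ∃ a₂ ∈ A₂, ∃ a₃ ∈ A₃, n = a₁ + a₂ + a₃) ∧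
          1 < n ∧ ¬ n.Prime := by
  obtain ⟨Λ, hΛ1, hΛ⟩ := exists_log_le_of_sievedTriple
  refine ⟨1 / 10 ^ 102, by positivity, ⌈Real.exp (10 ^ 103 * (Λ + 2))⌉₊, ?_⟩
  intro N hN A₁ A₂ A₃ h₁ h₂ h₃ c₁ c₂ c₃
  by_contra! hno
  have hprime : ∀ a₁ ∈ A₁, ∀ a₂ ∈ A₂, ∀ a₃ ∈ A₃, (a₁ + a₂ + a₃).Prime := by
    intro a₁ ha₁ a₂ ha₂ a₃ ha₃
    refine hno _ ⟨a₁, ha₁, a₂, ha₂, a₃, ha₃, rfl⟩ ?_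
    have := Finset.mem_Icc.1 (h₁ ha₁)
    have := Finset.mem_Icc.1 (h₂ ha₂)
    omega
  have hexpN : Real.exp (10 ^ 103 * (Λ + 2)) ≤ N := Nat.ceil_le.1 hN
  have hN0 : (0 : ℝ) < N := (Real.exp_pos _).trans_le hexpN
  have hlogN : 10 ^ 103 * (Λ + 2) ≤ Real.log N := (Real.le_log_iff_exp_le hN0).2 hexpN
  set x : ℝ := (N : ℝ) ^ ((1:ℝ)/3 - 1 / 10 ^ 102) with hx
  have hx0 : 0 < x := Real.rpow_pos_of_pos hN0 _
  have hlogx : Real.log x = ((1:ℝ)/3 - 1 / 10 ^ 102) * Real.log N := Real.log_rpow hN0 _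
  have hlog4 : Real.log 4 < 2 := by
    rw [show (4 : ℝ) = 2 ^ 2 by norm_num, Real.log_pow]
    push_cast
    linarith [Real.log_two_lt_d9]
  have hx4 : 4 ≤ x := by
    rw [← Real.log_le_log_iff (by norm_num) hx0, hlogx]
    linarith
  have hfloor : x / 4 ≤ (⌊x / 2⌋₊ : ℝ) := by linarith [Nat.lt_floor_add_one (x / 2)]
  have hle : (⌊x / 2⌋₊ : ℝ) ≤ x / 2 := Nat.floor_le (by linarith)
  have hlogn : Real.log x - Real.log 4 ≤ Real.log (⌊x / 2⌋₊ : ℝ) := by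
    rw [← Real.log_div hx0.ne' (by norm_num)]
    exact Real.log_le_log (by positivity) hfloor
  have hcard : ∀ A : Finset ℕ, (A.card : ℝ) ≥ x → 2 * ⌊x / 2⌋₊ ≤ A.card := by
    intro A hA
    have : (2 : ℝ) * ⌊x / 2⌋₊ ≤ A.card := by linarith
    exact_mod_cast this
  obtain ⟨B₁, B₂, B₃, hB⟩ := exists_sievedTriple_of_prime_sums
    (n := ⌊x / 2⌋₊) (Nat.le_floor (by push_cast; linarith)) h₁ h₂ h₃ (hcard _ c₁)
    (by linarith [hcard _ c₂]) (by linarith [hcard _ c₃])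
    (by rw [hlogx] at hlogn; linarith) hprime
  have := hΛ _ _ _ _ _ hB
  rw [hlogx] at hlogn
  linarith
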